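/- arXiv:math/9904151 — 2 statements merged into one kernel-verified Lean document; each statement's English description precedes it below -/
import Mathlib

section
/- Let v = (G, F) be a holomorphic vector field on a neighborhood of 0 in ℂ^{n−1} × ℂ (coordinates (y, t)) with v(0) = 0, and let A = Dv(0) have eigenvalues b_1, …, b_n. Assume the vector e = (0, …, 0, 1) (the t-direction) is an eigenvector of A with eigenvalue b_n, and that b_n/b_i ∉ ℝ for every i ≠ n. Then there exists a unique germ at 0 of a holomorphic map q : (ℂ, 0) → ℂ^{n−1} with q(0) = 0 and q′(0) = 0 such that G(q(t), t) = q′(t)·F(q(t), t) for all t near 0; i.e. there is a unique separatrix of v at 0 tangent to the eigenline ℂe, and it is the graph of q. -/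
noncomputable section

open Complex Set Polynomial

section Separatrix

open Filter Topology Metric

variable {E : Type*} [NormedAddCommGroup E] [NormedSpace ℂ E]

lemma norm_le_div_of_smul_deriv_add {N : ℕ} (hN : 0 < N) {ρ K : ℝ} {z f : ℂ → E}
    (hz : ∀ t ∈ ball (0 : ℂ) ρ, DifferentiableAt ℂ z t)
    (hzf : ∀ t ∈ ball (0 : ℂ) ρ, t • deriv z t + (N : ℂ) • z t = f t)
    (hf : ∀ t ∈ ball (0 : ℂ) ρ, ‖f t‖ ≤ K) {t : ℂ} (ht : t ∈ ball (0 : ℂ) ρ) :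
    ‖z t‖ ≤ K / N := by
  obtain ⟨n, rfl⟩ : ∃ n, N = n + 1 := ⟨N - 1, by omega⟩
  have hmem : ∀ σ ∈ Icc (0 : ℝ) 1, (σ : ℂ) * t ∈ ball (0 : ℂ) ρ := by
    intro σ hσ
    rw [mem_ball_zero_iff] at ht ⊢
    rw [norm_mul, norm_real, Real.norm_of_nonneg hσ.1]
    nlinarith [norm_nonneg t, hσ.1, hσ.2]
  have hg : ∀ σ ∈ Icc (0 : ℝ) 1, HasDerivAt (fun σ : ℝ => (σ : ℂ) ^ (n + 1) • z (σ * t))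
      ((σ : ℂ) ^ n • f (σ * t)) σ := by
    intro σ hσ
    have h1 : HasDerivAt (fun s : ℂ => s ^ (n + 1) • z (s * t))
        ((σ : ℂ) ^ n • f (σ * t)) (σ : ℂ) := by
      have h2 := (hasDerivAt_pow (n + 1) (σ : ℂ)).smul
        (HasDerivAt.scomp (σ : ℂ) (hz _ (hmem σ hσ)).hasDerivAt
          ((hasDerivAt_id (σ : ℂ)).mul_const t))
      refine HasDerivAt.congr_deriv h2 ?_
      rw [← hzf _ (hmem σ hσ)]
      simp only [smul_add, smul_smul, Function.comp, id]
      congr 1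
      · congr 1; ring
      · rw [Nat.add_sub_cancel, mul_comm]
    exact (HasDerivAt.scomp σ h1 ofRealCLM.hasDerivAt).congr_deriv (by simp)
  have hB : ∀ x : ℝ, HasDerivAt (fun σ : ℝ => K * σ ^ (n + 1) / (n + 1 : ℕ)) (K * x ^ n) x := by
    intro x
    have := ((hasDerivAt_pow (n + 1) x).const_mul K).div_const ((n + 1 : ℕ) : ℝ)
    refine this.congr_deriv ?_
    have : ((n + 1 : ℕ) : ℝ) ≠ 0 := by positivity
    rw [div_eq_iff this, Nat.add_sub_cancel]
    ring
  have := image_norm_le_of_norm_deriv_right_le_deriv_boundary (a := 0) (b := 1)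
    (fun σ hσ => (hg σ hσ).continuousAt.continuousWithinAt)
    (fun σ hσ => (hg σ (Ico_subset_Icc_self hσ)).hasDerivWithinAt) (by simp) hB
    (fun σ hσ => by
      rw [norm_smul, norm_pow, norm_real, Real.norm_of_nonneg hσ.1, mul_comm]
      have := hf _ (hmem σ (Ico_subset_Icc_self hσ))
      have := hσ.1
      gcongr) (right_mem_Icc.2 zero_le_one)
  simpa using this

lemma exists_smul_deriv_add_eq [CompleteSpace E] {N : ℕ} (hN : 0 < N) {ρ K : ℝ} {f : ℂ → E}
    (hf : ∀ t ∈ ball (0 : ℂ) ρ, DifferentiableAt ℂ f t)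
    (hK : ∀ t ∈ ball (0 : ℂ) ρ, ‖f t‖ ≤ K) :
    ∃ z : ℂ → E, (∀ t ∈ ball (0 : ℂ) ρ, DifferentiableAt ℂ z t) ∧
      ∀ t ∈ ball (0 : ℂ) ρ, t • deriv z t + (N : ℂ) • z t = f t := by
  rcases le_or_gt ρ 0 with hρ | hρ
  · simp [ball_eq_empty.2 hρ]
  obtain ⟨n, rfl⟩ : ∃ n, N = n + 1 := ⟨N - 1, by omega⟩
  have hpf : DifferentiableOn ℂ (fun t : ℂ => t ^ n • f t) (ball 0 ρ) := fun t ht =>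
    ((differentiableAt_pow n).smul (hf t ht)).differentiableWithinAt
  obtain ⟨g, hg0, hg⟩ := hpf.isExactOn_ball.with_val_at 0 0
  have hgb : ∀ t ∈ ball (0 : ℂ) ρ, ‖g t‖ ≤ K * ‖t‖ ^ (n + 1) := by
    intro t ht
    have hs : closedBall (0 : ℂ) ‖t‖ ⊆ ball 0 ρ := closedBall_subset_ball (by simpa using ht)
    have := Convex.norm_image_sub_le_of_norm_hasDerivWithin_le (C := ‖t‖ ^ n * K)
      (fun x hx => (hg x (hs hx)).hasDerivWithinAt)
      (fun x hx => by
        rw [norm_smul, norm_pow]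
        have h1 := hK x (hs hx)
        have h2 : ‖x‖ ≤ ‖t‖ := by simpa using hx
        gcongr) (convex_closedBall (0 : ℂ) ‖t‖) (x := 0) (y := t)
      (by simp) (by simp)
    rw [hg0, sub_zero, sub_zero] at this
    linarith [show ‖t‖ ^ n * K * ‖t‖ = K * ‖t‖ ^ (n + 1) by ring]
  have hnhds : ball (0 : ℂ) ρ ∈ 𝓝 (0 : ℂ) := ball_mem_nhds _ hρ
  have hz := differentiableOn_update_limUnder_of_bddAbove (f := fun t => (t ^ (n + 1))⁻¹ • g t) hnhds
    (fun t ht => (((differentiableAt_pow (𝕜 := ℂ) (x := t) (n + 1)).inv (pow_ne_zero _ ht.2)).smul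
      (hg t ht.1).differentiableAt).differentiableWithinAt)
    ⟨K, by
      rintro _ ⟨t, ht, rfl⟩
      have ht0 : 0 < ‖t‖ := norm_pos_iff.2 ht.2
      simp only [Function.comp, norm_smul, norm_inv, norm_pow]
      rw [inv_mul_le_iff₀ (by positivity)]
      linarith [hgb t ht.1]⟩
  set z := Function.update (fun t : ℂ => (t ^ (n + 1))⁻¹ • g t) 0
    (limUnder (𝓝[≠] 0) fun t : ℂ => (t ^ (n + 1))⁻¹ • g t) with hzdef
  have hzd : ∀ t ∈ ball (0 : ℂ) ρ, DifferentiableAt ℂ z t := fun t ht =>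
    hz.differentiableAt (isOpen_ball.mem_nhds ht)
  have hne : ∀ t ∈ ball (0 : ℂ) ρ, t ≠ 0 → t • deriv z t + ((n + 1 : ℕ) : ℂ) • z t = f t := by
    intro t ht ht0
    have h1 : (fun s : ℂ => s ^ (n + 1) • z s) =ᶠ[𝓝 t] g := by
      filter_upwards [isOpen_ne.mem_nhds ht0] with s hs
      have hs' : s ≠ 0 := hs
      simp [hzdef, smul_smul, hs']
    have h2 := ((hasDerivAt_pow (n + 1) t).smul (hzd t ht).hasDerivAt).unique
      ((hg t ht).congr_of_eventuallyEq h1)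
    have h3 : t ^ n • (t • deriv z t + ((n + 1 : ℕ) : ℂ) • z t) = t ^ n • f t := by
      rw [← h2, smul_add, smul_smul, smul_smul]
      congr 2
      simp; ring
    exact smul_right_injective E (pow_ne_zero n ht0) h3
  refine ⟨z, hzd, fun t ht => ?_⟩
  by_cases ht0 : t = 0
  · subst ht0
    have hc1 : ContinuousAt (fun t : ℂ => t • deriv z t + ((n + 1 : ℕ) : ℂ) • z t) 0 := by
      have : ContinuousAt (deriv z) 0 :=
        ((hz.deriv isOpen_ball).differentiableAt hnhds).continuousAt
      have := (hzd 0 ht).continuousAt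
      fun_prop
    have hev : (fun t : ℂ => t • deriv z t + ((n + 1 : ℕ) : ℂ) • z t) =ᶠ[𝓝[≠] 0] f := by
      filter_upwards [self_mem_nhdsWithin, mem_nhdsWithin_of_mem_nhds hnhds] with s hs hs'
      exact hne s hs' hs
    exact tendsto_nhds_unique ((hc1.tendsto.mono_left nhdsWithin_le_nhds).congr' hev)
      ((hf 0 ht).continuousAt.tendsto.mono_left nhdsWithin_le_nhds)
  · exact hne t ht ht0

lemma exists_contraction_solution [CompleteSpace E] {N : ℕ} (hN : 0 < N) {ρ R κ : ℝ}
    (hR : 0 ≤ R) (hκ0 : 0 ≤ κ) (hκ : κ < N) {h : E × ℂ → E}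
    (hh : ∀ z : ℂ → E, (∀ t ∈ ball (0 : ℂ) ρ, DifferentiableAt ℂ z t) →
      (∀ t ∈ ball (0 : ℂ) ρ, ‖z t‖ ≤ R) →
      ∀ t ∈ ball (0 : ℂ) ρ, DifferentiableAt ℂ (fun t => h (z t, t)) t)
    (hlip : ∀ t ∈ ball (0 : ℂ) ρ, ∀ y₁ y₂ : E, ‖y₁‖ ≤ R → ‖y₂‖ ≤ R →
      ‖h (y₁, t) - h (y₂, t)‖ ≤ κ * ‖y₁ - y₂‖)
    (h0 : ∀ t ∈ ball (0 : ℂ) ρ, ‖h (0, t)‖ ≤ (N - κ) * R) :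
    ∃ z : ℂ → E, (∀ t ∈ ball (0 : ℂ) ρ, DifferentiableAt ℂ z t) ∧
      (∀ t ∈ ball (0 : ℂ) ρ, ‖z t‖ ≤ R) ∧
      ∀ t ∈ ball (0 : ℂ) ρ, t • deriv z t + (N : ℂ) • z t = h (z t, t) := by
  have hN' : (0 : ℝ) < N := by exact_mod_cast hN
  let S := {z : ℂ → E // (∀ t ∈ ball (0 : ℂ) ρ, DifferentiableAt ℂ z t) ∧
    ∀ t ∈ ball (0 : ℂ) ρ, ‖z t‖ ≤ R}
  have hstep : ∀ z : S, ∃ w : S, ∀ t ∈ ball (0 : ℂ) ρ,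
      t • deriv w.1 t + (N : ℂ) • w.1 t = h (z.1 t, t) := by
    rintro ⟨z, hz, hzR⟩
    have hb : ∀ t ∈ ball (0 : ℂ) ρ, ‖h (z t, t)‖ ≤ N * R := by
      intro t ht
      have h1 := hlip t ht (z t) 0 (hzR t ht) (by simpa using hR)
      have h2 := norm_le_norm_sub_add (h (z t, t)) (h (0, t))
      rw [sub_zero] at h1
      nlinarith [h0 t ht, hzR t ht, mul_le_mul_of_nonneg_left (hzR t ht) hκ0]
    obtain ⟨w, hw, hwe⟩ := exists_smul_deriv_add_eq hN (hh z hz hzR) hb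
    refine ⟨⟨w, hw, fun t ht => ?_⟩, hwe⟩
    have := norm_le_div_of_smul_deriv_add hN hw hwe hb ht
    rwa [mul_div_cancel_left₀ _ hN'.ne'] at this
  choose T hT using hstep
  have hcontr : ∀ (z w : S) (K : ℝ), (∀ t ∈ ball (0 : ℂ) ρ, ‖z.1 t - w.1 t‖ ≤ K) →
      ∀ t ∈ ball (0 : ℂ) ρ, ‖(T z).1 t - (T w).1 t‖ ≤ κ / N * K := by
    intro z w K hK t ht
    have := norm_le_div_of_smul_deriv_add (K := κ * K) (z := fun t => (T z).1 t - (T w).1 t)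
      (f := fun t => h (z.1 t, t) - h (w.1 t, t)) hN
      (fun t ht => ((T z).2.1 t ht).sub ((T w).2.1 t ht))
      (fun t ht => by
        rw [← hT z t ht, ← hT w t ht, deriv_fun_sub ((T z).2.1 t ht) ((T w).2.1 t ht)]
        module)
      (fun t ht => (hlip t ht _ _ (z.2.2 t ht) (w.2.2 t ht)).trans
        (mul_le_mul_of_nonneg_left (hK t ht) hκ0)) ht
    rwa [mul_div_right_comm] at this
  let s : ℕ → S := fun k => T^[k] ⟨0, fun t _ => differentiableAt_const (0 : E), fun t _ => by simpa using hR⟩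
  have hs : ∀ k, s (k + 1) = T (s k) := fun k => Function.iterate_succ_apply' _ _ _
  set q := κ / N with hq
  have hq1 : q < 1 := (div_lt_one hN').2 hκ
  have hq0 : 0 ≤ q := by positivity
  have hd : ∀ k, ∀ t ∈ ball (0 : ℂ) ρ, ‖(s k).1 t - (s (k + 1)).1 t‖ ≤ 2 * R * q ^ k := by
    intro k
    induction k with
    | zero =>
      intro t ht
      have := norm_sub_le ((s 0).1 t) ((s 1).1 t)
      simp only [pow_zero, zero_add]
      linarith [(s 0).2.2 t ht, (s 1).2.2 t ht]
    | succ k ih =>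
      intro t ht
      rw [hs (k + 1), hs k]
      have := hcontr _ _ _ ih t ht
      rw [← hs k] at this ⊢
      rw [pow_succ]
      linarith
  have hlim : ∀ t, ∃ y, t ∈ ball (0 : ℂ) ρ → Tendsto (fun k => (s k).1 t) atTop (𝓝 y) := by
    intro t
    by_cases ht : t ∈ ball (0 : ℂ) ρ
    · obtain ⟨y, hy⟩ := cauchySeq_tendsto_of_complete
        (cauchySeq_of_le_geometric (f := fun k => (s k).1 t) q (2 * R) hq1 fun k => by
          rw [dist_eq_norm]; exact hd k t ht)
      exact ⟨y, fun _ => hy⟩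
    · exact ⟨0, fun h => absurd h ht⟩
  choose W hW using hlim
  have hsW : ∀ k, ∀ t ∈ ball (0 : ℂ) ρ, ‖(s k).1 t - W t‖ ≤ 2 * R * q ^ k / (1 - q) := by
    intro k t ht
    rw [← dist_eq_norm]
    exact dist_le_of_le_geometric_of_tendsto q (2 * R) hq1
      (fun k => by rw [dist_eq_norm]; exact hd k t ht) (hW t ht) k
  have hto : Tendsto (fun k => 2 * R * q ^ k / (1 - q)) atTop (𝓝 0) := by
    simpa using ((tendsto_pow_atTop_nhds_zero_of_lt_one hq0 hq1).const_mul (2 * R)).div_const (1 - q)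
  have hunif : TendstoUniformlyOn (fun k => (s k).1) W atTop (ball (0 : ℂ) ρ) := by
    rw [Metric.tendstoUniformlyOn_iff]
    intro ε hε
    filter_upwards [hto.eventually (gt_mem_nhds hε)] with k hk t ht
    rw [dist_comm, dist_eq_norm]
    exact (hsW k t ht).trans_lt hk
  have hWd : DifferentiableOn ℂ W (ball 0 ρ) :=
    hunif.tendstoLocallyUniformlyOn.differentiableOn
      (Eventually.of_forall fun k t ht => ((s k).2.1 t ht).differentiableWithinAt) isOpen_ball
  let w : S := ⟨W, fun t ht => hWd.differentiableAt (isOpen_ball.mem_nhds ht), fun t ht =>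
    le_of_tendsto (hW t ht).norm (Eventually.of_forall fun k => (s k).2.2 t ht)⟩
  have hfix : ∀ t ∈ ball (0 : ℂ) ρ, (T w).1 t = W t := by
    intro t ht
    refine tendsto_nhds_unique ?_ ((hW t ht).comp (tendsto_add_atTop_nat 1))
    rw [tendsto_iff_norm_sub_tendsto_zero]
    refine squeeze_zero (fun _ => norm_nonneg _) (fun k => ?_) (by simpa using hto.const_mul q)
    simp only [Function.comp, hs]
    exact hcontr (s k) w _ (hsW k) t ht
  exact ⟨(T w).1, (T w).2.1, (T w).2.2, fun t ht => by rw [hfix t ht, ← hfix t ht, hT w t ht, hfix t ht]⟩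

variable {E' : Type*} [NormedAddCommGroup E'] [NormedSpace ℂ E']

/-- A map of `(y, t)` which is holomorphic along holomorphic graphs near the origin and strictly
differentiable in `y` at the origin, uniformly in `t`, with derivative `M`. -/
structure HolomorphicAlongGraphs (M : E →L[ℂ] E') (H : E × ℂ → E') : Prop where
  hol : ∀ᶠ x : E × ℂ in 𝓝 0, ∀ w : ℂ → E, (∀ᶠ t in 𝓝 x.2, DifferentiableAt ℂ w t) →
    w x.2 = x.1 → DifferentiableAt ℂ (fun t => H (w t, t)) x.2
  lip : ∀ ε > 0, ∀ᶠ p : (E × E) × ℂ in 𝓝 0,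
    ‖H (p.1.1, p.2) - H (p.1.2, p.2) - M (p.1.1 - p.1.2)‖ ≤ ε * ‖p.1.1 - p.1.2‖

/-- A germ at `0` of a holomorphic solution of `t w' = H (w, t)` with `w 0 = 0`. -/
structure IsBriotBouquetSolution (H : E × ℂ → E) (w : ℂ → E) : Prop where
  diff : ∀ᶠ t in 𝓝 (0 : ℂ), DifferentiableAt ℂ w t
  zero : w 0 = 0
  eq : ∀ᶠ t in 𝓝 (0 : ℂ), t • deriv w t = H (w t, t)

namespace HolomorphicAlongGraphs

variable {M : E →L[ℂ] E'} {H : E × ℂ → E'}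

lemma eventually_differentiableAt (hH : HolomorphicAlongGraphs M H) {w : ℂ → E}
    (hw : ∀ᶠ t in 𝓝 (0 : ℂ), DifferentiableAt ℂ w t) (hw0 : w 0 = 0) :
    ∀ᶠ t in 𝓝 (0 : ℂ), DifferentiableAt ℂ (fun t => H (w t, t)) t := by
  have hc : Tendsto (fun t : ℂ => (w t, t)) (𝓝 0) (𝓝 0) := by
    have : ContinuousAt (fun t : ℂ => (w t, t)) 0 :=
      hw.self_of_nhds.continuousAt.prodMk continuousAt_id
    rwa [ContinuousAt, hw0] at this
  filter_upwards [hc.eventually hH.hol, hw.eventually_nhds] with t h1 h2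
  exact h1 w h2 rfl

lemma tendsto (hH : HolomorphicAlongGraphs M H) : Tendsto H (𝓝 0) (𝓝 (H 0)) := by
  have h1 : Tendsto (fun t : ℂ => H (0, t)) (𝓝 0) (𝓝 (H 0)) :=
    (hH.eventually_differentiableAt (w := fun _ => 0) (by simp) rfl).self_of_nhds.continuousAt
  have h2 : Tendsto (fun x : E × ℂ => ((x.1, (0 : E)), x.2)) (𝓝 0) (𝓝 0) :=
    Continuous.tendsto' (by fun_prop) _ _ rfl
  have h3 : Tendsto (fun x : E × ℂ => H x - H (0, x.2)) (𝓝 0) (𝓝 0) := by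
    refine squeeze_zero_norm' (a := fun x => (1 + ‖M‖) * ‖x.1‖) ?_ ?_
    · filter_upwards [h2.eventually (hH.lip 1 one_pos)] with x hx
      simp only [sub_zero] at hx
      have := norm_le_norm_sub_add (H x - H (0, x.2)) (M x.1)
      linarith [M.le_opNorm x.1]
    · exact Continuous.tendsto' (by fun_prop) _ _ (by simp)
  have h4 : Tendsto (fun x : E × ℂ => H (0, x.2)) (𝓝 0) (𝓝 (H 0)) :=
    h1.comp (continuous_snd.tendsto' _ _ rfl)
  simpa using h3.add h4

lemma hasDerivAt_comp_smul (hH : HolomorphicAlongGraphs M H) {h : E'}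
    (hd : HasDerivAt (fun t => H (0, t)) h 0) {u : ℂ → E} (hu : ContinuousAt u 0) :
    HasDerivAt (fun t => H (t • u t, t)) (M (u 0) + h) 0 := by
  have h1 : HasDerivAt (fun t => H (t • u t, t) - H (0, t) - M (t • u t)) 0 0 := by
    rw [hasDerivAt_iff_isLittleO]
    simp only [sub_zero, smul_zero, zero_smul, map_zero, sub_self]
    rw [Asymptotics.isLittleO_iff]
    intro c hc
    have hpos : 0 < ‖u 0‖ + 1 := by positivity
    have hc1 : Tendsto (fun t : ℂ => ((t • u t, (0 : E)), t)) (𝓝 0) (𝓝 0) := by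
      have : ContinuousAt (fun t : ℂ => ((t • u t, (0 : E)), t)) 0 := by fun_prop
      rwa [ContinuousAt, zero_smul] at this
    filter_upwards [hc1.eventually (hH.lip (c / (‖u 0‖ + 1)) (by positivity)),
      hu.norm.eventually (gt_mem_nhds (lt_add_one ‖u 0‖))] with t h1 h2
    simp only [sub_zero] at h1
    refine h1.trans ?_
    rw [norm_smul, div_mul_eq_mul_div, div_le_iff₀ hpos, mul_assoc]
    have : ‖t‖ * ‖u t‖ ≤ ‖t‖ * (‖u 0‖ + 1) := by gcongr
    nlinarith
  have h2 : HasDerivAt (fun t : ℂ => t • M (u t)) (M (u 0)) 0 := by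
    rw [hasDerivAt_iff_tendsto_slope]
    have : Tendsto (fun t => M (u t)) (𝓝[≠] 0) (𝓝 (M (u 0))) :=
      ((M.continuous.continuousAt (x := u 0)).comp hu).tendsto.mono_left nhdsWithin_le_nhds
    refine this.congr' ?_
    filter_upwards [self_mem_nhdsWithin] with t ht
    have ht' : t ≠ 0 := ht
    simp [slope_def_module, smul_smul, ht']
  have h3 := (h1.add hd).add h2
  simp only [zero_add, add_comm h] at h3
  refine h3.congr_of_eventuallyEq (Eventually.of_forall fun t => ?_)
  simp only [Pi.add_apply, map_smul]
  abel

end HolomorphicAlongGraphs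

/-- The strict transform of `H` under `(y, t) ↦ (t (a + y), t)`. -/
def blowUp (M : E →L[ℂ] E') (h : E') (a : E) (H : E × ℂ → E') (x : E × ℂ) : E' :=
  if x.2 = 0 then M (a + x.1) + h else x.2⁻¹ • H (x.2 • (a + x.1), x.2)

namespace HolomorphicAlongGraphs

variable {M : E →L[ℂ] E'} {H : E × ℂ → E'}

lemma blowUp [CompleteSpace E'] (hH : HolomorphicAlongGraphs M H) (h0 : H 0 = 0) {h : E'}
    (hd : HasDerivAt (fun t => H (0, t)) h 0) (a : E) :
    HolomorphicAlongGraphs M (blowUp M h a H) where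
  hol := by
    have hc : Tendsto (fun x : E × ℂ => (x.2 • (a + x.1), x.2)) (𝓝 0) (𝓝 0) :=
      Continuous.tendsto' (by fun_prop) _ _ (by simp)
    filter_upwards [hc.eventually hH.hol] with ⟨y, s⟩ hx w hw hwy
    dsimp only at hx hw hwy ⊢
    by_cases hs : s = 0
    · subst hs
      set f : ℂ → E' := fun t => H (t • (a + w t), t) with hf
      have hfd : ∀ᶠ t in 𝓝 (0 : ℂ), DifferentiableAt ℂ f t := by
        refine hH.eventually_differentiableAt (w := fun t => t • (a + w t)) ?_ (by simp)
        filter_upwards [hw] with t ht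
        exact differentiableAt_id.smul (ht.const_add a)
      have hf' : HasDerivAt f (M (a + w 0) + h) 0 :=
        hH.hasDerivAt_comp_smul hd (u := fun t => a + w t)
          (continuousAt_const.add hw.self_of_nhds.continuousAt)
      have hf0 : f 0 = 0 := by
        simp only [hf, zero_smul]
        exact h0
      have heq : (fun t => _root_.blowUp M h a H (w t, t)) = dslope f 0 := by
        funext t
        by_cases ht : t = 0
        · subst ht
          simp [_root_.blowUp, hf'.deriv]
        · rw [dslope_of_ne _ ht, slope_def_module, hf0]
          simp [_root_.blowUp, ht, hf]
      rw [heq]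
      have hmem : {t | DifferentiableAt ℂ f t} ∈ 𝓝 (0 : ℂ) := hfd
      exact ((differentiableOn_dslope hmem).2 fun t ht =>
        DifferentiableAt.differentiableWithinAt ht).differentiableAt hmem
    · have h1 : DifferentiableAt ℂ (fun t => H (t • (a + w t), t)) s := by
        refine hx (fun t => t • (a + w t)) ?_ (by rw [hwy])
        filter_upwards [hw] with t ht
        exact differentiableAt_id.smul (ht.const_add a)
      refine ((differentiableAt_inv hs).smul h1).congr_of_eventuallyEq ?_
      filter_upwards [isOpen_ne.mem_nhds hs] with t ht
      have ht' : t ≠ 0 := ht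
      simp [_root_.blowUp, ht']
  lip := by
    intro ε hε
    have hc : Tendsto (fun p : (E × E) × ℂ => ((p.2 • (a + p.1.1), p.2 • (a + p.1.2)), p.2))
        (𝓝 0) (𝓝 0) := Continuous.tendsto' (by fun_prop) _ _ (by simp)
    filter_upwards [hc.eventually (hH.lip ε hε)] with ⟨⟨y₁, y₂⟩, t⟩ hp
    dsimp only at hp ⊢
    by_cases ht : t = 0
    · subst ht
      have : M (a + y₁) + h - (M (a + y₂) + h) - M (y₁ - y₂) = 0 := by
        simp only [map_add, map_sub]; abel
      simp only [_root_.blowUp, if_true, this, norm_zero]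
      positivity
    · have e1 : t • (a + y₁) - t • (a + y₂) = t • (y₁ - y₂) := by module
      have e2 : _root_.blowUp M h a H (y₁, t) - _root_.blowUp M h a H (y₂, t) - M (y₁ - y₂) =
          t⁻¹ • (H (t • (a + y₁), t) - H (t • (a + y₂), t) - M (t • (a + y₁) - t • (a + y₂))) := by
        rw [e1, map_smul, smul_sub, smul_smul, inv_mul_cancel₀ ht, one_smul, smul_sub]
        simp [_root_.blowUp, ht]
      rw [e2, norm_smul, norm_inv, inv_mul_le_iff₀ (norm_pos_iff.2 ht)]
      rw [e1, norm_smul] at hp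
      rw [e1]
      linarith

lemma sub_add_fst {M : E →L[ℂ] E} {H : E × ℂ → E} (hH : HolomorphicAlongGraphs M H) (a : E) :
    HolomorphicAlongGraphs (M - ContinuousLinearMap.id ℂ E) (fun x => H x - (a + x.1)) where
  hol := by
    filter_upwards [hH.hol] with x hx w hw hwx
    exact (hx w hw hwx).sub (hw.self_of_nhds.const_add a)
  lip := by
    intro ε hε
    filter_upwards [hH.lip ε hε] with p hp
    convert hp using 2
    simp only [sub_apply, ContinuousLinearMap.id_apply]
    abel

lemma inv_smul {M : E →L[ℂ] E'} {c : E →L[ℂ] ℂ} {G : E × ℂ → E'} {F : E × ℂ → ℂ}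
    (hG : HolomorphicAlongGraphs M G) (hF : HolomorphicAlongGraphs c F) (hG0 : G 0 = 0)
    (hF0 : F 0 ≠ 0) :
    HolomorphicAlongGraphs ((F 0)⁻¹ • M) (fun x => (F x)⁻¹ • G x) where
  hol := by
    filter_upwards [hG.hol, hF.hol, hF.tendsto.eventually (isOpen_ne.mem_nhds hF0)]
      with x h1 h2 h3 w hw hwx
    refine ((h2 w hw hwx).inv ?_).smul (h1 w hw hwx)
    rw [hwx]
    exact h3
  lip := by
    intro ε hε
    have hn : 0 < ‖F 0‖ := norm_pos_iff.2 hF0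
    have hc1 : Tendsto (fun p : (E × E) × ℂ => (p.1.1, p.2)) (𝓝 0) (𝓝 0) :=
      Continuous.tendsto' (by fun_prop) _ _ rfl
    have hc2 : Tendsto (fun p : (E × E) × ℂ => (p.1.2, p.2)) (𝓝 0) (𝓝 0) :=
      Continuous.tendsto' (by fun_prop) _ _ rfl
    have hF1 := hF.tendsto.comp hc1
    have hF2 := hF.tendsto.comp hc2
    have hG2 := hG.tendsto.comp hc2
    rw [hG0] at hG2
    have hQ := (((hF1.inv₀ hF0).norm.mul_const (ε * ‖F 0‖ / 2)).add
      (((hF1.inv₀ hF0).sub_const (F 0)⁻¹).norm.mul_const ‖M‖)).add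
      ((((hF1.inv₀ hF0).norm.mul (hF2.inv₀ hF0).norm).mul_const (1 + ‖c‖)).mul hG2.norm)
    have hlt : ‖(F 0)⁻¹‖ * (ε * ‖F 0‖ / 2) + ‖(F 0)⁻¹ - (F 0)⁻¹‖ * ‖M‖ +
        ‖(F 0)⁻¹‖ * ‖(F 0)⁻¹‖ * (1 + ‖c‖) * ‖(0 : E')‖ < ε := by
      rw [sub_self, norm_zero, norm_zero, norm_inv, zero_mul, mul_zero, add_zero, add_zero,
        show ‖F 0‖⁻¹ * (ε * ‖F 0‖ / 2) = ε / 2 by field_simp]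
      exact half_lt_self hε
    filter_upwards [hQ.eventually (gt_mem_nhds hlt), hG.lip (ε * ‖F 0‖ / 2) (by positivity),
      hF.lip 1 one_pos, hF1.eventually (isOpen_ne.mem_nhds hF0),
      hF2.eventually (isOpen_ne.mem_nhds hF0)] with ⟨⟨y₁, y₂⟩, t⟩ hq hg hf hn1 hn2
    simp only [Function.comp] at hq hg hf hn1 hn2 ⊢
    set F₁ := F (y₁, t)
    set F₂ := F (y₂, t)
    set d := y₁ - y₂
    have hf' : ‖F₁ - F₂‖ ≤ (1 + ‖c‖) * ‖d‖ := by
      have := norm_le_norm_sub_add (F₁ - F₂) (c d)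
      linarith [c.le_opNorm d]
    have e : F₁⁻¹ • G (y₁, t) - F₂⁻¹ • G (y₂, t) - ((F 0)⁻¹ • M) d =
        F₁⁻¹ • (G (y₁, t) - G (y₂, t) - M d) + (F₁⁻¹ - (F 0)⁻¹) • M d -
          (F₁⁻¹ * F₂⁻¹ * (F₁ - F₂)) • G (y₂, t) := by
      have : F₁⁻¹ * F₂⁻¹ * (F₁ - F₂) = F₂⁻¹ - F₁⁻¹ := by
        have h1 : F₁ ≠ 0 := hn1
        have h2 : F₂ ≠ 0 := hn2
        field_simp
      rw [this, smul_apply]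
      module
    rw [e]
    refine (norm_sub_le _ _).trans ((add_le_add (norm_add_le _ _) le_rfl).trans ?_)
    simp only [norm_smul, norm_mul]
    refine le_trans ?_ (mul_le_mul_of_nonneg_right hq.le (norm_nonneg d))
    rw [add_mul, add_mul]
    refine add_le_add (add_le_add ?_ ?_) ?_
    · rw [mul_assoc]
      gcongr
    · rw [mul_assoc]
      gcongr
      exact M.le_opNorm d
    · calc ‖F₁⁻¹‖ * ‖F₂⁻¹‖ * ‖F₁ - F₂‖ * ‖G (y₂, t)‖
          ≤ ‖F₁⁻¹‖ * ‖F₂⁻¹‖ * ((1 + ‖c‖) * ‖d‖) * ‖G (y₂, t)‖ := by gcongr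
        _ = _ := by ring

end HolomorphicAlongGraphs

lemma hasStrictFDerivAt_of_eventually_differentiableAt {f : E → E'} {A : E →L[ℂ] E'} {x₀ : E}
    (hf : ∀ᶠ x in 𝓝 x₀, DifferentiableAt ℂ f x) (hA : HasFDerivAt f A x₀) :
    HasStrictFDerivAt f A x₀ := by
  rw [← hA.fderiv]
  refine hasStrictFDerivAt_of_hasFDerivAt_of_continuousAt
    (hf.mono fun x hx => hx.hasFDerivAt) ?_
  rw [Metric.continuousAt_iff']
  intro ε hε
  have ho := (Asymptotics.isLittleO_iff.1 hA.isLittleO) (c := ε / 12) (by positivity)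
  obtain ⟨δ, hδ, hb⟩ := Metric.eventually_nhds_iff_ball.1 (ho.and hf)
  filter_upwards [ball_mem_nhds x₀ (half_pos hδ)] with x hx
  rw [hA.fderiv, dist_eq_norm]
  have hsub : ball x (δ / 2) ⊆ ball x₀ δ := ball_subset_ball' (by
    rw [mem_ball] at hx; linarith)
  have hd : ∀ y ∈ ball x (δ / 2), DifferentiableAt ℂ (fun y => f y - A y) y := fun y hy =>
    (hb y (hsub hy)).2.sub A.differentiableAt
  have hxm : x ∈ ball x (δ / 2) := mem_ball_self (half_pos hδ)
  have hest : ∀ y ∈ ball x (δ / 2), ‖f y - f x₀ - A (y - x₀)‖ ≤ ε / 12 * δ := by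
    intro y hy
    refine (hb y (hsub hy)).1.trans ?_
    have := hsub hy
    rw [mem_ball, dist_eq_norm] at this
    gcongr
  have h1 := norm_fderiv_le_div_of_mapsTo_ball (R₂ := ε * δ / 4)
    (fun y hy => (hd y hy).differentiableWithinAt) (fun y hy => by
      rw [mem_closedBall, dist_eq_norm]
      have e : f y - A y - (f x - A x) =
          (f y - f x₀ - A (y - x₀)) - (f x - f x₀ - A (x - x₀)) := by
        simp only [map_sub]; abel
      rw [e]
      refine (norm_sub_le _ _).trans ?_
      have := hest y hy
      have := hest x hxm
      nlinarith) (half_pos hδ)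
  rw [fderiv_fun_sub (hb x (hsub hxm)).2 A.differentiableAt, A.fderiv] at h1
  refine h1.trans_lt ?_
  rw [div_lt_iff₀ (half_pos hδ)]
  nlinarith

lemma HolomorphicAlongGraphs.of_hasFDerivAt {H : E × ℂ → E'} {A : E × ℂ →L[ℂ] E'}
    (hH : ∀ᶠ x in 𝓝 (0 : E × ℂ), DifferentiableAt ℂ H x) (hA : HasFDerivAt H A 0) :
    HolomorphicAlongGraphs (A.comp (ContinuousLinearMap.inl ℂ E ℂ)) H where
  hol := by
    filter_upwards [hH] with x hx w hw hwx
    have hx' : DifferentiableAt ℂ H (w x.2, x.2) := by rwa [hwx]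
    exact DifferentiableAt.comp x.2 (f := fun t => (w t, t)) hx'
      (hw.self_of_nhds.prodMk differentiableAt_id)
  lip := by
    intro ε hε
    have hc : Tendsto (fun p : (E × E) × ℂ => ((p.1.1, p.2), (p.1.2, p.2)))
        (𝓝 0) (𝓝 ((0 : E × ℂ), (0 : E × ℂ))) := Continuous.tendsto' (by fun_prop) _ _ rfl
    have h1 := Asymptotics.isLittleO_iff.1
      (hasStrictFDerivAt_of_eventually_differentiableAt hH hA).isLittleO hε
    filter_upwards [hc.eventually h1] with p hp
    simpa [Prod.norm_def] using hp

/-- Existence and uniqueness of the solution germ of `t w' = H (w, t)`, `w 0 = 0`. -/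
def HasUniqueSolution (H : E × ℂ → E) : Prop :=
  ∃ w, IsBriotBouquetSolution H w ∧ ∀ w', IsBriotBouquetSolution H w' → w' =ᶠ[𝓝 0] w

lemma hasUniqueSolution_of_norm_lt [CompleteSpace E] {M : E →L[ℂ] E} {H : E × ℂ → E}
    (hH : HolomorphicAlongGraphs M H) (h0 : H 0 = 0) {N : ℕ}
    (hM : ‖M + (N : ℂ) • ContinuousLinearMap.id ℂ E‖ < N) : HasUniqueSolution H := by
  have hN' : (0 : ℝ) < N := (norm_nonneg _).trans_lt hM
  have hN : 0 < N := by exact_mod_cast hN'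
  obtain ⟨κ, hκM, hκ⟩ := exists_between hM
  have hκ0 : 0 ≤ κ := (norm_nonneg _).trans hκM.le
  obtain ⟨r₁, hr₁, hlip⟩ := Metric.eventually_nhds_iff_ball.1
    (hH.lip (κ - ‖M + (N : ℂ) • ContinuousLinearMap.id ℂ E‖) (by linarith))
  obtain ⟨r₂, hr₂, hhol⟩ := Metric.eventually_nhds_iff_ball.1 hH.hol
  set r := min r₁ r₂
  have hr : 0 < r := lt_min hr₁ hr₂
  set R := r / 2
  have hR : 0 < R := half_pos hr
  have hRr : R < r := half_lt_self hr
  set h : E × ℂ → E := fun x => H x + (N : ℂ) • x.1 with hh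
  have hh0 : h (0, 0) = 0 := by
    simp only [hh, smul_zero, add_zero]
    exact h0
  have hhlip : ∀ t : ℂ, ‖t‖ < r → ∀ y₁ y₂ : E, ‖y₁‖ ≤ R → ‖y₂‖ ≤ R →
      ‖h (y₁, t) - h (y₂, t)‖ ≤ κ * ‖y₁ - y₂‖ := by
    intro t ht y₁ y₂ h1 h2
    have := hlip ((y₁, y₂), t) (by
      rw [mem_ball_zero_iff]
      exact (max_lt (max_lt (h1.trans_lt hRr) (h2.trans_lt hRr)) ht).trans_le (min_le_left _ _))
    have e : h (y₁, t) - h (y₂, t) = (H (y₁, t) - H (y₂, t) - M (y₁ - y₂)) +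
        (M + (N : ℂ) • ContinuousLinearMap.id ℂ E) (y₁ - y₂) := by
      simp only [hh, add_apply, smul_apply, ContinuousLinearMap.id_apply]
      module
    rw [e]
    refine (norm_add_le _ _).trans ?_
    have h3 := (M + (N : ℂ) • ContinuousLinearMap.id ℂ E).le_opNorm (y₁ - y₂)
    dsimp only at this
    linarith
  have hhhol : ∀ {w : ℂ → E} {s : ℂ}, (∀ᶠ t in 𝓝 s, DifferentiableAt ℂ w t) → ‖w s‖ ≤ R →
      ‖s‖ < r → DifferentiableAt ℂ (fun t => h (w t, t)) s := by
    intro w s hw hws hs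
    refine (hhol (w s, s) ?_ w hw rfl).add (hw.self_of_nhds.const_smul _)
    rw [mem_ball_zero_iff]
    exact (max_lt (hws.trans_lt hRr) hs).trans_le (min_le_right _ _)
  obtain ⟨ρ, hρ, hρr, hρ0⟩ : ∃ ρ > 0, ρ ≤ r ∧ ∀ t ∈ ball (0 : ℂ) ρ, ‖h (0, t)‖ ≤ (N - κ) * R := by
    have hc : ContinuousAt (fun t : ℂ => h (0, t)) 0 :=
      (hhhol (w := fun _ => 0) (by simp) (by simpa using hR.le) (by simpa using hr)).continuousAt
    have hlt : ‖h (0, 0)‖ < (N - κ) * R := by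
      rw [hh0, norm_zero]
      exact mul_pos (by linarith) hR
    have hev := hc.norm.eventually (gt_mem_nhds hlt)
    obtain ⟨ρ, hρ, hb⟩ := Metric.eventually_nhds_iff_ball.1 hev
    exact ⟨min ρ r, lt_min hρ hr, min_le_right _ _, fun t ht =>
      (hb t (ball_subset_ball (min_le_left _ _) ht)).le⟩
  have hlt : ∀ t ∈ ball (0 : ℂ) ρ, ‖t‖ < r := fun t ht =>
    (mem_ball_zero_iff.1 ht).trans_le hρr
  obtain ⟨w, hw, hwR, hwe⟩ := exists_contraction_solution hN hR.le hκ0 hκ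
    (fun z hz hzR t ht => hhhol
      (by filter_upwards [isOpen_ball.mem_nhds ht] with s hs using hz s hs) (hzR t ht) (hlt t ht))
    (fun t ht => hhlip t (hlt t ht)) hρ0
  have hmem : ball (0 : ℂ) ρ ∈ 𝓝 (0 : ℂ) := ball_mem_nhds _ hρ
  have hw0 : w 0 = 0 := by
    have h1 := hwe 0 (mem_ball_self hρ)
    have h2 := hhlip 0 (by simpa using hr) (w 0) 0 (hwR 0 (mem_ball_self hρ)) (by simpa using hR.le)
    rw [zero_smul, zero_add] at h1
    rw [hh0, sub_zero, sub_zero, ← h1, norm_smul, Complex.norm_natCast] at h2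
    by_contra hne
    have := norm_pos_iff.2 hne
    nlinarith
  have hsolw : IsBriotBouquetSolution H w := by
    refine ⟨by filter_upwards [hmem] with t ht using hw t ht, hw0, ?_⟩
    filter_upwards [hmem] with t ht
    exact add_right_cancel (hwe t ht)
  refine ⟨w, hsolw, fun w' hw' => ?_⟩
  have hRev : ∀ᶠ t in 𝓝 (0 : ℂ), ‖w' t‖ < R :=
    hw'.diff.self_of_nhds.continuousAt.norm.eventually (gt_mem_nhds (by simpa [hw'.zero] using hR))
  obtain ⟨δ, hδ, hb⟩ := Metric.eventually_nhds_iff_ball.1 ((hw'.diff.and hw'.eq).and (hRev.and hmem))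
  have hest : ∀ k : ℕ, ∀ t ∈ ball (0 : ℂ) δ, ‖w' t - w t‖ ≤ 2 * R * (κ / N) ^ k := by
    intro k
    induction k with
    | zero =>
      intro t ht
      rw [pow_zero, mul_one]
      linarith [norm_sub_le (w' t) (w t), (hb t ht).2.1, hwR t (hb t ht).2.2]
    | succ k ih =>
      intro t ht
      have := norm_le_div_of_smul_deriv_add (K := κ * (2 * R * (κ / N) ^ k))
        (z := fun t => w' t - w t) (f := fun t => h (w' t, t) - h (w t, t)) hN
        (fun t ht => (hb t ht).1.1.sub (hw t (hb t ht).2.2))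
        (fun t ht => by
          rw [deriv_fun_sub (hb t ht).1.1 (hw t (hb t ht).2.2), ← hwe t (hb t ht).2.2]
          simp only [hh]
          rw [← (hb t ht).1.2]
          module)
        (fun t ht => (hhlip t (hlt t (hb t ht).2.2) _ _ (hb t ht).2.1.le
          (hwR t (hb t ht).2.2)).trans (mul_le_mul_of_nonneg_left (ih t ht) hκ0)) ht
      refine this.trans_eq ?_
      rw [pow_succ]
      ring
  filter_upwards [ball_mem_nhds (0 : ℂ) hδ] with t ht
  have hlim : Tendsto (fun k : ℕ => 2 * R * (κ / N) ^ k) atTop (𝓝 0) := by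
    simpa using (tendsto_pow_atTop_nhds_zero_of_lt_one (by positivity)
      ((div_lt_one hN').2 hκ)).const_mul (2 * R)
  have := ge_of_tendsto hlim (Eventually.of_forall fun k => hest k t ht)
  exact sub_eq_zero.1 (norm_le_zero_iff.1 this)

lemma eventually_differentiableAt_dslope [CompleteSpace E] {w : ℂ → E}
    (hw : ∀ᶠ t in 𝓝 (0 : ℂ), DifferentiableAt ℂ w t) :
    ∀ᶠ t in 𝓝 (0 : ℂ), DifferentiableAt ℂ (dslope w 0) t := by
  filter_upwards [hw.eventually_nhds, hw] with t ht ht'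
  by_cases h : t = 0
  · subst h
    have hmem : {t | DifferentiableAt ℂ w t} ∈ 𝓝 (0 : ℂ) := hw
    exact ((differentiableOn_dslope hmem).2 fun t ht =>
      DifferentiableAt.differentiableWithinAt ht).differentiableAt hmem
  · exact (differentiableAt_dslope_of_ne h).2 ht'

lemma eq_smul_dslope {w : ℂ → E} (hw0 : w 0 = 0) (t : ℂ) : w t = t • dslope w 0 t := by
  simpa [hw0] using (sub_smul_dslope w 0 t).symm

lemma IsBriotBouquetSolution.deriv_zero [CompleteSpace E] {M : E →L[ℂ] E} {H : E × ℂ → E}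
    (hH : HolomorphicAlongGraphs M H) {h : E} (hd : HasDerivAt (fun t => H (0, t)) h 0)
    {w : ℂ → E} (hw : IsBriotBouquetSolution H w) : deriv w 0 = M (deriv w 0) + h := by
  have h1 := hH.hasDerivAt_comp_smul hd (u := dslope w 0)
    (eventually_differentiableAt_dslope hw.diff).self_of_nhds.continuousAt
  rw [dslope_same] at h1
  have hmem : {t | DifferentiableAt ℂ w t} ∈ 𝓝 (0 : ℂ) := hw.diff
  have h2 : DifferentiableAt ℂ (deriv w) 0 :=
    ((DifferentiableOn.analyticAt (fun t ht => DifferentiableAt.differentiableWithinAt ht)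
      hmem).deriv).differentiableAt
  have h3 := (hasDerivAt_id (0 : ℂ)).smul h2.hasDerivAt
  simp only [id, zero_smul, one_smul, zero_add] at h3
  refine h3.unique (h1.congr_of_eventuallyEq ?_)
  filter_upwards [hw.eq] with t ht
  rw [← eq_smul_dslope hw.zero]
  simpa using ht

lemma HasUniqueSolution.of_blowUp [CompleteSpace E] {M : E →L[ℂ] E} {H : E × ℂ → E}
    (hH : HolomorphicAlongGraphs M H) (h0 : H 0 = 0) {h a : E}
    (hd : HasDerivAt (fun t => H (0, t)) h 0) (ha : a = M a + h)
    (hinj : ∀ v, M v = v → v = 0)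
    (hU : HasUniqueSolution fun x => blowUp M h a H x - (a + x.1)) : HasUniqueSolution H := by
  obtain ⟨w, hw, huniq⟩ := hU
  refine ⟨fun t => t • (a + w t), ⟨?_, by simp, ?_⟩, fun w' hw' => ?_⟩
  · filter_upwards [hw.diff] with t ht
    exact differentiableAt_id.smul (ht.const_add a)
  · filter_upwards [hw.diff, hw.eq] with t hdt het
    by_cases ht : t = 0
    · subst ht
      simp only [zero_smul]
      exact h0.symm
    have h1 := ((hasDerivAt_id t).smul (hdt.hasDerivAt.const_add a)).deriv
    have h2 : deriv (fun t => t • (a + w t)) t = t • deriv w t + (1 : ℂ) • (a + w t) := h1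
    rw [h2, het, one_smul, sub_add_cancel]
    simp [blowUp, ht, smul_smul]
  · have hda : deriv w' 0 = a := by
      have h1 := hw'.deriv_zero hH hd
      refine sub_eq_zero.1 (hinj _ ?_)
      rw [map_sub]
      nth_rewrite 2 [h1]
      nth_rewrite 2 [ha]
      abel
    have hsol : IsBriotBouquetSolution (fun x => blowUp M h a H x - (a + x.1))
        (fun t => dslope w' 0 t - a) := by
      have hds := eventually_differentiableAt_dslope hw'.diff
      refine ⟨hds.mono fun t ht => ht.sub_const a, by simp [hda], ?_⟩
      filter_upwards [hds, hw'.eq] with t hdt het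
      by_cases ht : t = 0
      · subst ht
        simp [blowUp, hda, ← ha]
      have h2 : deriv w' t = t • deriv (dslope w' 0) t + (1 : ℂ) • dslope w' 0 t := by
        have h1 := (hasDerivAt_id t).smul hdt.hasDerivAt
        exact (h1.congr_of_eventuallyEq
          (Eventually.of_forall (eq_smul_dslope hw'.zero))).deriv
      rw [eq_smul_dslope hw'.zero t, h2] at het
      simp only [blowUp, ht, if_false, add_sub_cancel]
      rw [← het, smul_smul, inv_mul_cancel₀ ht, one_smul, one_smul, add_sub_cancel_right,
        deriv_sub_const_fun]
    filter_upwards [huniq _ hsol] with t ht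
    rw [eq_smul_dslope hw'.zero t, ← ht, add_sub_cancel]

theorem hasUniqueSolution_of_nonresonant [FiniteDimensional ℂ E] (N : ℕ) :
    ∀ (j : ℕ) (M : E →L[ℂ] E),
      ‖M - (j : ℂ) • ContinuousLinearMap.id ℂ E + (N : ℂ) • ContinuousLinearMap.id ℂ E‖ < N →
      (∀ k : ℕ, 1 ≤ k → ∀ v, M v = (k : ℂ) • v → v = 0) →
      ∀ H : E × ℂ → E, HolomorphicAlongGraphs M H → H 0 = 0 → HasUniqueSolution H := by
  have : CompleteSpace E := FiniteDimensional.complete ℂ E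
  intro j
  induction j with
  | zero =>
    intro M hM _ H hH h0
    refine hasUniqueSolution_of_norm_lt hH h0 (N := N) ?_
    simpa using hM
  | succ j ih =>
    intro M hM hk H hH h0
    have hinj : ∀ v, M v = v → v = 0 := fun v hv => hk 1 le_rfl v (by simpa using hv)
    have hd : HasDerivAt (fun t => H (0, t)) (deriv (fun t => H (0, t)) 0) 0 :=
      (hH.eventually_differentiableAt (w := fun _ => 0) (by simp)
        rfl).self_of_nhds.hasDerivAt
    set h := deriv (fun t => H (0, t)) 0
    obtain ⟨a, ha⟩ : ∃ a, a - M a = h := by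
      have hi : Function.Injective ((LinearMap.id : E →ₗ[ℂ] E) - (M : E →ₗ[ℂ] E)) := by
        rw [← LinearMap.ker_eq_bot, LinearMap.ker_eq_bot']
        intro v hv
        exact hinj v (sub_eq_zero.1 hv).symm
      exact LinearMap.injective_iff_surjective.1 hi h
    have ha' : a = M a + h := by rw [← ha]; abel
    refine HasUniqueSolution.of_blowUp hH h0 hd ha' hinj
      (ih (M - ContinuousLinearMap.id ℂ E) ?_ ?_ _ ((hH.blowUp h0 hd a).sub_add_fst a) ?_)
    · convert hM using 3
      push_cast
      module
    · intro k hk1 v hv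
      refine hk (k + 1) (by omega) v ?_
      rw [sub_apply, ContinuousLinearMap.id_apply, sub_eq_iff_eq_add] at hv
      rw [hv]
      push_cast
      module
    · simp [blowUp, ← ha']

/-- A germ of holomorphic invariant curve `{(q t, t)}` of the vector field `(G, F)`, tangent to the
`t`-axis at the origin. -/
structure IsSeparatrix (G : E × ℂ → E) (F : E × ℂ → ℂ) (q : ℂ → E) : Prop where
  diff : ∀ᶠ t in 𝓝 (0 : ℂ), DifferentiableAt ℂ q t
  zero : q 0 = 0
  deriv_zero : deriv q 0 = 0
  eq : ∀ᶠ t in 𝓝 (0 : ℂ), G (q t, t) = F (q t, t) • deriv q t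

lemma smul_deriv_eq_iff {G : E × ℂ → E} {F : E × ℂ → ℂ} {B : E →L[ℂ] E} {c : E →L[ℂ] ℂ} {μ : ℂ}
    {y y' : E} {t : ℂ} (ht : t ≠ 0) (hF : blowUp c μ 0 F (y, t) ≠ 0) :
    t • y' = (blowUp c μ 0 F (y, t))⁻¹ • blowUp B 0 0 G (y, t) - (0 + y) ↔
      G (t • y, t) = F (t • y, t) • (t • y' + (1 : ℂ) • y) := by
  have hG' : G (t • y, t) = t • blowUp B 0 0 G (y, t) := by simp [blowUp, ht, smul_smul]
  have hF' : F (t • y, t) = t * blowUp c μ 0 F (y, t) := by simp [blowUp, ht]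
  rw [hG', hF', mul_smul, smul_right_inj ht, one_smul, zero_add, eq_sub_iff_add_eq,
    eq_inv_smul_iff₀ hF, eq_comm]

theorem exists_unique_isSeparatrix [FiniteDimensional ℂ E] {G : E × ℂ → E} {F : E × ℂ → ℂ}
    {B : E →L[ℂ] E} {c : E →L[ℂ] ℂ} {μ : ℂ} (hG : HolomorphicAlongGraphs B G)
    (hF : HolomorphicAlongGraphs c F) (hG0 : G 0 = 0) (hF0 : F 0 = 0)
    (hGd : HasDerivAt (fun t => G (0, t)) 0 0) (hFd : HasDerivAt (fun t => F (0, t)) μ 0)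
    (hμ : μ ≠ 0) (hB : ∀ k : ℕ, 2 ≤ k → ∀ v, B v = (k * μ) • v → v = 0) :
    ∃ q, IsSeparatrix G F q ∧ ∀ q', IsSeparatrix G F q' → q' =ᶠ[𝓝 0] q := by
  have : CompleteSpace E := FiniteDimensional.complete ℂ E
  have hGb := hG.blowUp hG0 hGd 0
  have hFb := hF.blowUp hF0 hFd 0
  have hGb0 : blowUp B 0 0 G 0 = 0 := by simp [blowUp]
  have hFb0 : blowUp c μ 0 F 0 = μ := by simp [blowUp]
  have hK := (hGb.inv_smul hFb hGb0 (by rwa [hFb0])).sub_add_fst 0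
  rw [hFb0] at hK
  have hne : ∀ w : ℂ → E, (∀ᶠ t in 𝓝 (0 : ℂ), DifferentiableAt ℂ w t) → w 0 = 0 →
      ∀ᶠ t in 𝓝 (0 : ℂ), blowUp c μ 0 F (w t, t) ≠ 0 := by
    intro w hw hw0
    refine (hFb.eventually_differentiableAt hw hw0).self_of_nhds.continuousAt.eventually_ne ?_
    rw [hw0]
    exact hFb0.trans_ne hμ
  obtain ⟨n, hn⟩ := exists_nat_gt ‖μ⁻¹ • B - ContinuousLinearMap.id ℂ E‖
  obtain ⟨w, hw, huniq⟩ := hasUniqueSolution_of_nonresonant n n _ (by simpa using hn)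
    (fun k hk v hv => by
      refine hB (k + 1) (by omega) v ?_
      rw [sub_apply, ContinuousLinearMap.id_apply, smul_apply, sub_eq_iff_eq_add,
        inv_smul_eq_iff₀ hμ] at hv
      rw [hv]
      push_cast
      module) _ hK (by simp [hGb0])
  have hderiv : ∀ {u : ℂ → E} {t : ℂ}, DifferentiableAt ℂ u t →
      HasDerivAt (fun t => t • u t) (t • deriv u t + (1 : ℂ) • u t) t := fun hu =>
    (hasDerivAt_id _).smul hu.hasDerivAt
  refine ⟨fun t => t • w t, ⟨?_, by simp, ?_, ?_⟩, fun q' hq' => ?_⟩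
  · filter_upwards [hw.diff] with t ht
    exact (hderiv ht).differentiableAt
  · rw [(hderiv hw.diff.self_of_nhds).deriv]
    simp [hw.zero]
  · filter_upwards [hw.diff, hw.eq, hne w hw.diff hw.zero] with t hdt het hnt
    rw [(hderiv hdt).deriv]
    by_cases ht : t = 0
    · subst ht
      have h1 : G (0, 0) = 0 := hG0
      simp [h1, hw.zero]
    · exact (smul_deriv_eq_iff ht hnt).1 het
  · have hds := eventually_differentiableAt_dslope hq'.diff
    have hds0 : dslope q' 0 0 = 0 := by rw [dslope_same, hq'.deriv_zero]
    have hsol := huniq (dslope q' 0) ⟨hds, hds0, by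
      filter_upwards [hds, hq'.eq, hne _ hds hds0] with t hdt het hnt
      by_cases ht : t = 0
      · subst ht
        rw [hds0]
        change _ = (blowUp c μ 0 F 0)⁻¹ • blowUp B 0 0 G 0 - (0 + 0)
        simp [hGb0]
      · refine (smul_deriv_eq_iff ht hnt).2 ?_
        rw [← eq_smul_dslope hq'.zero, het, ((hderiv hdt).congr_of_eventuallyEq
          (Eventually.of_forall (eq_smul_dslope hq'.zero))).deriv]⟩
    filter_upwards [hsol] with t ht
    rw [eq_smul_dslope hq'.zero, ht]

/-- An eigenvector of the induced map on the quotient by an eigenline lifts to an eigenvector,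
when the two eigenvalues differ. -/
lemma hasEigenvalue_of_fst_apply_eq {A : E × ℂ →L[ℂ] E × ℂ} {μ ν : ℂ}
    (he : A (0, 1) = μ • ((0 : E), (1 : ℂ))) (hμν : ν ≠ μ) {v : E} (hv : v ≠ 0)
    (hAv : (A (v, 0)).1 = ν • v) :
    Module.End.HasEigenvalue (A : E × ℂ →ₗ[ℂ] E × ℂ) ν := by
  set s := (A (v, 0)).2 / (ν - μ)
  refine Module.End.hasEigenvalue_of_hasEigenvector (x := (v, s))
    ⟨Module.End.mem_eigenspace_iff.2 ?_, fun h => hv (congrArg Prod.fst h)⟩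
  have hdec : ((v, s) : E × ℂ) = (v, 0) + s • ((0 : E), (1 : ℂ)) := by simp
  change A (v, s) = ν • (v, s)
  have hs : s * (ν - μ) = (A (v, 0)).2 := div_mul_cancel₀ _ (sub_ne_zero.2 hμν)
  rw [hdec, map_add, map_smul, he]
  ext1
  · simp [hAv]
  · simp only [Prod.snd_add, Prod.smul_snd, smul_eq_mul, ← hs]
    ring

end Separatrix

theorem stmt7 (m : ℕ) (hm : 1 ≤ m)
    (G : (Fin m → ℂ) × ℂ → (Fin m → ℂ)) (F : (Fin m → ℂ) × ℂ → ℂ)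
    (U : Set ((Fin m → ℂ) × ℂ)) (hU : U ∈ nhds (0 : (Fin m → ℂ) × ℂ))
    (hGF : DifferentiableOn ℂ (fun x => (G x, F x)) U)
    (hG0 : G 0 = 0) (hF0 : F 0 = 0)
    (A : ((Fin m → ℂ) × ℂ) →L[ℂ] ((Fin m → ℂ) × ℂ))
    (hA : HasFDerivAt (fun x => (G x, F x)) A 0)
    (b : Fin (m + 1) → ℂ)
    (hchar : (A : ((Fin m → ℂ) × ℂ) →ₗ[ℂ] ((Fin m → ℂ) × ℂ)).charpoly
      = ∏ i : Fin (m + 1), (Polynomial.X - Polynomial.C (b i)))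
    (he : A ((0 : Fin m → ℂ), (1 : ℂ)) = b (Fin.last m) • ((0 : Fin m → ℂ), (1 : ℂ)))
    (hreal : ∀ i : Fin (m + 1), i ≠ Fin.last m → ∀ r : ℝ, b (Fin.last m) ≠ (r : ℂ) * b i) :
    ∃ q : ℂ → (Fin m → ℂ), ∃ W ∈ nhds (0 : ℂ),
      DifferentiableOn ℂ q W ∧ q 0 = 0 ∧ deriv q 0 = 0 ∧
      (∀ t ∈ W, G (q t, t) = F (q t, t) • deriv q t) ∧
      ∀ q' : ℂ → (Fin m → ℂ), ∀ W' ∈ nhds (0 : ℂ),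
        DifferentiableOn ℂ q' W' → q' 0 = 0 → deriv q' 0 = 0 →
        (∀ t ∈ W', G (q' t, t) = F (q' t, t) • deriv q' t) →
        ∀ᶠ t in nhds (0 : ℂ), q' t = q t := by
  set μ := b (Fin.last m) with hμdef
  have hμ : μ ≠ 0 := by
    have h0 : (⟨0, by omega⟩ : Fin (m + 1)) ≠ Fin.last m := by
      simp only [ne_eq, Fin.ext_iff, Fin.val_last]
      omega
    simpa using hreal _ h0 0
  have hd : ∀ᶠ x in nhds (0 : (Fin m → ℂ) × ℂ), DifferentiableAt ℂ (fun x => (G x, F x)) x := by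
    filter_upwards [eventually_mem_nhds_iff.2 hU] with x hx
    exact hGF.differentiableAt hx
  have hAG : HasFDerivAt G ((ContinuousLinearMap.fst ℂ (Fin m → ℂ) ℂ).comp A) 0 := hA.fst
  have hAF : HasFDerivAt F ((ContinuousLinearMap.snd ℂ (Fin m → ℂ) ℂ).comp A) 0 := hA.snd
  have hline : HasDerivAt (fun t : ℂ => ((0 : Fin m → ℂ), t)) (0, 1) 0 :=
    (hasDerivAt_const (0 : ℂ) (0 : Fin m → ℂ)).prodMk (hasDerivAt_id 0)
  have hGd : HasDerivAt (fun t => G (0, t)) 0 0 :=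
    (HasFDerivAt.comp_hasDerivAt (0 : ℂ) hAG hline).congr_deriv (by simp [he])
  have hFd : HasDerivAt (fun t => F (0, t)) μ 0 :=
    (HasFDerivAt.comp_hasDerivAt (0 : ℂ) hAF hline).congr_deriv (by simp [he])
  obtain ⟨q, hq, huniq⟩ := exists_unique_isSeparatrix
    (.of_hasFDerivAt (hd.mono fun x hx => hx.fst) hAG)
    (.of_hasFDerivAt (hd.mono fun x hx => hx.snd) hAF) hG0 hF0 hGd hFd hμ (by
      intro k hk v hv
      by_contra hv0
      have hk0 : (k : ℂ) ≠ 0 := by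
        have : k ≠ 0 := by omega
        exact_mod_cast this
      have hne : (k : ℂ) * μ ≠ μ := by
        rw [Ne, mul_eq_right₀ hμ]
        have : k ≠ 1 := by omega
        exact_mod_cast this
      have hev := hasEigenvalue_of_fst_apply_eq he hne hv0 hv
      rw [Module.End.hasEigenvalue_iff_isRoot_charpoly, hchar, Polynomial.IsRoot,
        Polynomial.eval_prod, Finset.prod_eq_zero_iff] at hev
      obtain ⟨i, -, hi⟩ := hev
      rw [Polynomial.eval_sub, Polynomial.eval_X, Polynomial.eval_C, sub_eq_zero] at hi
      have hil : i ≠ Fin.last m := by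
        rintro rfl
        exact hne hi
      refine hreal i hil (k : ℝ)⁻¹ ?_
      rw [← hi]
      push_cast
      rw [inv_mul_cancel_left₀ hk0])
  refine ⟨q, {t | DifferentiableAt ℂ q t ∧ G (q t, t) = F (q t, t) • deriv q t},
    hq.diff.and hq.eq, fun t ht => ht.1.differentiableWithinAt, hq.zero, hq.deriv_zero,
    fun t ht => ht.2, fun q' W' hW' hd' h0' h1' he' => huniq q' ⟨?_, h0', h1', ?_⟩⟩
  · filter_upwards [eventually_mem_nhds_iff.2 hW'] with t ht
    exact hd'.differentiableAt ht
  · filter_upwards [hW'] with t ht using he' t ht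
end
end

section
/- Let k ≥ 1 and let v_ε = (f(·,·,ε), g(·,·,ε)), ε ∈ (−ε₀, ε₀), be a family of holomorphic vector fields on a fixed polydisc U ⊂ ℂ², holomorphic in (z,t) and jointly continuous in ε, such that the unperturbed field has the saddle-node form (1): f(z,t,0) = z + A(z,t) with A(0,0) = 0, ∂A/∂z(0,0) = 0 and ∂^jA/∂t^j(0,0) = 0 for 1 ≤ j ≤ k, and g(z,t,0) = t^{k+1}. Then there exist ε₁ > 0, a polydisc U′ ∋ 0, a family Φ_ε : U′ → ℂ² of injective holomorphic maps and a family u_ε : U′ → ℂ∖{0} of nonvanishing holomorphic functions, both jointly continuous in (x, ε), and a family of holomorphic vector fields w_ε of type (1)_ε — namely w_ε(z̃, t̃) = ( z̃(1 + Q̃(z̃, t̃, ε)) + g̃(t̃, ε)·p̃(t̃, ε), p̃(t̃, ε) ) with p̃(t̃, ε) = ∏_{i=0}^{k}(t̃ − α_i(ε)), where Q̃ and g̃ are holomorphic and jointly continuous in ε with Q̃(0,0,0) = 0 and the α_i(ε) are continuous with α_i(0) = 0 — such that for every |ε| < ε₁ and every x ∈ U′: DΦ_ε(x)(v_ε(x))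 = u_ε(x)·w_ε(Φ_ε(x)). In other words, every continuous deformation of a saddle-node field (1) is orbitally analytically equivalent, via a continuous family of analytic changes of variables defined for all small parameter values, to a family of type (1)_ε. -/
noncomputable section

open Complex Set Filter Metric

/-- The Banach algebra of absolutely convergent power series on the closed unit bidisc. -/
def BidiscAlg : Type := lp (fun _ : Fin 2 →₀ ℕ => ℂ) 1

namespace BidiscAlg

instance : NormedAddCommGroup BidiscAlg :=
  inferInstanceAs (NormedAddCommGroup (lp (fun _ : Fin 2 →₀ ℕ => ℂ) 1))

instance : NormedSpace ℂ BidiscAlg :=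
  inferInstanceAs (NormedSpace ℂ (lp (fun _ : Fin 2 →₀ ℕ => ℂ) 1))

instance : CompleteSpace BidiscAlg :=
  inferInstanceAs (CompleteSpace (lp (fun _ : Fin 2 →₀ ℕ => ℂ) 1))

/-- The coefficient of `b` at the exponent `n`. -/
def co (b : BidiscAlg) (n : Fin 2 →₀ ℕ) : ℂ := b.1 n

theorem ext {a b : BidiscAlg} (h : ∀ n, co a n = co b n) : a = b :=
  lp.ext (funext h)

theorem summable_norm (b : BidiscAlg) : Summable fun n => ‖co b n‖ := by
  have := (lp.memℓp (b : lp (fun _ : Fin 2 →₀ ℕ => ℂ) 1)).summable (by simp)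
  simp only [ENNReal.toReal_one, Real.rpow_one] at this
  exact this

theorem norm_eq (b : BidiscAlg) : ‖b‖ = ∑' n, ‖co b n‖ := by
  have := lp.norm_eq_tsum_rpow (p := 1) (by simp) (b : lp (fun _ : Fin 2 →₀ ℕ => ℂ) 1)
  simp only [ENNReal.toReal_one, Real.rpow_one, div_one] at this
  exact this

/-- The element with prescribed absolutely summable coefficients. -/
def mk (f : (Fin 2 →₀ ℕ) → ℂ) (hf : Summable fun n => ‖f n‖) : BidiscAlg :=
  ⟨f, memℓp_gen (by simpa using hf)⟩

@[simp] theorem co_mk (f : (Fin 2 →₀ ℕ) → ℂ) (hf) (n) : co (mk f hf) n = f n := rfl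

@[simp] theorem co_add (a b : BidiscAlg) (n) : co (a + b) n = co a n + co b n := rfl
@[simp] theorem co_sub (a b : BidiscAlg) (n) : co (a - b) n = co a n - co b n := rfl
@[simp] theorem co_zero (n) : co 0 n = 0 := rfl
@[simp] theorem co_smul (c : ℂ) (a : BidiscAlg) (n) : co (c • a) n = c * co a n := rfl

theorem norm_co_le (b : BidiscAlg) (n) : ‖co b n‖ ≤ ‖b‖ := by
  rw [norm_eq]
  exact (summable_norm b).le_tsum n fun _ _ => norm_nonneg _

theorem summable_mul_aux (a b : BidiscAlg) :
    Summable fun n : Fin 2 →₀ ℕ =>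
      ∑ p ∈ Finset.HasAntidiagonal.antidiagonal n, ‖co a p.1‖ * ‖co b p.2‖ := by
  have h : Summable fun q : (Fin 2 →₀ ℕ) × (Fin 2 →₀ ℕ) => ‖co a q.1‖ * ‖co b q.2‖ :=
    (summable_norm a).mul_of_nonneg (summable_norm b) (fun _ => norm_nonneg _)
      fun _ => norm_nonneg _
  exact summable_sum_mul_antidiagonal_of_summable_mul
    (f := fun n => ‖co a n‖) (g := fun n => ‖co b n‖) h

theorem norm_conv_le (a b : BidiscAlg) (n : Fin 2 →₀ ℕ) :
    ‖∑ p ∈ Finset.HasAntidiagonal.antidiagonal n, co a p.1 * co b p.2‖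
      ≤ ∑ p ∈ Finset.HasAntidiagonal.antidiagonal n, ‖co a p.1‖ * ‖co b p.2‖ :=
  (norm_sum_le _ _).trans (by simp)

instance : Mul BidiscAlg where
  mul a b := mk (fun n => ∑ p ∈ Finset.HasAntidiagonal.antidiagonal n, co a p.1 * co b p.2)
    ((summable_mul_aux a b).of_nonneg_of_le (fun _ => norm_nonneg _) (norm_conv_le a b))

theorem co_mul (a b : BidiscAlg) (n) :
    co (a * b) n = ∑ p ∈ Finset.HasAntidiagonal.antidiagonal n, co a p.1 * co b p.2 := rfl

theorem summable_single (m : Fin 2 →₀ ℕ) (c : ℂ) : Summable fun n => ‖if n = m then c else 0‖ :=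
  summable_of_ne_finset_zero (s := {m}) fun n hn => by simp_all

/-- The monomial with exponent `m`. -/
def mono (m : Fin 2 →₀ ℕ) : BidiscAlg := mk (fun n => if n = m then 1 else 0) (summable_single m 1)

theorem co_mono (m n) : co (mono m) n = if n = m then 1 else 0 := rfl

instance : One BidiscAlg := ⟨mono 0⟩

/-- The underlying formal power series. -/
def toPS (b : BidiscAlg) : MvPowerSeries (Fin 2) ℂ := co b

theorem coeff_toPS (b : BidiscAlg) (n) : MvPowerSeries.coeff n (toPS b) = co b n := rfl

theorem toPS_injective : Function.Injective toPS := fun _ _ h => ext fun n => congrFun h n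

theorem toPS_add (a b : BidiscAlg) : toPS (a + b) = toPS a + toPS b := rfl
theorem toPS_zero : toPS 0 = 0 := rfl
theorem toPS_mul (a b : BidiscAlg) : toPS (a * b) = toPS a * toPS b := by
  ext n
  rw [MvPowerSeries.coeff_mul]
  rfl

theorem toPS_mono (m) : toPS (mono m) = MvPowerSeries.monomial m 1 := by
  ext n
  rw [MvPowerSeries.coeff_monomial, coeff_toPS, co_mono]

theorem toPS_one : toPS 1 = 1 := toPS_mono 0

instance : CommRing BidiscAlg :=
  { (inferInstance : AddCommGroup BidiscAlg) with
    mul := (· * ·)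
    one := 1
    left_distrib := fun a b c => toPS_injective (by simp only [toPS_mul, toPS_add, mul_add])
    right_distrib := fun a b c => toPS_injective (by simp only [toPS_mul, toPS_add, add_mul])
    zero_mul := fun a => toPS_injective (by simp only [toPS_mul, toPS_zero, zero_mul])
    mul_zero := fun a => toPS_injective (by simp only [toPS_mul, toPS_zero, mul_zero])
    mul_assoc := fun a b c => toPS_injective (by simp only [toPS_mul, mul_assoc])
    one_mul := fun a => toPS_injective (by simp only [toPS_mul, toPS_one, one_mul])
    mul_one := fun a => toPS_injective (by simp only [toPS_mul, toPS_one, mul_one])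
    mul_comm := fun a b => toPS_injective (by simp only [toPS_mul, mul_comm]) }

instance : NormedCommRing BidiscAlg :=
  { (inferInstance : NormedAddCommGroup BidiscAlg), (inferInstance : CommRing BidiscAlg) with
    norm_mul_le := fun a b => by
      rw [norm_eq (a * b), norm_eq a, norm_eq b,
        (summable_norm a).tsum_mul_tsum_eq_tsum_sum_antidiagonal (summable_norm b)
          ((summable_norm a).mul_of_nonneg (summable_norm b) (fun _ => norm_nonneg _)
            fun _ => norm_nonneg _)]
      exact (summable_norm (a * b)).tsum_le_tsum (norm_conv_le a b) (summable_mul_aux a b) }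

instance : Algebra ℂ BidiscAlg :=
  Algebra.ofModule
    (fun c a b => ext fun n => by
      simp only [co_mul, co_smul, Finset.mul_sum, mul_assoc])
    (fun c a b => ext fun n => by
      simp only [co_mul, co_smul, Finset.mul_sum, mul_left_comm])

instance : NormedAlgebra ℂ BidiscAlg where
  norm_smul_le := norm_smul_le

theorem norm_mono (m) : ‖mono m‖ = 1 := by
  rw [norm_eq, tsum_eq_single m]
  · simp [co_mono]
  · intro n hn; simp [co_mono, hn]

instance : NormOneClass BidiscAlg := ⟨norm_mono 0⟩

theorem mono_mul_mono (m n) : mono m * mono n = mono (m + n) :=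
  toPS_injective (by simp [toPS_mul, toPS_mono, MvPowerSeries.monomial_mul_monomial])

theorem co_mono_mul (m : Fin 2 →₀ ℕ) (b : BidiscAlg) (n : Fin 2 →₀ ℕ) :
    co (mono m * b) n = if m ≤ n then co b (n - m) else 0 := by
  rw [← coeff_toPS, toPS_mul, toPS_mono, MvPowerSeries.coeff_monomial_mul]
  simp [coeff_toPS]

/-! ### Evaluation -/

/-- The value of the monomial with exponent `n` at `x`. -/
def mval (x : ℂ × ℂ) (n : Fin 2 →₀ ℕ) : ℂ := x.1 ^ n 0 * x.2 ^ n 1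

theorem mval_add (x : ℂ × ℂ) (m n) : mval x (m + n) = mval x m * mval x n := by
  simp only [mval, Finsupp.add_apply, pow_add]; ring

theorem norm_mval_le {x : ℂ × ℂ} (hx : ‖x‖ ≤ 1) (n) : ‖mval x n‖ ≤ 1 := by
  have h1 := (norm_fst_le x).trans hx
  have h2 := (norm_snd_le x).trans hx
  rw [mval, norm_mul, norm_pow, norm_pow]
  exact mul_le_one₀ (pow_le_one₀ (norm_nonneg _) h1) (by positivity)
    (pow_le_one₀ (norm_nonneg _) h2)

theorem norm_term_le {x : ℂ × ℂ} (hx : ‖x‖ ≤ 1) (b : BidiscAlg) (n) :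
    ‖co b n * mval x n‖ ≤ ‖co b n‖ := by
  rw [norm_mul]
  exact mul_le_of_le_one_right (norm_nonneg _) (norm_mval_le hx n)

theorem summable_norm_term {x : ℂ × ℂ} (hx : ‖x‖ ≤ 1) (b : BidiscAlg) :
    Summable fun n => ‖co b n * mval x n‖ :=
  (summable_norm b).of_nonneg_of_le (fun _ => norm_nonneg _) (norm_term_le hx b)

theorem summable_term {x : ℂ × ℂ} (hx : ‖x‖ ≤ 1) (b : BidiscAlg) :
    Summable fun n => co b n * mval x n := (summable_norm_term hx b).of_norm

/-- The value of the power series `b` at `x`. -/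
def ev (x : ℂ × ℂ) (b : BidiscAlg) : ℂ := ∑' n, co b n * mval x n

variable {x : ℂ × ℂ}

theorem norm_ev_le (hx : ‖x‖ ≤ 1) (b : BidiscAlg) : ‖ev x b‖ ≤ ‖b‖ := by
  rw [norm_eq]
  exact (norm_tsum_le_tsum_norm (summable_norm_term hx b)).trans
    ((summable_norm_term hx b).tsum_le_tsum (norm_term_le hx b) (summable_norm b))

theorem ev_add (hx : ‖x‖ ≤ 1) (a b : BidiscAlg) : ev x (a + b) = ev x a + ev x b := by
  simp only [ev, co_add, add_mul]
  exact (summable_term hx a).tsum_add (summable_term hx b)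

theorem ev_smul (c : ℂ) (a : BidiscAlg) : ev x (c • a) = c * ev x a := by
  simp only [ev, co_smul, mul_assoc, tsum_mul_left]

theorem ev_mono (m) : ev x (mono m) = mval x m := by
  rw [ev, tsum_eq_single m]
  · simp [co_mono]
  · intro n hn; simp [co_mono, hn]

theorem ev_mul (hx : ‖x‖ ≤ 1) (a b : BidiscAlg) : ev x (a * b) = ev x a * ev x b := by
  have h := summable_mul_of_summable_norm (summable_norm_term hx a) (summable_norm_term hx b)
  rw [ev, ev, ev, Summable.tsum_mul_tsum_eq_tsum_sum_antidiagonal (f := fun n => co a n * mval x n)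
    (g := fun n => co b n * mval x n) (summable_term hx a) (summable_term hx b) h]
  refine tsum_congr fun n => ?_
  rw [co_mul, Finset.sum_mul]
  refine Finset.sum_congr rfl fun p hp => ?_
  rw [← Finset.HasAntidiagonal.mem_antidiagonal.1 hp, mval_add]
  ring

theorem ev_zero : ev x 0 = 0 := by simp [ev]

theorem ev_one : ev x 1 = 1 := by
  have : (1 : BidiscAlg) = mono 0 := rfl
  rw [this, ev_mono]
  simp [mval]

/-- Evaluation at a point of the closed bidisc as a ring homomorphism. -/
def evHom (x : ℂ × ℂ) (hx : ‖x‖ ≤ 1) : BidiscAlg →+* ℂ where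
  toFun := ev x
  map_zero' := ev_zero
  map_one' := ev_one
  map_add' := ev_add hx
  map_mul' := ev_mul hx

theorem ev_sub (hx : ‖x‖ ≤ 1) (a b : BidiscAlg) : ev x (a - b) = ev x a - ev x b :=
  map_sub (evHom x hx) a b

theorem ev_pow (hx : ‖x‖ ≤ 1) (a : BidiscAlg) (n : ℕ) : ev x (a ^ n) = ev x a ^ n :=
  map_pow (evHom x hx) a n

theorem ev_sum (hx : ‖x‖ ≤ 1) {ι : Type*} (s : Finset ι) (f : ι → BidiscAlg) :
    ev x (∑ i ∈ s, f i) = ∑ i ∈ s, ev x (f i) :=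
  map_sum (evHom x hx) f s

theorem ev_apply_zero (b : BidiscAlg) : ev 0 b = co b 0 := by
  rw [ev, tsum_eq_single 0]
  · simp [mval]
  · intro n hn
    have : n 0 ≠ 0 ∨ n 1 ≠ 0 := by
      by_contra! h
      exact hn (Finsupp.ext fun i => by fin_cases i <;> simp [h])
    rcases this with h | h <;> simp [mval, h]

theorem continuous_mval (n) : Continuous fun x => mval x n := by
  unfold mval; fun_prop

theorem continuousOn_ev (b : BidiscAlg) : ContinuousOn (fun x => ev x b) (closedBall 0 1) :=
  continuousOn_tsum (fun n => (continuous_const.mul (continuous_mval n)).continuousOn)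
    (summable_norm b) fun n x hx => norm_term_le (by simpa using hx) b n

theorem continuousOn_ev_uncurry :
    ContinuousOn (fun p : (ℂ × ℂ) × BidiscAlg => ev p.1 p.2) (closedBall 0 1 ×ˢ univ) := by
  rintro ⟨x, b⟩ ⟨hx, -⟩
  have hx' : ‖x‖ ≤ 1 := by simpa using hx
  have h1 : Tendsto (fun p : (ℂ × ℂ) × BidiscAlg => ‖p.2 - b‖ + ‖ev p.1 b - ev x b‖)
      (nhdsWithin (x, b) (closedBall 0 1 ×ˢ univ)) (nhds 0) := by
    have ha : ContinuousWithinAt (fun p : (ℂ × ℂ) × BidiscAlg => ev p.1 b)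
        (closedBall 0 1 ×ˢ univ) (x, b) :=
      ContinuousWithinAt.comp (g := fun x => ev x b) (f := Prod.fst) (t := closedBall 0 1)
        (continuousOn_ev b x hx) continuous_fst.continuousWithinAt fun p hp => hp.1
    have hb : ContinuousWithinAt (fun p : (ℂ × ℂ) × BidiscAlg =>
        ‖p.2 - b‖ + ‖ev p.1 b - ev x b‖) (closedBall 0 1 ×ˢ univ) (x, b) :=
      ((continuous_snd.sub continuous_const).norm.continuousWithinAt).add
        (ha.sub continuousWithinAt_const).norm
    simpa [ContinuousWithinAt] using hb
  rw [ContinuousWithinAt, tendsto_iff_norm_sub_tendsto_zero]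
  refine squeeze_zero' (Eventually.of_forall fun _ => norm_nonneg _) ?_ h1
  filter_upwards [self_mem_nhdsWithin] with p hp
  have hp' : ‖p.1‖ ≤ 1 := by simpa using hp.1
  calc ‖ev p.1 p.2 - ev x b‖ = ‖ev p.1 (p.2 - b) + (ev p.1 b - ev x b)‖ := by
        rw [ev_sub hp']; congr 1; ring
    _ ≤ _ := (norm_add_le _ _).trans (by gcongr; exact norm_ev_le hp' _)

/-! ### Weighted shifts -/

theorem summable_shift (w : (Fin 2 →₀ ℕ) → ℂ) (σ : (Fin 2 →₀ ℕ) → Fin 2 →₀ ℕ) (C : ℝ)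
    (hσ : Function.Injective σ) (hw : ∀ n, ‖w n‖ ≤ C) (b : BidiscAlg) :
    Summable fun n => ‖w n * co b (σ n)‖ :=
  (((summable_norm b).comp_injective hσ).mul_left C).of_nonneg_of_le (fun _ => norm_nonneg _)
    fun n => by
      rw [norm_mul]
      exact mul_le_mul_of_nonneg_right (hw n) (norm_nonneg _)

/-- The operator reindexing coefficients along an injective map and multiplying them with bounded
weights. -/
def shift (w : (Fin 2 →₀ ℕ) → ℂ) (σ : (Fin 2 →₀ ℕ) → Fin 2 →₀ ℕ) (C : ℝ)
    (hσ : Function.Injective σ) (hw : ∀ n, ‖w n‖ ≤ C) : BidiscAlg →L[ℂ] BidiscAlg :=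
  LinearMap.mkContinuous
    { toFun := fun b => mk (fun n => w n * co b (σ n)) (summable_shift w σ C hσ hw b)
      map_add' := fun a b => ext fun n => by simp [mul_add]
      map_smul' := fun c a => ext fun n => by simp [mul_left_comm] } C fun b => by
    have hs := summable_shift w σ C hσ hw b
    have hC : 0 ≤ C := (norm_nonneg _).trans (hw 0)
    rw [norm_eq, norm_eq b]
    calc ∑' n, ‖w n * co b (σ n)‖ ≤ ∑' n, C * ‖co b (σ n)‖ :=
          hs.tsum_le_tsum (fun n => by
            rw [norm_mul]; exact mul_le_mul_of_nonneg_right (hw n) (norm_nonneg _))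
            (((summable_norm b).comp_injective hσ).mul_left C)
      _ = C * ∑' n, ‖co b (σ n)‖ := tsum_mul_left
      _ ≤ C * ∑' n, ‖co b n‖ := mul_le_mul_of_nonneg_left
          (tsum_comp_le_tsum_of_inj (summable_norm b) (fun _ => norm_nonneg _) hσ) hC

theorem co_shift (w σ C hσ hw) (b : BidiscAlg) (n) :
    co (shift w σ C hσ hw b) n = w n * co b (σ n) := rfl

theorem norm_shift_le (w σ C hσ hw) (b : BidiscAlg) : ‖shift w σ C hσ hw b‖ ≤ C * ‖b‖ :=
  ContinuousLinearMap.le_of_opNorm_le _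
    (LinearMap.mkContinuous_norm_le _ ((norm_nonneg _).trans (hw 0)) _) b

/-- The coefficient at `n` as a continuous linear functional. -/
def coCLM (n : Fin 2 →₀ ℕ) : BidiscAlg →L[ℂ] ℂ :=
  LinearMap.mkContinuous
    { toFun := fun b => co b n
      map_add' := fun a b => rfl
      map_smul' := fun c a => rfl } 1 fun b => by rw [one_mul]; exact norm_co_le b n

theorem coCLM_apply (n) (b : BidiscAlg) : coCLM n b = co b n := rfl

/-! ### Differentiation -/

/-- The exponent of the monomial `z`. -/
abbrev e0 : Fin 2 →₀ ℕ := Finsupp.single 0 1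

/-- The exponent of the monomial `t`. -/
abbrev e1 : Fin 2 →₀ ℕ := Finsupp.single 1 1

theorem e0_zero : e0 0 = 1 := by simp [e0]
theorem e0_one : e0 1 = 0 := by simp [e0]
theorem e1_zero : e1 0 = 0 := by simp [e1]
theorem e1_one : e1 1 = 1 := by simp [e1]

theorem single_le_iff (i : Fin 2) (m : ℕ) (n : Fin 2 →₀ ℕ) : Finsupp.single i m ≤ n ↔ m ≤ n i :=
  Finsupp.single_le_iff

theorem notMem_range_add_single {i : Fin 2} {n : Fin 2 →₀ ℕ}
    (h : n ∉ range fun m => m + Finsupp.single i 1) : n i = 0 := by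
  by_contra h0
  exact h ⟨n - Finsupp.single i 1,
    tsub_add_cancel_of_le ((single_le_iff i 1 n).2 (Nat.one_le_iff_ne_zero.2 h0))⟩

/-- The weighted term of a termwise derivative. -/
theorem hasSum_deriv_term {b c : BidiscAlg} (i : Fin 2)
    (hc : ∀ n, co c n = (n i + 1) * co b (n + Finsupp.single i 1)) (hx : ‖x‖ ≤ 1) :
    HasSum (fun n => (n i : ℂ) * co b n * mval x (n - Finsupp.single i 1)) (ev x c) := by
  have hinj : Function.Injective fun m : Fin 2 →₀ ℕ => m + Finsupp.single i 1 :=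
    add_left_injective _
  have h : HasSum _ (ev x c) := (summable_term hx c).hasSum
  refine (hinj.hasSum_iff fun n hn => ?_).1 ?_
  · simp [notMem_range_add_single hn]
  · convert h using 2 with n
    simp [hc]

theorem summable_deriv_norm {b c : BidiscAlg} (i : Fin 2)
    (hc : ∀ n, co c n = (n i + 1) * co b (n + Finsupp.single i 1)) :
    Summable fun n => ‖(n i : ℂ) * co b n‖ := by
  have hinj : Function.Injective fun m : Fin 2 →₀ ℕ => m + Finsupp.single i 1 :=
    add_left_injective _
  refine (hinj.summable_iff fun n hn => ?_).1 ?_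
  · simp [notMem_range_add_single hn]
  · convert summable_norm c using 2 with n
    rw [hc, Function.comp_apply, Finsupp.add_apply, Finsupp.single_eq_same, Nat.cast_add_one]

theorem hasFDerivAt_mval (n : Fin 2 →₀ ℕ) (x : ℂ × ℂ) :
    HasFDerivAt (fun x => mval x n)
      (((n 0 : ℂ) * mval x (n - e0)) • ContinuousLinearMap.fst ℂ ℂ ℂ
        + ((n 1 : ℂ) * mval x (n - e1)) • ContinuousLinearMap.snd ℂ ℂ ℂ) x := by
  have h1 : HasFDerivAt (fun x : ℂ × ℂ => x.1 ^ n 0) _ x :=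
    (hasFDerivAt_fst (𝕜 := ℂ) (p := x)).pow (n 0)
  have h2 : HasFDerivAt (fun x : ℂ × ℂ => x.2 ^ n 1) _ x :=
    (hasFDerivAt_snd (𝕜 := ℂ) (p := x)).pow (n 1)
  refine (h1.mul h2).congr_fderiv ?_
  ext <;> simp [mval, Finsupp.tsub_apply] <;> ring

theorem hasFDerivAt_ev {b bz bt : BidiscAlg}
    (hz : ∀ n, co bz n = (n 0 + 1) * co b (n + e0))
    (ht : ∀ n, co bt n = (n 1 + 1) * co b (n + e1)) (hx : ‖x‖ < 1) :
    HasFDerivAt (fun x => ev x b) (ev x bz • ContinuousLinearMap.fst ℂ ℂ ℂ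
        + ev x bt • ContinuousLinearMap.snd ℂ ℂ ℂ) x := by
  have key := hasFDerivAt_tsum_of_isPreconnected (𝕜 := ℂ) (x₀ := (0 : ℂ × ℂ)) (x := x)
    (u := fun n => ‖(n 0 : ℂ) * co b n‖ + ‖(n 1 : ℂ) * co b n‖)
    (f := fun (n : Fin 2 →₀ ℕ) x => co b n * mval x n)
    (f' := fun n x => ((n 0 : ℂ) * co b n * mval x (n - e0)) • ContinuousLinearMap.fst ℂ ℂ ℂ
        + ((n 1 : ℂ) * co b n * mval x (n - e1)) • ContinuousLinearMap.snd ℂ ℂ ℂ)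
    ((summable_deriv_norm 0 hz).add (summable_deriv_norm 1 ht)) (isOpen_ball (x := (0 : ℂ × ℂ))
      (ε := 1)) (convex_ball _ _).isPreconnected ?_ ?_ (by simp) ?_ (by simpa using hx)
  · refine key.congr_fderiv ?_
    have h0 := hasSum_deriv_term 0 hz hx.le
    have h1 := hasSum_deriv_term 1 ht hx.le
    exact ((h0.smul_const _).add (h1.smul_const _)).tsum_eq
  · intro n y _
    refine ((hasFDerivAt_mval n y).const_mul (co b n)).congr_fderiv ?_
    ext <;> simp <;> ring
  · intro n y hy
    have hy' : ‖y‖ ≤ 1 := by simpa using (mem_ball_zero_iff.1 hy).le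
    refine (norm_add_le _ _).trans (add_le_add ?_ ?_)
    · rw [norm_smul, norm_mul]
      exact (mul_le_of_le_one_right (by positivity) (ContinuousLinearMap.norm_fst_le ℂ ℂ ℂ)).trans
        (mul_le_of_le_one_right (norm_nonneg _) (norm_mval_le hy' _))
    · rw [norm_smul, norm_mul]
      exact (mul_le_of_le_one_right (by positivity) (ContinuousLinearMap.norm_snd_le ℂ ℂ ℂ)).trans
        (mul_le_of_le_one_right (norm_nonneg _) (norm_mval_le hy' _))
  · exact summable_term (by simp) b

theorem mval_half (n : Fin 2 →₀ ℕ) (x : ℂ × ℂ) :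
    mval ((2⁻¹ : ℂ) • x) n = 2⁻¹ ^ (n 0 + n 1) * mval x n := by
  simp only [mval, Prod.smul_fst, Prod.smul_snd, smul_eq_mul, mul_pow, pow_add]; ring

theorem norm_half_pow (n : ℕ) : ‖(2⁻¹ : ℂ) ^ n‖ = (2 ^ n : ℝ)⁻¹ := by
  simp

/-- Precomposition with the contraction by the factor `1/2`. -/
def half : BidiscAlg →L[ℂ] BidiscAlg :=
  shift (fun n => 2⁻¹ ^ (n 0 + n 1)) id 1 Function.injective_id fun n => by
    rw [norm_half_pow]
    exact inv_le_one_of_one_le₀ (one_le_pow₀ (by norm_num))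

theorem ev_half (x : ℂ × ℂ) (b : BidiscAlg) : ev x (half b) = ev ((2⁻¹ : ℂ) • x) b := by
  refine tsum_congr fun n => ?_
  rw [half, co_shift, mval_half, id]; ring

/-- The partial derivative in the direction `i` after a contraction by the factor `1/2`. -/
def dhalf (i : Fin 2) : BidiscAlg →L[ℂ] BidiscAlg :=
  shift (fun n => (n i + 1) * 2⁻¹ ^ (n 0 + n 1 + 1)) (fun n => n + Finsupp.single i 1) 1
    (add_left_injective _) fun n => by
      rw [norm_mul, norm_half_pow, ← div_eq_mul_inv, div_le_one (by positivity)]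
      have h1 : n i + 1 ≤ n 0 + n 1 + 1 := by fin_cases i <;> simp
      have h2 : ‖(n i : ℂ) + 1‖ = ((n i + 1 : ℕ) : ℝ) := by
        rw [← Nat.cast_add_one, Complex.norm_natCast]
      rw [h2]
      exact_mod_cast h1.trans Nat.lt_two_pow_self.le

theorem co_dhalf (i : Fin 2) (b : BidiscAlg) (n) :
    co (dhalf i b) n = (n i + 1) * co (half b) (n + Finsupp.single i 1) := by
  rw [dhalf, half, co_shift, co_shift, id, mul_assoc]
  congr 3
  fin_cases i <;> simp <;> ring

theorem hasFDerivAt_ev_half (b : BidiscAlg) (hx : ‖x‖ < 1) :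
    HasFDerivAt (fun x => ev x (half b)) (ev x (dhalf 0 b) • ContinuousLinearMap.fst ℂ ℂ ℂ
        + ev x (dhalf 1 b) • ContinuousLinearMap.snd ℂ ℂ ℂ) x :=
  hasFDerivAt_ev (co_dhalf 0 b) (co_dhalf 1 b) hx

theorem differentiableAt_ev (b : BidiscAlg) (hx : ‖x‖ < 1 / 2) :
    DifferentiableAt ℂ (fun x => ev x b) x := by
  have h2 : ‖(2 : ℂ) • x‖ < 1 := by rw [norm_smul]; simp; linarith
  have h := (hasFDerivAt_ev_half b h2).differentiableAt.comp x
    (differentiableAt_id.const_smul (2 : ℂ))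
  refine h.congr_of_eventuallyEq (Eventually.of_forall fun y => ?_)
  simp [ev_half, smul_smul]

/-! ### Taylor expansion with parameters -/

/-- Evaluation at a point of the closed bidisc as a continuous linear functional. -/
def evCLM (x : ℂ × ℂ) (hx : ‖x‖ ≤ 1) : BidiscAlg →L[ℂ] ℂ :=
  LinearMap.mkContinuous
    { toFun := ev x
      map_add' := ev_add hx
      map_smul' := fun c a => ev_smul c a } 1 fun b => by rw [one_mul]; exact norm_ev_le hx b

theorem evCLM_apply (hx : ‖x‖ ≤ 1) (b : BidiscAlg) : evCLM x hx b = ev x b := rfl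

theorem ev_algebraMap (c : ℂ) : ev x (algebraMap ℂ BidiscAlg c) = c := by
  rw [Algebra.algebraMap_eq_smul_one, ev_smul, ev_one, mul_one]

/-- The Cauchy kernel `(ζ - a)⁻¹ dζ` on the circle of radius `r`. -/
def cauchyKernel (a : BidiscAlg) (r θ : ℝ) : BidiscAlg :=
  deriv (circleMap 0 r) θ • Ring.inverse (algebraMap ℂ BidiscAlg (circleMap 0 r θ) - a)

theorem isUnit_circleMap_sub {a : BidiscAlg} {r : ℝ} (hr : 0 < r) (ha : ‖a‖ < r) (θ : ℝ) :
    IsUnit (algebraMap ℂ BidiscAlg (circleMap 0 r θ) - a) :=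
  spectrum.mem_resolventSet_of_norm_lt (by rwa [norm_circleMap_zero, abs_of_pos hr])

theorem continuous_cauchyKernel {a : BidiscAlg} {r : ℝ} (hr : 0 < r) (ha : ‖a‖ < r) :
    Continuous (cauchyKernel a r) := by
  have hd : Continuous fun θ => deriv (circleMap 0 r) θ := by
    simp only [deriv_circleMap]; fun_prop
  refine hd.smul (g := fun θ => Ring.inverse (algebraMap ℂ BidiscAlg (circleMap 0 r θ) - a)) ?_
  rw [continuous_iff_continuousAt]
  intro θ
  refine ContinuousAt.comp (g := Ring.inverse)
    (f := fun θ => algebraMap ℂ BidiscAlg (circleMap 0 r θ) - a) ?_ ?_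
  · exact NormedRing.inverse_continuousAt (isUnit_circleMap_sub hr ha θ).unit
  · exact (((continuous_algebraMap ℂ BidiscAlg).comp (continuous_circleMap 0 r)).sub
      continuous_const).continuousAt

theorem ev_cauchyKernel {a : BidiscAlg} {r : ℝ} (hr : 0 < r) (ha : ‖a‖ < r) (hx : ‖x‖ ≤ 1)
    (θ : ℝ) : ev x (cauchyKernel a r θ)
      = deriv (circleMap 0 r) θ * (circleMap 0 r θ - ev x a)⁻¹ := by
  have h := congrArg (ev x) (Ring.mul_inverse_cancel _ (isUnit_circleMap_sub hr ha θ))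
  rw [ev_mul hx, ev_sub hx, ev_algebraMap, ev_one] at h
  rw [cauchyKernel, ev_smul, eq_inv_of_mul_eq_one_right h]

theorem exists_taylor {S : Set ℝ} {δ R : ℝ} (hR : 0 < R) (hRδ : R < δ) (h : ℝ → ℂ × ℂ → ℂ)
    (hd : ∀ ε ∈ S, DifferentiableOn ℂ (h ε) (ball 0 δ))
    (hc : ContinuousOn (fun w : (ℂ × ℂ) × ℝ => h w.2 w.1) (ball 0 δ ×ˢ S)) :
    ∃ b : ℝ → BidiscAlg, ContinuousOn b S ∧
      ∀ ε ∈ S, ∀ x : ℂ × ℂ, ‖x‖ ≤ 1 → ev x (b ε) = h ε ((R : ℂ) • x) := by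
  obtain ⟨r, hRr, hrδ⟩ := exists_between hRδ
  have hr : 0 < r := hR.trans hRr
  have hnorm (m) : ‖(R : ℂ) • mono m‖ < r := by
    rw [norm_smul, norm_mono, Complex.norm_real, Real.norm_of_nonneg hR.le, mul_one]; exact hRr
  set k0 := cauchyKernel ((R : ℂ) • mono e0) r
  set k1 := cauchyKernel ((R : ℂ) • mono e1) r
  have hk0 : Continuous k0 := continuous_cauchyKernel hr (hnorm e0)
  have hk1 : Continuous k1 := continuous_cauchyKernel hr (hnorm e1)
  have hmem (θ η : ℝ) : (circleMap 0 r θ, circleMap 0 r η) ∈ ball (0 : ℂ × ℂ) δ := by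
    rw [mem_ball_zero_iff, Prod.norm_def]
    simp [abs_of_pos hr, hrδ]
  set G : S → ℝ → ℝ → BidiscAlg := fun ε θ η =>
    h ε (circleMap 0 r θ, circleMap 0 r η) • (k0 θ * k1 η) with hG
  have hGc : Continuous fun q : (S × ℝ) × ℝ => G q.1.1 q.1.2 q.2 := by
    have hkc : Continuous fun q : (S × ℝ) × ℝ => k0 q.1.2 * k1 q.2 :=
      (hk0.comp (continuous_snd.comp continuous_fst)).mul (hk1.comp continuous_snd)
    have hhc : Continuous fun q : (S × ℝ) × ℝ =>
        h q.1.1 (circleMap 0 r q.1.2, circleMap 0 r q.2) := hc.comp_continuous (f := fun q : (S × ℝ) × ℝ =>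
      (((circleMap 0 r q.1.2, circleMap 0 r q.2) : ℂ × ℂ), (q.1.1 : ℝ)))
      (by fun_prop) fun q => ⟨hmem _ _, q.1.1.2⟩
    exact hhc.smul hkc
  have hI1 : Continuous fun q : S × ℝ => ∫ η in 0..2 * Real.pi, G q.1 q.2 η :=
    intervalIntegral.continuous_parametric_intervalIntegral_of_continuous'
      (f := fun (q : S × ℝ) η => G q.1 q.2 η) hGc 0 _
  have hI2 : Continuous fun ε : S => ∫ θ in 0..2 * Real.pi, ∫ η in 0..2 * Real.pi, G ε θ η :=
    intervalIntegral.continuous_parametric_intervalIntegral_of_continuous'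
      (f := fun (ε : S) θ => ∫ η in 0..2 * Real.pi, G ε θ η) hI1 0 _
  refine ⟨fun ε => ((2 * Real.pi * I : ℂ)⁻¹ * (2 * Real.pi * I : ℂ)⁻¹) •
    ∫ θ in 0..2 * Real.pi, ∫ η in 0..2 * Real.pi,
      h ε (circleMap 0 r θ, circleMap 0 r η) • (k0 θ * k1 η), ?_, ?_⟩
  · rw [continuousOn_iff_continuous_domRestrict]
    exact hI2.const_smul ((2 * Real.pi * I : ℂ)⁻¹ * (2 * Real.pi * I : ℂ)⁻¹)
  intro ε hε x hx
  have hx1 : ‖(R : ℂ) * x.1‖ < r := by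
    rw [norm_mul, Complex.norm_real, Real.norm_of_nonneg hR.le]
    exact (mul_le_of_le_one_right hR.le ((norm_fst_le x).trans hx)).trans_lt hRr
  have hx2 : ‖(R : ℂ) * x.2‖ < r := by
    rw [norm_mul, Complex.norm_real, Real.norm_of_nonneg hR.le]
    exact (mul_le_of_le_one_right hR.le ((norm_snd_le x).trans hx)).trans_lt hRr
  have hev0 : ev x ((R : ℂ) • mono e0) = R * x.1 := by rw [ev_smul, ev_mono]; simp [mval]
  have hev1 : ev x ((R : ℂ) • mono e1) = R * x.2 := by rw [ev_smul, ev_mono]; simp [mval]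
  have hpt {a b : ℂ} (ha : ‖a‖ ≤ r) (hb : ‖b‖ ≤ r) : (a, b) ∈ ball (0 : ℂ × ℂ) δ := by
    rw [mem_ball_zero_iff, Prod.norm_def]
    exact (max_le ha hb).trans_lt hrδ
  have inner (ζ : ℂ) (hζ : ‖ζ‖ ≤ r) : ∫ η in 0..2 * Real.pi, ev x (k1 η) *
      h ε (ζ, circleMap 0 r η) = (2 * Real.pi * I : ℂ) * h ε (ζ, R * x.2) := by
    have := DifferentiableOn.circleIntegral_sub_inv_smul (R := r) (c := 0) (w := R * x.2)
      (f := fun t => h ε (ζ, t)) ((hd ε hε).comp (by fun_prop)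
        fun t ht => hpt hζ (by simpa using ht)) (by simpa using hx2)
    rw [smul_eq_mul] at this
    rw [← this, circleIntegral]
    refine intervalIntegral.integral_congr fun η _ => ?_
    simp only [k1, ev_cauchyKernel hr (hnorm e1) hx, hev1, smul_eq_mul, mul_assoc]
  have outer : ∫ θ in 0..2 * Real.pi, ev x (k0 θ) *
      h ε (circleMap 0 r θ, R * x.2) = (2 * Real.pi * I : ℂ) * h ε (R * x.1, R * x.2) := by
    have := DifferentiableOn.circleIntegral_sub_inv_smul (R := r) (c := 0) (w := R * x.1)
      (f := fun z => h ε (z, R * x.2)) ((hd ε hε).comp (by fun_prop)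
        fun t ht => hpt (by simpa using ht) hx2.le) (by simpa using hx1)
    rw [smul_eq_mul] at this
    rw [← this, circleIntegral]
    refine intervalIntegral.integral_congr fun η _ => ?_
    simp only [k0, ev_cauchyKernel hr (hnorm e0) hx, hev0, smul_eq_mul, mul_assoc]
  have e1 : ev x (∫ θ in 0..2 * Real.pi, ∫ η in 0..2 * Real.pi,
      h ε (circleMap 0 r θ, circleMap 0 r η) • (k0 θ * k1 η))
      = ∫ θ in 0..2 * Real.pi, ∫ η in 0..2 * Real.pi,
        ev x (h ε (circleMap 0 r θ, circleMap 0 r η) • (k0 θ * k1 η)) := by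
    have hθ : Continuous fun θ => ∫ η in 0..2 * Real.pi, G ⟨ε, hε⟩ θ η :=
      hI1.comp (f := fun θ : ℝ => ((⟨ε, hε⟩ : S), θ)) (by fun_prop)
    rw [← evCLM_apply hx, ← (evCLM x hx).intervalIntegral_comp_comm
      (hθ.intervalIntegrable _ _)]
    refine intervalIntegral.integral_congr fun θ _ => ?_
    have hη : Continuous fun η => G ⟨ε, hε⟩ θ η :=
      hGc.comp (f := fun η : ℝ => (((⟨ε, hε⟩ : S), θ), η)) (by fun_prop)
    exact ((evCLM x hx).intervalIntegral_comp_comm (hη.intervalIntegrable _ _)).symm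
  have e2 (θ : ℝ) : ∫ η in 0..2 * Real.pi,
        ev x (h ε (circleMap 0 r θ, circleMap 0 r η) • (k0 θ * k1 η))
      = (2 * Real.pi * I : ℂ) * (ev x (k0 θ) * h ε (circleMap 0 r θ, R * x.2)) := by
    rw [mul_left_comm, ← inner _ (by simp [abs_of_pos hr]), ← intervalIntegral.integral_const_mul]
    refine intervalIntegral.integral_congr fun η _ => ?_
    simp only [ev_smul, ev_mul hx]; ring
  have hpi : (2 * Real.pi * I : ℂ) ≠ 0 := two_pi_I_ne_zero
  change ev x (_ • _) = _
  rw [ev_smul, e1]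
  simp only [e2]
  rw [intervalIntegral.integral_const_mul, outer]
  change _ = h ε (R * x.1, R * x.2)
  field_simp

end BidiscAlg

section ContinuousRoots

open Polynomial

theorem Polynomial.exists_root_dist_lt {p : ℂ[X]} (hm : p.Monic) (hn : p.natDegree ≠ 0) (z : ℂ) :
    ∃ w, p.eval w = 0 ∧ ∀ η : ℝ, 0 ≤ η → ‖p.eval z‖ < η ^ p.natDegree → dist z w < η := by
  have hne : p.roots.toFinset.Nonempty := by
    obtain ⟨w, hw⟩ := IsAlgClosed.exists_root p fun h => hn (natDegree_eq_of_degree_eq_some h)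
    exact ⟨w, by rw [Multiset.mem_toFinset, mem_roots hm.ne_zero]; exact hw⟩
  obtain ⟨w, hw, hmin⟩ := Finset.exists_min_image _ (fun w => dist z w) hne
  rw [Multiset.mem_toFinset, mem_roots hm.ne_zero] at hw
  refine ⟨w, hw, fun η hη h => ?_⟩
  by_contra! hle
  have key : ∀ s : Multiset ℂ, (∀ v ∈ s, η ≤ dist z v) →
      η ^ Multiset.card s ≤ ‖(s.map fun v => z - v).prod‖ := by
    intro s
    induction s using Multiset.induction_on with
    | empty => simp
    | cons v s ih =>
      intro hs
      rw [Multiset.card_cons, Multiset.map_cons, Multiset.prod_cons, norm_mul, pow_succ']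
      refine mul_le_mul ?_ (ih fun u hu => hs u (Multiset.mem_cons_of_mem hu)) (by positivity)
        (norm_nonneg _)
      rw [← dist_eq_norm]
      exact hs v (Multiset.mem_cons_self v s)
  have h1 := key p.roots fun v hv => hle.trans (hmin v (by simpa using hv))
  have h2 : p = (p.roots.map fun a => X - C a).prod :=
    (IsAlgClosed.splits p).eq_prod_roots_of_monic hm
  have h3 : p.eval z = (p.roots.map fun v => z - v).prod := by
    conv_lhs => rw [h2]
    rw [eval_multiset_prod, Multiset.map_map]
    simp
  rw [← h3, IsAlgClosed.card_roots_eq_natDegree] at h1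
  exact absurd h (not_lt.2 h1)

/-- A chain of points with steps at most `η` that stays `η`-close to a finite set `S` moves at most
by `3 * #S * η`. -/
theorem dist_le_of_chain {η : ℝ} (hη : 0 ≤ η) (x : ℕ → ℂ) (S : Finset ℂ) :
    ∀ {i j : ℕ}, i ≤ j → (∀ l, i ≤ l → l < j → dist (x l) (x (l + 1)) ≤ η) →
      (∀ l, i ≤ l → l ≤ j → ∃ s ∈ S, dist (x l) s ≤ η) →
      dist (x i) (x j) ≤ 3 * S.card * η := by
  classical
  induction hN : S.card generalizing S with
  | zero =>
    intro i j hij _ h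
    obtain ⟨s, hs, -⟩ := h i le_rfl hij
    simp [Finset.card_eq_zero.1 hN] at hs
  | succ N ih =>
    intro i j hij hstep h
    obtain ⟨s, hs, his⟩ := h i le_rfl hij
    set P := (Finset.Icc i j).filter fun l => dist (x l) s ≤ η with hP
    have hPne : P.Nonempty := ⟨i, by simp [hP, hij, his]⟩
    obtain ⟨l, hl, hmax⟩ := Finset.exists_max_image P id hPne
    simp only [hP, Finset.mem_filter, Finset.mem_Icc, id] at hl hmax
    have hil : dist (x i) (x l) ≤ 2 * η := by
      have := dist_triangle_right (x i) (x l) s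
      linarith [hl.2]
    rcases hl.1.2.eq_or_lt with rfl | hlj
    · refine hil.trans ?_
      push_cast
      nlinarith [mul_nonneg (Nat.cast_nonneg N : (0 : ℝ) ≤ N) hη]
    · have h1 := ih (S.erase s) (by rw [Finset.card_erase_of_mem hs, hN]; rfl) (i := l + 1) (j := j)
        hlj (fun m hm hmj => hstep m (by omega) hmj) fun m hm hmj => by
          obtain ⟨s', hs', hd⟩ := h m (by omega) hmj
          refine ⟨s', Finset.mem_erase.2 ⟨?_, hs'⟩, hd⟩
          rintro rfl
          have := hmax m ⟨⟨by omega, hmj⟩, hd⟩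
          omega
      have h2 := hstep l hl.1.1 hlj
      have h3 := dist_triangle4 (x i) (x l) (x (l + 1)) (x j)
      push_cast
      linarith

theorem Polynomial.continuous_eval_family {n : ℕ} {p : ℝ → ℂ[X]} (hd : ∀ s, (p s).natDegree = n)
    (hc : ∀ i, Continuous fun s => (p s).coeff i) :
    Continuous fun q : ℝ × ℂ => (p q.1).eval q.2 := by
  simp_rw [eval_eq_sum_range, hd]
  exact continuous_finsetSum _ fun i _ => ((hc i).comp continuous_fst).mul (by fun_prop)

theorem Polynomial.exists_root_bound {n : ℕ} {p : ℝ → ℂ[X]} (hm : ∀ s, (p s).Monic)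
    (hd : ∀ s, (p s).natDegree = n) (hc : ∀ i, Continuous fun s => (p s).coeff i) (L : ℝ) :
    ∃ M : ℝ, ∀ s ∈ Icc 0 L, ∀ z, (p s).eval z = 0 → ‖z‖ ≤ M := by
  obtain ⟨M, hM⟩ := isCompact_Icc.exists_bound_of_continuousOn (s := Icc 0 L)
    (f := fun s => ∑ i ∈ Finset.range n, ‖(p s).coeff i‖ + 1)
    (Continuous.continuousOn (by fun_prop))
  refine ⟨M, fun s hs z hz => ?_⟩
  have h1 := (IsRoot.norm_lt_cauchyBound (hm s).ne_zero hz).le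
  have h2 : (cauchyBound (p s) : ℝ) ≤ ∑ i ∈ Finset.range n, ‖(p s).coeff i‖ + 1 := by
    rw [cauchyBound, (hm s).leadingCoeff, hd, nnnorm_one, div_one, NNReal.coe_add, NNReal.coe_one]
    gcongr
    have : (Finset.range n).sup (fun i => ‖(p s).coeff i‖₊)
        ≤ ∑ i ∈ Finset.range n, ‖(p s).coeff i‖₊ :=
      Finset.sup_le fun i hi =>
        Finset.single_le_sum (f := fun i => ‖(p s).coeff i‖₊) (fun _ _ => zero_le) hi
    simpa using NNReal.coe_le_coe.2 this
  have h3 := (le_abs_self _).trans (hM s hs)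
  calc ‖z‖ ≤ (cauchyBound (p s) : ℝ) := by exact_mod_cast h1
    _ ≤ M := h2.trans h3

theorem Polynomial.exists_continuous_root {n : ℕ} (hn : n ≠ 0) {p : ℝ → ℂ[X]}
    (hm : ∀ s, (p s).Monic) (hd : ∀ s, (p s).natDegree = n)
    (hc : ∀ i, Continuous fun s => (p s).coeff i) (L : ℝ) :
    ∃ α : ℝ → ℂ, ContinuousOn α (Icc 0 L) ∧ ∀ s ∈ Icc 0 L, (p s).eval (α s) = 0 := by
  obtain ⟨M, hM⟩ := exists_root_bound hm hd hc L
  choose nr hnr hnear using fun s z =>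
    exists_root_dist_lt (hm s) (by rw [hd]; exact hn) z
  have hev := continuous_eval_family hd hc
  have hmod : ∀ η > 0, ∃ δ > 0, ∀ s ∈ Icc 0 L, ∀ s' ∈ Icc 0 L, |s - s'| < δ →
      ∀ z, (p s).eval z = 0 → dist z (nr s' z) < η := by
    intro η hη
    have hK : IsCompact (Icc 0 L ×ˢ closedBall (0 : ℂ) M) :=
      isCompact_Icc.prod (isCompact_closedBall _ _)
    obtain ⟨δ, hδ, h⟩ := Metric.uniformContinuousOn_iff.1
      (hK.uniformContinuousOn_of_continuous hev.continuousOn) (η ^ n) (by positivity)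
    refine ⟨δ, hδ, fun s hs s' hs' hss z hz => hnear s' z η hη.le ?_⟩
    have hzM : z ∈ closedBall (0 : ℂ) M := by simpa using hM s hs z hz
    have := h (s, z) ⟨hs, hzM⟩ (s', z) ⟨hs', hzM⟩ (by simpa [Prod.dist_eq, Real.dist_eq, hδ] using hss)
    simpa [hz, hd] using this
  set ch : ℕ → ℕ → ℂ := fun m i =>
    Nat.rec (nr 0 0) (fun i z => nr ((i + 1 : ℕ) / (m + 1 : ℕ)) z) i with hch
  have ch_succ (m i : ℕ) : ch m (i + 1) = nr ((i + 1 : ℕ) / (m + 1 : ℕ)) (ch m i) := rfl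
  have ch_root (m i : ℕ) : (p ((i : ℕ) / (m + 1 : ℕ))).eval (ch m i) = 0 := by
    cases i with
    | zero =>
      have : ch m 0 = nr 0 0 := rfl
      simpa [this] using hnr 0 0
    | succ i => rw [ch_succ]; exact hnr _ _
  set idx : ℕ → ℝ → ℕ := fun m s => ⌊s * (m + 1 : ℕ)⌋₊ with hidx
  have idx_le (m : ℕ) {s : ℝ} (hs : 0 ≤ s) : (idx m s : ℝ) / (m + 1 : ℕ) ≤ s := by
    rw [div_le_iff₀ (by positivity)]
    exact Nat.floor_le (by positivity)
  have idx_gt (m : ℕ) (s : ℝ) : s - 1 / (m + 1 : ℕ) < (idx m s : ℝ) / (m + 1 : ℕ) := by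
    rw [lt_div_iff₀ (by positivity), sub_mul, one_div_mul_cancel (by positivity)]
    exact Nat.sub_one_lt_floor _
  have idx_mem (m : ℕ) {s : ℝ} (hs : s ∈ Icc 0 L) {l : ℕ} (hl : l ≤ idx m s) :
      (l : ℝ) / (m + 1 : ℕ) ∈ Icc 0 L := by
    refine ⟨by positivity, le_trans ?_ ((idx_le m hs.1).trans hs.2)⟩
    gcongr
  have hmesh : Tendsto (fun m : ℕ => 1 / ((m + 1 : ℕ) : ℝ)) atTop (nhds 0) := by
    simpa using tendsto_one_div_add_atTop_nhds_zero_nat (𝕜 := ℝ)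
  have hosc : ∀ η > 0, ∃ δ > 0, ∀ᶠ m in atTop, ∀ s ∈ Icc 0 L, ∀ s' ∈ Icc 0 L, s ≤ s' → s' - s < δ →
      dist (ch m (idx m s)) (ch m (idx m s')) ≤ 3 * n * η := by
    intro η hη
    obtain ⟨δ, hδ, h⟩ := hmod η hη
    refine ⟨δ / 2, by positivity, ?_⟩
    filter_upwards [hmesh.eventually_lt_const (show 0 < δ / 2 by positivity)] with m hmm
    intro s hs s' hs' hle hlt
    set i := idx m s
    set j := idx m s'
    have hij : i ≤ j := Nat.floor_mono (by gcongr)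
    set S := (p (i / (m + 1 : ℕ))).roots.toFinset
    have hcard : S.card ≤ n := by
      refine (Multiset.toFinset_card_le _).trans ((card_roots' _).trans (hd _).le)
    have hpos : (0 : ℝ) < (m + 1 : ℕ) := by positivity
    refine (dist_le_of_chain hη.le (ch m) S hij ?_ ?_).trans ?_
    · intro l hil hlj
      rw [ch_succ]
      refine (h _ (idx_mem m hs' hlj.le) _ (idx_mem m hs' (Nat.succ_le_of_lt hlj)) ?_ _
        (ch_root m l)).le
      rw [← sub_div, abs_div, abs_of_pos hpos]
      push_cast at hmm ⊢
      simp only [sub_add_cancel_left, abs_neg, abs_one]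
      linarith
    · intro l hil hlj
      refine ⟨nr (i / (m + 1 : ℕ)) (ch m l), ?_, (h _ (idx_mem m hs' hlj) _ (idx_mem m hs le_rfl) ?_ _
        (ch_root m l)).le⟩
      · rw [Multiset.mem_toFinset, mem_roots (hm _).ne_zero]
        exact hnr _ _
      · have h1 : (l : ℝ) / (m + 1 : ℕ) ≤ j / (m + 1 : ℕ) := by gcongr
        have h2 : (i : ℝ) / (m + 1 : ℕ) ≤ l / (m + 1 : ℕ) := by gcongr
        have h3 := idx_le m hs'.1
        have h4 := idx_gt m s
        rw [abs_of_nonneg (by linarith)]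
        linarith
    · gcongr
  set u : Ultrafilter ℕ := hyperfilter ℕ
  have hu : (u : Filter ℕ) ≤ atTop := Nat.hyperfilter_le_atTop
  have hlim : ∀ s, ∃ a : ℂ, s ∈ Icc 0 L → Tendsto (fun m => ch m (idx m s)) u (nhds a) := by
    intro s
    by_cases hs : s ∈ Icc 0 L
    · obtain ⟨a, -, ha⟩ := (isCompact_closedBall (0 : ℂ) M).ultrafilter_le_nhds
        (u.map fun m => ch m (idx m s)) (by
          rw [le_principal_iff]
          refine Eventually.of_forall (f := (u : Filter ℕ)) fun m => ?_
          simpa using hM _ (idx_mem m hs le_rfl) _ (ch_root m _))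
      exact ⟨a, fun _ => ha⟩
    · exact ⟨0, fun h => absurd h hs⟩
  choose α hα using hlim
  have hα_osc : ∀ η > 0, ∃ δ > 0, ∀ s ∈ Icc 0 L, ∀ s' ∈ Icc 0 L, s ≤ s' → s' - s < δ →
      dist (α s) (α s') ≤ 3 * n * η := by
    intro η hη
    obtain ⟨δ, hδ, h⟩ := hosc η hη
    refine ⟨δ, hδ, fun s hs s' hs' hle hlt => ?_⟩
    exact le_of_tendsto ((hα s hs).dist (hα s' hs'))
      ((h.filter_mono hu).mono fun m hm => hm s hs s' hs' hle hlt)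
  refine ⟨α, ?_, fun s hs => ?_⟩
  · rw [Metric.continuousOn_iff]
    intro s hs η hη
    obtain ⟨δ, hδ, h⟩ := hα_osc (η / (3 * n + 1)) (by positivity)
    refine ⟨δ, hδ, fun s' hs' hlt => ?_⟩
    have hb : 3 * n * (η / (3 * n + 1)) < η := by
      rw [mul_div_assoc', div_lt_iff₀ (by positivity)]
      nlinarith
    rw [Real.dist_eq] at hlt
    rcases le_total s s' with hle | hle
    · rw [dist_comm]
      exact (h s hs s' hs' hle ((le_abs_self _).trans_lt hlt)).trans_lt hb
    · exact (h s' hs' s hs hle (by rw [← neg_sub]; exact (neg_le_abs _).trans_lt hlt)).trans_lt hb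
  · have h1 : Tendsto (fun m => ((idx m s : ℝ) / (m + 1 : ℕ))) u (nhds s) := by
      refine Tendsto.mono_left ?_ hu
      refine tendsto_of_tendsto_of_tendsto_of_le_of_le (g := fun m : ℕ => s - 1 / ((m + 1 : ℕ) : ℝ))
        (h := fun _ => s) ?_ tendsto_const_nhds (fun m => (idx_gt m s).le) fun m => idx_le m hs.1
      simpa using hmesh.const_sub s
    have h2 : Tendsto (fun m => (p ((idx m s : ℝ) / (m + 1 : ℕ))).eval (ch m (idx m s))) u
        (nhds ((p s).eval (α s))) :=
      (hev.tendsto (s, α s)).comp (h1.prodMk_nhds (hα s hs))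
    simp_rw [ch_root] at h2
    exact (tendsto_nhds_unique h2 tendsto_const_nhds)

theorem Polynomial.exists_continuous_roots_Icc (n : ℕ) (L : ℝ) (hL : 0 ≤ L) : ∀ {p : ℝ → ℂ[X]},
    (∀ s, (p s).Monic) → (∀ s, (p s).natDegree = n) →
    (∀ i, Continuous fun s => (p s).coeff i) →
    ∃ α : Fin n → ℝ → ℂ, (∀ i, Continuous (α i)) ∧
      ∀ s ∈ Icc 0 L, p s = ∏ i, (X - C (α i s)) := by
  induction n with
  | zero =>
    intro p hm hd _
    exact ⟨fun i => i.elim0, fun i => i.elim0, fun s _ => by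
      simpa using (hm s).natDegree_eq_zero.1 (hd s)⟩
  | succ n ih =>
    intro p hm hd hc
    obtain ⟨α₀, hα₀, hroot⟩ := exists_continuous_root n.succ_ne_zero hm hd hc L
    set cl : ℝ → ℝ := fun s => projIcc 0 L hL s with hcl
    have hclc : Continuous cl := by fun_prop
    have hclm (s) : cl s ∈ Icc 0 L := (projIcc 0 L hL s).2
    have hcle {s} (hs : s ∈ Icc 0 L) : cl s = s := by simp [hcl, projIcc_of_mem hL hs]
    set β : ℝ → ℂ := fun s => α₀ (cl s)
    have hβ : Continuous β := hα₀.comp_continuous hclc hclm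
    have hdiv (s) : (X - C (β s)) * (p (cl s) /ₘ (X - C (β s))) = p (cl s) :=
      mul_divByMonic_eq_iff_isRoot.2 (hroot _ (hclm s))
    obtain ⟨α, hαc, hα⟩ := ih (p := fun s => p (cl s) /ₘ (X - C (β s)))
      (fun s => (monic_X_sub_C (β s)).of_mul_monic_left (by rw [hdiv]; exact hm _))
      (fun s => by
        rw [natDegree_divByMonic _ (monic_X_sub_C _), hd, natDegree_X_sub_C]; rfl)
      fun i => by
        simp_rw [coeff_divByMonic_X_sub_C, hd]
        exact continuous_finsetSum _ fun j _ => (hβ.pow _).mul ((hc j).comp hclc)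
    refine ⟨Fin.cons β α, fun i => ?_, fun s hs => ?_⟩
    · refine Fin.cases hβ (fun i => ?_) i
      exact hαc i
    · rw [Fin.prod_univ_succ]
      simp only [Fin.cons_zero, Fin.cons_succ]
      rw [← hα s hs, hdiv, hcle hs]

/-- The roots of a monic polynomial depending continuously on a real parameter can be chosen
continuously. -/
theorem Polynomial.exists_continuous_roots {n : ℕ} {r : ℝ} (hr : 0 ≤ r) {p : ℝ → ℂ[X]}
    (hm : ∀ s ∈ Icc (-r) r, (p s).Monic) (hd : ∀ s ∈ Icc (-r) r, (p s).natDegree = n)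
    (hc : ∀ i, ContinuousOn (fun s => (p s).coeff i) (Icc (-r) r)) :
    ∃ α : Fin n → ℝ → ℂ, (∀ i, Continuous (α i)) ∧
      ∀ s ∈ Icc (-r) r, p s = ∏ i, (X - C (α i s)) := by
  have hr' : -r ≤ r := by linarith
  set cl : ℝ → ℝ := fun s => projIcc (-r) r hr' (s - r) with hcl
  have hclc : Continuous cl := by fun_prop
  have hclm (s) : cl s ∈ Icc (-r) r := (projIcc (-r) r hr' (s - r)).2
  obtain ⟨α, hα, h⟩ := exists_continuous_roots_Icc n (2 * r) (by linarith) (p := fun s => p (cl s))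
    (fun s => hm _ (hclm s)) (fun s => hd _ (hclm s)) fun i => (hc i).comp_continuous hclc hclm
  refine ⟨fun i s => α i (s + r), fun i => (hα i).comp (by fun_prop), fun s hs => ?_⟩
  rw [← h (s + r) ⟨by linarith [hs.1], by linarith [hs.2]⟩]
  simp [hcl, projIcc_of_mem hr' hs]

end ContinuousRoots

theorem exists_implicit_solution {V W : Type*} [NormedAddCommGroup V] [NormedSpace ℂ V]
    [CompleteSpace V] [NormedAddCommGroup W] [NormedSpace ℂ W] [CompleteSpace W] {G : V × W → W}
    (hG : ContDiff ℂ 1 G) {v₀ : V} (h₀ : G (v₀, 0) = 0) {E : W →L[ℂ] W} (hE : ‖E‖ < 1)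
    (hd : HasFDerivAt (fun h => G (v₀, h)) (ContinuousLinearMap.id ℂ W + E) 0) :
    ∃ ψ : V → W, ψ v₀ = 0 ∧ ∀ᶠ v in nhds v₀, ContinuousAt ψ v ∧ G (v, ψ v) = 0 := by
  have hGa : ContDiffAt ℂ 1 G (v₀, 0) := hG.contDiffAt
  have hinr : fderiv ℂ G (v₀, 0) ∘L .inr ℂ V W = ContinuousLinearMap.id ℂ W + E := by
    have h1 : HasFDerivAt (fun h : W => G (v₀, h)) (fderiv ℂ G (v₀, 0) ∘L .inr ℂ V W) 0 :=
      HasFDerivAt.comp (g := G) (f := fun h : W => (v₀, h)) 0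
        (hGa.differentiableAt one_ne_zero).hasFDerivAt (hasFDerivAt_prodMk_right v₀ 0)
    exact h1.unique hd
  have hinv : (fderiv ℂ G (v₀, 0) ∘L .inr ℂ V W).IsInvertible := by
    obtain ⟨u, hu⟩ := isUnit_one_sub_of_norm_lt_one (x := -E) (by rwa [norm_neg])
    refine ⟨ContinuousLinearEquiv.ofUnit u, ?_⟩
    rw [hinr]
    ext h
    have := congrArg (fun L : W →L[ℂ] W => L h) hu
    simp only [sub_neg_eq_add] at this
    exact this
  refine ⟨hGa.implicitFunction one_ne_zero hinv, hGa.implicitFunction_apply_self one_ne_zero hinv,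
    ?_⟩
  filter_upwards [hGa.eventually_apply_implicitFunction one_ne_zero hinv,
    (hGa.contDiffAt_implicitFunction one_ne_zero hinv).eventually (by simp)] with v h1 h2
  exact ⟨h2.continuousAt, h1.trans h₀⟩

namespace BidiscAlg

variable {x : ℂ × ℂ}

/-! ### Rescaled families -/

theorem mval_smul (c : ℂ) (n : Fin 2 →₀ ℕ) (x : ℂ × ℂ) :
    mval (c • x) n = c ^ (n 0 + n 1) * mval x n := by
  simp only [mval, Prod.smul_fst, Prod.smul_snd, smul_eq_mul, mul_pow, pow_add]; ring

/-- Precomposition with a contraction. -/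
def scale (ρ : ℝ) (h0 : 0 ≤ ρ) (h1 : ρ ≤ 1) : BidiscAlg →L[ℂ] BidiscAlg :=
  shift (fun n => (ρ : ℂ) ^ (n 0 + n 1)) id 1 Function.injective_id fun n => by
    rw [norm_pow, Complex.norm_real, Real.norm_of_nonneg h0]
    exact pow_le_one₀ h0 h1

theorem co_scale (ρ : ℝ) (h0 h1) (b : BidiscAlg) (n) :
    co (scale ρ h0 h1 b) n = (ρ : ℂ) ^ (n 0 + n 1) * co b n := rfl

theorem ev_scale (ρ : ℝ) (h0 h1) (x : ℂ × ℂ) (b : BidiscAlg) :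
    ev x (scale ρ h0 h1 b) = ev ((ρ : ℂ) • x) b := by
  refine tsum_congr fun n => ?_
  rw [co_scale, mval_smul]; ring

theorem exponent_cases (n : Fin 2 →₀ ℕ) : n = 0 ∨ n = e0 ∨ n = e1 ∨ 2 ≤ n 0 + n 1 := by
  by_contra! h
  obtain ⟨h1, h2, h3, h4⟩ := h
  have h5 : (n 0 = 0 ∧ n 1 = 0) ∨ (n 0 = 1 ∧ n 1 = 0) ∨ (n 0 = 0 ∧ n 1 = 1) := by omega
  rcases h5 with h | h | h
  · exact h1 (Finsupp.ext fun i => by fin_cases i <;> simp [h])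
  · exact h2 (Finsupp.ext fun i => by fin_cases i <;> simp [h])
  · exact h3 (Finsupp.ext fun i => by fin_cases i <;> simp [h])

theorem co_of_hasFDerivAt {b : BidiscAlg} {c d : ℂ}
    (h : HasFDerivAt (fun x => ev x b)
      (c • ContinuousLinearMap.fst ℂ ℂ ℂ + d • ContinuousLinearMap.snd ℂ ℂ ℂ) 0) :
    co b e0 = c ∧ co b e1 = d := by
  have h1 := hasFDerivAt_ev_half (x := 0) b (by simp)
  have h2 : HasFDerivAt (fun x => ev x (half b)) ((c • ContinuousLinearMap.fst ℂ ℂ ℂ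
      + d • ContinuousLinearMap.snd ℂ ℂ ℂ) ∘L ((2⁻¹ : ℂ) • ContinuousLinearMap.id ℂ (ℂ × ℂ))) 0 := by
    simp only [ev_half]
    refine HasFDerivAt.comp (g := fun x => ev x b) (f := fun x : ℂ × ℂ => (2⁻¹ : ℂ) • x) 0 ?_
      ((2⁻¹ : ℂ) • ContinuousLinearMap.id ℂ (ℂ × ℂ)).hasFDerivAt
    simpa using h
  have h3 := h1.unique h2
  have h4 := congrArg (fun L : ℂ × ℂ →L[ℂ] ℂ => L (1, 0)) h3
  have h5 := congrArg (fun L : ℂ × ℂ →L[ℂ] ℂ => L (0, 1)) h3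
  simp [ev_apply_zero, co_dhalf, half, co_shift] at h4 h5
  exact ⟨h4, h5⟩

/-- Expansion of a rescaled family whose unperturbed member is tangent to the first coordinate. -/
theorem exists_scaled_expansion {e δ : ℝ} (he : 0 < e) (hδ : 0 < δ) (F : ℝ → ℂ × ℂ → ℂ)
    (hd : ∀ ε ∈ Ioo (-e) e, DifferentiableOn ℂ (F ε) (ball 0 δ))
    (hc : ContinuousOn (fun w : (ℂ × ℂ) × ℝ => F w.2 w.1) (ball 0 δ ×ˢ Ioo (-e) e))
    (h0 : F 0 0 = 0) (h1 : HasFDerivAt (F 0) (ContinuousLinearMap.fst ℂ ℂ ℂ) 0)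
    {η : ℝ} (hη : 0 < η) :
    ∃ ρ₀ : ℝ, 0 < ρ₀ ∧ ρ₀ < δ ∧ ∀ ρ : ℝ, 0 < ρ → ρ ≤ ρ₀ →
      ∃ b : ℝ → BidiscAlg, ContinuousOn b (Ioo (-e) e) ∧ ‖b 0 - mono e0‖ ≤ η ∧
        ∀ ε ∈ Ioo (-e) e, ∀ x : ℂ × ℂ, ‖x‖ ≤ 1 → ev x (b ε) = (ρ : ℂ)⁻¹ * F ε ((ρ : ℂ) • x) := by
  obtain ⟨β, hβ, hβF⟩ := exists_taylor (half_pos hδ) (half_lt_self hδ) F hd hc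
  have h0e : (0 : ℝ) ∈ Ioo (-e) e := ⟨by linarith, he⟩
  set R := δ / 2 with hR
  have hRpos : 0 < R := half_pos hδ
  have hRC : (R : ℂ) ≠ 0 := by exact_mod_cast hRpos.ne'
  have hβ0 : co (β 0) 0 = 0 := by
    rw [← ev_apply_zero, hβF 0 h0e 0 (by simp)]; simpa using h0
  have hβ1 : co (β 0) e0 = R ∧ co (β 0) e1 = 0 := by
    refine co_of_hasFDerivAt ?_
    have h2 : HasFDerivAt (fun x : ℂ × ℂ => F 0 ((R : ℂ) • x)) ((ContinuousLinearMap.fst ℂ ℂ ℂ) ∘L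
        ((R : ℂ) • ContinuousLinearMap.id ℂ (ℂ × ℂ))) 0 :=
      HasFDerivAt.comp (g := F 0) (f := fun x : ℂ × ℂ => (R : ℂ) • x) 0 (by simpa using h1)
        ((R : ℂ) • ContinuousLinearMap.id ℂ (ℂ × ℂ)).hasFDerivAt
    refine (h2.congr_fderiv ?_).congr_of_eventuallyEq ?_
    · ext <;> simp
    · filter_upwards [closedBall_mem_nhds (0 : ℂ × ℂ) one_pos] with x hx
      exact hβF 0 h0e x (by simpa using hx)
  obtain ⟨c, hc0, hc1, hcη⟩ : ∃ c : ℝ, 0 < c ∧ c ≤ 1 ∧ c * (R⁻¹ * ‖β 0‖) ≤ η := by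
    refine ⟨min 1 (η / (R⁻¹ * ‖β 0‖ + 1)), by positivity, min_le_left _ _, ?_⟩
    refine (mul_le_mul_of_nonneg_right (min_le_right _ _) (by positivity)).trans ?_
    rw [div_mul_eq_mul_div, div_le_iff₀ (by positivity)]
    nlinarith
  refine ⟨c * R, by positivity, ?_, fun ρ hρ hρc => ?_⟩
  · have : c * R ≤ R := mul_le_of_le_one_left hRpos.le hc1
    linarith
  have hs0 : 0 ≤ ρ / R := by positivity
  have hsc : ρ / R ≤ c := (div_le_iff₀ hRpos).2 hρc
  have hs1 : ρ / R ≤ 1 := hsc.trans hc1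
  have hρC : (ρ : ℂ) ≠ 0 := by exact_mod_cast hρ.ne'
  refine ⟨fun ε => (ρ : ℂ)⁻¹ • scale (ρ / R) hs0 hs1 (β ε), ?_, ?_, fun ε hε x hx => ?_⟩
  · exact ((scale (ρ / R) hs0 hs1).continuous.comp_continuousOn hβ).const_smul ((ρ : ℂ)⁻¹)
  · refine le_trans ?_ hcη
    have hterm : ∀ n, ‖co ((ρ : ℂ)⁻¹ • scale (ρ / R) hs0 hs1 (β 0) - mono e0) n‖
        ≤ c * (R⁻¹ * ‖co (β 0) n‖) := by
      intro n
      rw [co_sub, co_smul, co_scale, co_mono]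
      rcases exponent_cases n with rfl | rfl | rfl | hn
      · have hne : (0 : Fin 2 →₀ ℕ) ≠ e0 := fun h => by simpa using DFunLike.congr_fun h 0
        simp [hβ0, hne]
      · have : (ρ : ℂ)⁻¹ * (((ρ / R : ℝ) : ℂ) * R) - 1 = 0 := by
          push_cast; field_simp; simp
        simp only [hβ1.1, e0_zero, e0_one, if_true, add_zero, pow_one, this, norm_zero]
        positivity
      · have hne : e1 ≠ e0 := fun h => by simpa using DFunLike.congr_fun h 0
        simp [hβ1.2, hne]
      · have hne : n ≠ e0 := by rintro rfl; simp at hn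
        rw [if_neg hne, sub_zero, norm_mul, norm_mul, norm_pow, norm_inv, Complex.norm_real,
          Complex.norm_real, Real.norm_of_nonneg hρ.le, Real.norm_of_nonneg hs0]
        have h2 : (ρ / R) ^ (n 0 + n 1) ≤ c * (ρ / R) := by
          calc (ρ / R) ^ (n 0 + n 1) ≤ (ρ / R) ^ 2 := pow_le_pow_of_le_one hs0 hs1 hn
            _ = (ρ / R) * (ρ / R) := sq _
            _ ≤ c * (ρ / R) := mul_le_mul_of_nonneg_right hsc hs0
        calc ρ⁻¹ * ((ρ / R) ^ (n 0 + n 1) * ‖co (β 0) n‖)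
            ≤ ρ⁻¹ * (c * (ρ / R) * ‖co (β 0) n‖) := by gcongr
          _ = c * (R⁻¹ * ‖co (β 0) n‖) := by field_simp
    rw [norm_eq, norm_eq (β 0), ← tsum_mul_left, ← tsum_mul_left]
    exact (summable_norm _).tsum_le_tsum hterm (((summable_norm _).mul_left _).mul_left _)
  · have hx2 : ‖((ρ / R : ℝ) : ℂ) • x‖ ≤ 1 := by
      rw [norm_smul, Complex.norm_real, Real.norm_of_nonneg hs0]
      exact mul_le_one₀ hs1 (norm_nonneg _) hx
    change ev x (_ • _) = _
    rw [ev_smul, ev_scale, hβF ε hε _ hx2, smul_smul]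
    congr 3
    push_cast
    field_simp

/-! ### Division by a vertical graph -/

/-- The part of a series not involving the first variable. -/
def restrictZ : BidiscAlg →L[ℂ] BidiscAlg :=
  shift (fun n => if n 0 = 0 then 1 else 0) id 1 Function.injective_id fun n => by
    split_ifs <;> simp

/-- The quotient of the remaining part by the first variable. -/
def quotZ : BidiscAlg →L[ℂ] BidiscAlg :=
  shift (fun _ => 1) (fun n => n + e0) 1 (add_left_injective _) fun n => by simp

theorem restrictZ_add_mul_quotZ (b : BidiscAlg) : restrictZ b + mono e0 * quotZ b = b := by
  refine ext fun n => ?_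
  rw [co_add, co_mono_mul, restrictZ, quotZ, co_shift, co_shift]
  rcases Nat.eq_zero_or_pos (n 0) with h | h
  · have : ¬e0 ≤ n := fun h' => by simpa [h] using (single_le_iff 0 1 n).1 h'
    simp [h, this]
  · have : e0 ≤ n := (single_le_iff 0 1 n).2 h
    simp [h.ne', this, tsub_add_cancel_of_le this]

theorem ev_restrictZ (b : BidiscAlg) (x : ℂ × ℂ) :
    ev x (restrictZ b) = ev (0, x.2) (restrictZ b) := by
  refine tsum_congr fun n => ?_
  rw [restrictZ, co_shift]
  rcases Nat.eq_zero_or_pos (n 0) with h | h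
  · simp [h, mval]
  · simp [h.ne']

theorem norm_restrictZ_le (b : BidiscAlg) : ‖restrictZ b‖ ≤ ‖b‖ :=
  (norm_shift_le _ _ 1 _ _ b).trans_eq (one_mul _)

theorem norm_quotZ_le (b : BidiscAlg) : ‖quotZ b‖ ≤ ‖b‖ :=
  (norm_shift_le _ _ 1 _ _ b).trans_eq (one_mul _)

theorem exists_weierstrass_factor : ∃ ψ : BidiscAlg → BidiscAlg, ψ (mono e0) = 0 ∧
    ∀ᶠ b in nhds (mono e0), ContinuousAt ψ b ∧
      (mono e0 + restrictZ (ψ b)) * (1 + quotZ (ψ b)) = b := by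
  obtain ⟨ψ, hψ, h⟩ := exists_implicit_solution (V := BidiscAlg) (W := BidiscAlg)
    (G := fun p => (mono e0 + restrictZ p.2) * (1 + quotZ p.2) - p.1) (v₀ := mono e0) (E := 0)
    (by fun_prop) (by simp) (by simp) (by
      have h1 : HasFDerivAt (fun h => restrictZ h * quotZ h) (0 : BidiscAlg →L[ℂ] BidiscAlg) 0 := by
        refine (restrictZ.hasFDerivAt.mul quotZ.hasFDerivAt).congr_fderiv ?_
        ext h; simp
      refine ((hasFDerivAt_id (𝕜 := ℂ) (0 : BidiscAlg)).add h1).congr_of_eventuallyEq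
        (Eventually.of_forall fun h => ?_)
      have := restrictZ_add_mul_quotZ h
      simp only [id, Pi.add_apply]
      linear_combination this)
  exact ⟨ψ, hψ, h.mono fun b hb => ⟨hb.1, by linear_combination hb.2⟩⟩

theorem continuousOn_ev_comp {X : Type*} [TopologicalSpace X] {g : X → ℂ × ℂ} {β : X → BidiscAlg}
    {S : Set X} (hg : ContinuousOn g S) (hβ : ContinuousOn β S) (h : ∀ x ∈ S, ‖g x‖ ≤ 1) :
    ContinuousOn (fun x => ev (g x) (β x)) S :=
  continuousOn_ev_uncurry.comp (hg.prodMk hβ) fun x hx => ⟨by simpa using h x hx, mem_univ _⟩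

theorem hasFDerivAt_ev_of_lt (b : BidiscAlg) {x : ℂ × ℂ} (hx : ‖x‖ < 1 / 2) :
    HasFDerivAt (fun x => ev x b) ((2 * ev ((2 : ℂ) • x) (dhalf 0 b)) • ContinuousLinearMap.fst ℂ ℂ ℂ
      + (2 * ev ((2 : ℂ) • x) (dhalf 1 b)) • ContinuousLinearMap.snd ℂ ℂ ℂ) x := by
  have h2 : ‖(2 : ℂ) • x‖ < 1 := by rw [norm_smul, Complex.norm_ofNat]; linarith
  have h := HasFDerivAt.comp (g := fun x => ev x (half b)) (f := fun x : ℂ × ℂ => (2 : ℂ) • x) x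
    (hasFDerivAt_ev_half b h2) ((2 : ℂ) • ContinuousLinearMap.id ℂ (ℂ × ℂ)).hasFDerivAt
  refine (h.congr_fderiv ?_).congr_of_eventuallyEq (Eventually.of_forall fun y => ?_)
  · ext <;> simp [mul_comm]
  · simp [ev_half, smul_smul]

end BidiscAlg

open BidiscAlg in
/-- A family of functions tangent to the first coordinate is the product of a unit and the
defining function of a family of vertical graphs. -/
theorem exists_graph_factor {e r : ℝ} (he : 0 < e) (hr : 0 < r) (F : ℝ → ℂ × ℂ → ℂ)
    (hd : ∀ ε ∈ Ioo (-e) e, DifferentiableOn ℂ (F ε) (ball 0 r))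
    (hc : ContinuousOn (fun w : (ℂ × ℂ) × ℝ => F w.2 w.1) (ball 0 r ×ˢ Ioo (-e) e))
    (h0 : F 0 0 = 0) (h1 : HasFDerivAt (F 0) (ContinuousLinearMap.fst ℂ ℂ ℂ) 0) :
    ∃ e' r' : ℝ, 0 < e' ∧ e' ≤ e ∧ 0 < r' ∧ r' ≤ r ∧
    ∃ s s' : ℝ → ℂ → ℂ, ∃ H : ℝ → ℂ × ℂ → ℂ, s 0 0 = 0 ∧ H 0 0 = 1 ∧
      (∀ ε ∈ Ioo (-e') e', (∀ x ∈ ball 0 r', F ε x = (x.1 - s ε x.2) * H ε x) ∧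
        (∀ T ∈ ball 0 r', HasDerivAt (s ε) (s' ε T) T ∧ ‖s ε T‖ ≤ r' / 4) ∧
        DifferentiableOn ℂ (s' ε) (ball 0 r') ∧ DifferentiableOn ℂ (H ε) (ball 0 r')) ∧
      ContinuousOn (fun w : ℂ × ℝ => s w.2 w.1) (ball 0 r' ×ˢ Ioo (-e') e') ∧
      ContinuousOn (fun w : ℂ × ℝ => s' w.2 w.1) (ball 0 r' ×ˢ Ioo (-e') e') ∧
      ContinuousOn (fun w : (ℂ × ℂ) × ℝ => H w.2 w.1) (ball 0 r' ×ˢ Ioo (-e') e') := by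
  obtain ⟨ψ, hψ0, hψ⟩ := exists_weierstrass_factor
  have hψs : ∀ᶠ b in nhds (mono e0), ‖ψ b‖ ≤ 1 / 16 := by
    have h2 : Tendsto (fun b => ‖ψ b‖) (nhds (mono e0)) (nhds 0) := by
      simpa [ContinuousAt, hψ0] using hψ.self_of_nhds.1.norm
    exact h2.eventually (eventually_le_nhds (by norm_num))
  obtain ⟨η, hη, hball⟩ := Metric.eventually_nhds_iff.1 (hψ.and hψs)
  obtain ⟨ρ, hρ, hρr, hρb⟩ := exists_scaled_expansion he hr F hd hc h0 h1 (half_pos hη)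
  obtain ⟨b, hb, hb0, hbF⟩ := hρb ρ hρ le_rfl
  have h0e : (0 : ℝ) ∈ Ioo (-e) e := ⟨by linarith, he⟩
  obtain ⟨e₂, he₂, hbe⟩ := Metric.continuousAt_iff.1 (hb.continuousAt (Ioo_mem_nhds h0e.1 h0e.2))
    (η / 2) (half_pos hη)
  have hsub : Ioo (-min e e₂) (min e e₂) ⊆ Ioo (-e) e :=
    Ioo_subset_Ioo (neg_le_neg (min_le_left _ _)) (min_le_left _ _)
  have hnear : ∀ ε ∈ Ioo (-min e e₂) (min e e₂), dist (b ε) (mono e0) < η := by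
    intro ε hε
    have h3 : dist ε 0 < e₂ := by
      rw [dist_zero_right, Real.norm_eq_abs, abs_lt]
      exact ⟨by linarith [hε.1, min_le_right e e₂], hε.2.trans_le (min_le_right _ _)⟩
    calc dist (b ε) (mono e0) ≤ dist (b ε) (b 0) + dist (b 0) (mono e0) := dist_triangle _ _ _
      _ < η / 2 + η / 2 := add_lt_add_of_lt_of_le (hbe h3) (by rwa [dist_eq_norm])
      _ = η := add_halves η
  have hρC : (ρ : ℂ) ≠ 0 := by exact_mod_cast hρ.ne'
  have hρn : ‖(ρ : ℂ)⁻¹‖ = ρ⁻¹ := by rw [norm_inv, Complex.norm_real, Real.norm_of_nonneg hρ.le]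
  set h : ℝ → BidiscAlg := fun ε => ψ (b ε) with hh
  have hhc : ContinuousOn h (Ioo (-min e e₂) (min e e₂)) := fun ε hε =>
    (hball (hnear ε hε)).1.1.comp_continuousWithinAt (hb.mono hsub ε hε)
  have hhn : ∀ ε ∈ Ioo (-min e e₂) (min e e₂), ‖h ε‖ ≤ 1 / 16 := fun ε hε =>
    (hball (hnear ε hε)).2
  have hscale : ∀ x ∈ ball (0 : ℂ × ℂ) (ρ / 4), ‖(ρ : ℂ)⁻¹ • x‖ < 1 / 4 := by
    intro x hx
    rw [norm_smul, hρn, inv_mul_lt_iff₀ hρ]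
    rw [mem_ball_zero_iff] at hx; linarith
  have hvert : ∀ T ∈ ball (0 : ℂ) (ρ / 4), ((0, T) : ℂ × ℂ) ∈ ball (0 : ℂ × ℂ) (ρ / 4) := by
    intro T hT
    rw [mem_ball_zero_iff] at hT ⊢
    simpa [Prod.norm_def, hρ] using hT
  set s : ℝ → ℂ → ℂ := fun ε T => -ρ * ev ((ρ : ℂ)⁻¹ • (0, T)) (restrictZ (h ε)) with hs
  set s' : ℝ → ℂ → ℂ := fun ε T =>
    -2 * ev ((2 : ℂ) • (ρ : ℂ)⁻¹ • (0, T)) (dhalf 1 (restrictZ (h ε))) with hs'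
  set H : ℝ → ℂ × ℂ → ℂ := fun ε x => 1 + ev ((ρ : ℂ)⁻¹ • x) (quotZ (h ε)) with hH
  have hfac : ∀ ε ∈ Ioo (-min e e₂) (min e e₂), ∀ x ∈ ball (0 : ℂ × ℂ) (ρ / 4),
      F ε x = (x.1 - s ε x.2) * H ε x := by
    intro ε hε x hx
    have hx1 : ‖(ρ : ℂ)⁻¹ • x‖ ≤ 1 := by linarith [hscale x hx]
    have h3 := hbF ε (hsub hε) _ hx1
    rw [smul_inv_smul₀ hρC, ← (hball (hnear ε hε)).1.2, ev_mul hx1, ev_add hx1, ev_add hx1,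
      ev_one, ev_mono, ev_restrictZ] at h3
    rw [eq_comm, inv_mul_eq_iff_eq_mul₀ hρC] at h3
    simp only [hs, hH, h3, hh, mval]
    simp
    field_simp
  have hHd : ∀ ε, DifferentiableOn ℂ (H ε) (ball 0 (ρ / 4)) := by
    intro ε x hx
    have h3 : DifferentiableAt ℂ (fun x => ev x (quotZ (h ε))) ((ρ : ℂ)⁻¹ • x) :=
      differentiableAt_ev _ (by linarith [hscale x hx])
    exact ((h3.comp x (differentiableAt_id.const_smul ((ρ : ℂ)⁻¹))).const_add 1).differentiableWithinAt
  have h0' : (0 : ℝ) ∈ Ioo (-min e e₂) (min e e₂) := by simp [he, he₂]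
  have h0b : (0 : ℂ × ℂ) ∈ ball (0 : ℂ × ℂ) (ρ / 4) := mem_ball_self (by positivity)
  have hH1 : ‖H 0 0 - 1‖ ≤ 1 / 16 := by
    simp only [hH, add_sub_cancel_left]
    exact (norm_ev_le (by simp) _).trans ((norm_quotZ_le _).trans (hhn 0 h0'))
  have hH0 : H 0 0 ≠ 0 := by
    intro h3; rw [h3] at hH1; norm_num at hH1
  have hs0 : s 0 0 = 0 := by
    have h3 := hfac 0 h0' 0 h0b
    rw [h0] at h3
    simpa [hH0] using h3.symm
  refine ⟨min e e₂, ρ / 4, lt_min he he₂, min_le_left _ _, by positivity, by linarith, s, s', H, hs0,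
    ?_, fun ε hε => ⟨hfac ε hε, fun T hT => ⟨?_, ?_⟩, ?_, hHd ε⟩, ?_, ?_, ?_⟩
  · have h3 : HasDerivAt (fun z : ℂ => F 0 (z, 0)) 1 0 := by
      have := HasFDerivAt.comp_hasDerivAt (f := fun z : ℂ => ((z, 0) : ℂ × ℂ)) (l := F 0) (0 : ℂ) h1
        ((hasDerivAt_id _).prodMk (hasDerivAt_const _ _))
      exact this.congr_deriv (by simp)
    have h4 : DifferentiableAt ℂ (fun z : ℂ => H 0 (z, 0)) 0 := by
      have h5 : DifferentiableAt ℂ (H 0) ((0 : ℂ), (0 : ℂ)) :=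
        (hHd 0).differentiableAt (ball_mem_nhds _ (by positivity))
      exact h5.comp (f := fun z : ℂ => ((z, 0) : ℂ × ℂ)) 0 (by fun_prop)
    have h5 := (hasDerivAt_id (0 : ℂ)).mul h4.hasDerivAt
    have h6 : (fun z : ℂ => F 0 (z, 0)) =ᶠ[nhds 0] (id * fun z : ℂ => H 0 (z, 0)) := by
      filter_upwards [ball_mem_nhds (0 : ℂ) (show 0 < ρ / 4 by positivity)] with z hz
      rw [hfac 0 h0' (z, 0) (by
        rw [mem_ball_zero_iff] at hz ⊢
        simpa [Prod.norm_def, hρ] using hz)]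
      simp [hs0]
    have h7 := (h5.congr_of_eventuallyEq h6).unique h3
    simpa [Prod.mk_zero_zero] using h7
  · have h3 := hscale _ (hvert T hT)
    have h4 := HasFDerivAt.comp_hasDerivAt (f := fun T : ℂ => (ρ : ℂ)⁻¹ • ((0, T) : ℂ × ℂ))
      (l := fun x => ev x (restrictZ (h ε))) T (hasFDerivAt_ev_of_lt _ (by linarith))
      (((hasDerivAt_const T (0 : ℂ)).prodMk (hasDerivAt_id T)).const_smul ((ρ : ℂ)⁻¹))
    refine (h4.const_mul (-ρ : ℂ)).congr_deriv ?_
    simp [hs']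
    field_simp
  · have h3 := hscale _ (hvert T hT)
    simp only [hs, norm_mul, norm_neg, Complex.norm_real, Real.norm_of_nonneg hρ.le]
    have := (norm_ev_le (x := (ρ : ℂ)⁻¹ • (0, T)) (by linarith) (restrictZ (h ε))).trans
      ((norm_restrictZ_le _).trans (hhn ε hε))
    nlinarith
  · intro T hT
    have h3 := hscale _ (hvert T hT)
    have h4 : DifferentiableAt ℂ (fun x => ev x (dhalf 1 (restrictZ (h ε))))
        ((2 : ℂ) • (ρ : ℂ)⁻¹ • ((0, T) : ℂ × ℂ)) :=
      differentiableAt_ev _ (by rw [norm_smul, Complex.norm_ofNat]; linarith)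
    exact ((h4.comp (f := fun T : ℂ => (2 : ℂ) • (ρ : ℂ)⁻¹ • ((0, T) : ℂ × ℂ)) T
      (by fun_prop)).const_mul (-2)).differentiableWithinAt
  · refine continuousOn_const.mul (continuousOn_ev_comp (by fun_prop)
      (restrictZ.continuous.comp_continuousOn (hhc.comp continuousOn_snd fun w hw => hw.2))
      fun w hw => ?_)
    linarith [hscale _ (hvert _ hw.1)]
  · refine continuousOn_const.mul (continuousOn_ev_comp (by fun_prop)
      ((dhalf 1).continuous.comp_continuousOn (restrictZ.continuous.comp_continuousOn
        (hhc.comp continuousOn_snd fun w hw => hw.2))) fun w hw => ?_)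
    rw [norm_smul, Complex.norm_ofNat]
    linarith [hscale _ (hvert _ hw.1)]
  · refine continuousOn_const.add (continuousOn_ev_comp (by fun_prop)
      (quotZ.continuous.comp_continuousOn (hhc.comp continuousOn_snd fun w hw => hw.2))
      fun w hw => ?_)
    linarith [hscale _ hw.1]

namespace BidiscAlg

theorem mono_e1_pow (j : ℕ) : mono e1 ^ j = mono (Finsupp.single 1 j) := by
  induction j with
  | zero => rw [pow_zero, Finsupp.single_zero]; rfl
  | succ j ih => rw [pow_succ, ih, mono_mul_mono, ← Finsupp.single_add]

/-! ### The homological operators -/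

/-- The primitive in the first variable of the part of degree at most `k` in the second one, for
the vector field `z ∂/∂z`. -/
def prim (k : ℕ) : BidiscAlg →L[ℂ] BidiscAlg :=
  shift (fun n => if n 1 ≤ k ∧ n 0 ≠ 0 then (n 0 : ℂ)⁻¹ else 0) id 1 Function.injective_id fun n => by
    split_ifs with h
    · have : (1 : ℝ) ≤ n 0 := by exact_mod_cast Nat.one_le_iff_ne_zero.2 h.2
      rw [norm_inv, Complex.norm_natCast]
      exact inv_le_one_of_one_le₀ this
    · simp

/-- The first partial derivative of `prim`. -/
def primZ (k : ℕ) : BidiscAlg →L[ℂ] BidiscAlg :=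
  shift (fun n => if n 1 ≤ k then 1 else 0) (fun n => n + e0) 1 (add_left_injective _) fun n => by
    split_ifs <;> simp

/-- The second partial derivative of `prim`. -/
def primT (k : ℕ) : BidiscAlg →L[ℂ] BidiscAlg :=
  shift (fun n => if n 1 + 1 ≤ k ∧ n 0 ≠ 0 then (n 1 + 1) * (n 0 : ℂ)⁻¹ else 0) (fun n => n + e1) k
    (add_left_injective _) fun n => by
    split_ifs with h
    · have h1 : (1 : ℝ) ≤ n 0 := by exact_mod_cast Nat.one_le_iff_ne_zero.2 h.2
      have h2 : (n 1 : ℝ) + 1 ≤ k := by exact_mod_cast h.1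
      have h3 : ‖(n 1 : ℂ) + 1‖ = n 1 + 1 := by exact_mod_cast Complex.norm_natCast (n 1 + 1)
      rw [norm_mul, norm_inv, Complex.norm_natCast, h3]
      exact (mul_le_of_le_one_right (by positivity) (inv_le_one_of_one_le₀ h1)).trans h2
    · simp

/-- The quotient of a series by the `k + 1`-st power of the second variable. -/
def quotT (k : ℕ) : BidiscAlg →L[ℂ] BidiscAlg :=
  shift (fun _ => 1) (fun n => n + Finsupp.single 1 (k + 1)) 1 (add_left_injective _)
    fun n => by simp

variable (k : ℕ) (h : BidiscAlg)

theorem norm_prim_le : ‖prim k h‖ ≤ ‖h‖ := (norm_shift_le _ _ 1 _ _ h).trans_eq (one_mul _)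

theorem norm_primZ_le : ‖primZ k h‖ ≤ ‖h‖ := (norm_shift_le _ _ 1 _ _ h).trans_eq (one_mul _)

theorem norm_primT_le : ‖primT k h‖ ≤ k * ‖h‖ := norm_shift_le _ _ k _ _ h

theorem norm_quotT_le : ‖quotT k h‖ ≤ ‖h‖ := (norm_shift_le _ _ 1 _ _ h).trans_eq (one_mul _)

theorem hasFDerivAt_ev_prim {x : ℂ × ℂ} (hx : ‖x‖ < 1) :
    HasFDerivAt (fun x => ev x (prim k h)) (ev x (primZ k h) • ContinuousLinearMap.fst ℂ ℂ ℂ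
      + ev x (primT k h) • ContinuousLinearMap.snd ℂ ℂ ℂ) x := by
  refine hasFDerivAt_ev (fun n => ?_) (fun n => ?_) hx
  · have : (n 0 : ℂ) + 1 ≠ 0 := Nat.cast_add_one_ne_zero _
    simp only [prim, primZ, co_shift, id, Finsupp.add_apply, e0_zero, e0_one, add_zero]
    by_cases h1 : n 1 ≤ k <;> simp [h1, this]
  · simp only [prim, primT, co_shift, id, Finsupp.add_apply, e1_zero, e1_one, add_zero]
    split_ifs <;> ring

theorem sum_coeff_eq :
    mono e0 * primZ k h + ∑ j ∈ Finset.range (k + 1), co h (Finsupp.single 1 j) • mono e1 ^ j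
      + mono e1 ^ (k + 1) * quotT k h = h := by
  refine ext fun n => ?_
  have hsum : co (∑ j ∈ Finset.range (k + 1), co h (Finsupp.single 1 j) • mono e1 ^ j) n
      = if n 0 = 0 ∧ n 1 ≤ k then co h n else 0 := by
    rw [← coCLM_apply, map_sum]
    simp only [mono_e1_pow, coCLM_apply, co_smul, co_mono]
    split_ifs with h1
    · have h2 : n = Finsupp.single 1 (n 1) := Finsupp.ext fun i => by fin_cases i <;> simp [h1.1]
      rw [Finset.sum_eq_single (n 1)]
      · rw [← h2]; simp
      · intro j _ hj
        have : n ≠ Finsupp.single 1 j := fun h3 => hj (by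
          have := DFunLike.congr_fun h3 1; simpa using this.symm)
        simp [this]
      · intro h3; exact absurd (Finset.mem_range.2 (Nat.lt_succ_of_le h1.2)) h3
    · refine Finset.sum_eq_zero fun j hj => ?_
      have : n ≠ Finsupp.single 1 j := by
        rintro rfl
        exact h1 (by simpa using Nat.lt_succ_iff.1 (Finset.mem_range.1 hj))
      simp [this]
  rw [co_add, co_add, hsum, mono_e1_pow, co_mono_mul, co_mono_mul, primZ, quotT, co_shift, co_shift]
  by_cases h1 : k + 1 ≤ n 1
  · have h2 : Finsupp.single 1 (k + 1) ≤ n := (single_le_iff _ _ _).2 h1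
    have h3 : ¬ n 1 ≤ k := by omega
    have h4 : ¬ (n - e0) 1 ≤ k := by simpa using h3
    rw [if_pos h2, if_neg h4, tsub_add_cancel_of_le h2]
    simp [h3]
  · have h2 : ¬ Finsupp.single 1 (k + 1) ≤ n := fun h' => h1 ((single_le_iff _ _ _).1 h')
    have h3 : n 1 ≤ k := by omega
    have h4 : (n - e0) 1 ≤ k := by simpa using h3
    rw [if_neg h2, if_pos h4]
    by_cases h5 : n 0 = 0
    · have : ¬ e0 ≤ n := fun h' => by simpa [h5] using (single_le_iff 0 1 n).1 h'
      simp [this, h3, h5]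
    · have : e0 ≤ n := (single_le_iff 0 1 n).2 (Nat.one_le_iff_ne_zero.2 h5)
      simp [this, h5, tsub_add_cancel_of_le this]

theorem exists_preparation_series {κ : ℂ} (hκ : κ ≠ 0) {a : BidiscAlg}
    (ha : ‖a‖ + ‖κ‖ * (2 * k + 1) < 1) :
    ∃ ψ : BidiscAlg × BidiscAlg → BidiscAlg, ψ (mono e0 + a, κ • mono e1 ^ (k + 1)) = 0 ∧
      ∀ᶠ p in nhds (mono e0 + a, κ • mono e1 ^ (k + 1)), ContinuousAt ψ p ∧
        p.1 * primZ k (ψ p) + p.2 * (1 + primT k (ψ p)) =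
          (κ • 1 - quotT k (ψ p)) * ((mono e1 + prim k (ψ p)) ^ (k + 1)
            - κ⁻¹ • ∑ j ∈ Finset.range (k + 1),
              co (ψ p) (Finsupp.single 1 j) • (mono e1 + prim k (ψ p)) ^ j) := by
  set E : BidiscAlg →L[ℂ] BidiscAlg := ContinuousLinearMap.mul ℂ _ a ∘L primZ k
    + κ • (ContinuousLinearMap.mul ℂ _ (mono e1 ^ (k + 1)) ∘L primT k)
    - (κ * (k + 1)) • (ContinuousLinearMap.mul ℂ _ (mono e1 ^ k) ∘L prim k) with hE
  have hEn : ‖E‖ < 1 := by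
    refine (ContinuousLinearMap.opNorm_le_bound E (by positivity) fun h => ?_).trans_lt ha
    have hk1 : ‖κ * ((k : ℂ) + 1)‖ = ‖κ‖ * (k + 1) := by
      rw [norm_mul]; congr 1; exact_mod_cast Complex.norm_natCast (k + 1)
    have h1 : ‖a * primZ k h‖ ≤ ‖a‖ * ‖h‖ :=
      (norm_mul_le _ _).trans (by gcongr; exact norm_primZ_le k h)
    have h2 : ‖κ • (mono e1 ^ (k + 1) * primT k h)‖ ≤ ‖κ‖ * (k * ‖h‖) := by
      rw [norm_smul]; gcongr
      refine (norm_mul_le _ _).trans ?_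
      rw [mono_e1_pow, norm_mono, one_mul]; exact norm_primT_le k h
    have h3 : ‖(κ * ((k : ℂ) + 1)) • (mono e1 ^ k * prim k h)‖ ≤ ‖κ‖ * (k + 1) * ‖h‖ := by
      rw [norm_smul, hk1]; gcongr
      refine (norm_mul_le _ _).trans ?_
      rw [mono_e1_pow, norm_mono, one_mul]; exact norm_prim_le k h
    calc ‖E h‖ ≤ ‖a * primZ k h‖ + ‖κ • (mono e1 ^ (k + 1) * primT k h)‖
          + ‖(κ * ((k : ℂ) + 1)) • (mono e1 ^ k * prim k h)‖ :=
          (norm_sub_le _ _).trans (add_le_add_left (norm_add_le _ _) _)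
      _ ≤ ‖a‖ * ‖h‖ + ‖κ‖ * (k * ‖h‖) + ‖κ‖ * (k + 1) * ‖h‖ := by gcongr
      _ = _ := by ring
  obtain ⟨ψ, hψ, hev⟩ := exists_implicit_solution (V := BidiscAlg × BidiscAlg) (W := BidiscAlg)
    (G := fun p => p.1.1 * primZ k p.2 + p.1.2 * (1 + primT k p.2)
      - (κ • 1 - quotT k p.2) * ((mono e1 + prim k p.2) ^ (k + 1)
        - κ⁻¹ • ∑ j ∈ Finset.range (k + 1),
          coCLM (Finsupp.single 1 j) p.2 • (mono e1 + prim k p.2) ^ j))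
    (v₀ := (mono e0 + a, κ • mono e1 ^ (k + 1))) (E := E) (by fun_prop) (by simp) hEn (by
      have hT : HasFDerivAt (fun h => mono e1 + prim k h) (prim k) 0 :=
        (prim k).hasFDerivAt.const_add _
      have hS := HasFDerivAt.fun_sum (u := Finset.range (k + 1)) fun j _ =>
        ((coCLM (Finsupp.single 1 j)).hasFDerivAt (x := (0 : BidiscAlg))).smul (hT.pow j)
      have h1 := (((primZ k).hasFDerivAt (x := (0 : BidiscAlg))).const_mul (mono e0 + a)).add
        (((primT k).hasFDerivAt.const_add 1).const_mul (κ • mono e1 ^ (k + 1)))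
      have h2 := (((quotT k).hasFDerivAt (x := (0 : BidiscAlg))).const_sub (κ • 1)).mul
        ((hT.pow (k + 1)).sub (hS.const_smul κ⁻¹))
      refine (h1.sub h2).congr_fderiv ?_
      refine ContinuousLinearMap.ext fun h => ?_
      have h3 := sum_coeff_eq k h
      simp [hE, coCLM_apply]
      rw [smul_sub, smul_inv_smul₀ hκ]
      generalize ∑ j ∈ Finset.range (k + 1), co h (Finsupp.single 1 j) • mono e1 ^ j = S at h3 ⊢
      simp only [Algebra.smul_def, map_mul, map_add, map_natCast, map_one]
      linear_combination h3)
  exact ⟨ψ, hψ, hev.mono fun p hp => ⟨hp.1, sub_eq_zero.1 hp.2⟩⟩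

end BidiscAlg

open BidiscAlg in
/-- Straightening of the base dynamics: there is a family of changes of the second variable after
which its derivative along the field is a unit times a polynomial of degree `k + 1`. -/
theorem exists_preparation {k : ℕ} (hk : 1 ≤ k) {e δ : ℝ} (he : 0 < e) (hδ : 0 < δ)
    (f g : ℝ → ℂ × ℂ → ℂ)
    (hfd : ∀ ε ∈ Ioo (-e) e, DifferentiableOn ℂ (f ε) (ball 0 δ))
    (hfc : ContinuousOn (fun w : (ℂ × ℂ) × ℝ => f w.2 w.1) (ball 0 δ ×ˢ Ioo (-e) e))
    (hgd : ∀ ε ∈ Ioo (-e) e, DifferentiableOn ℂ (g ε) (ball 0 δ))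
    (hgc : ContinuousOn (fun w : (ℂ × ℂ) × ℝ => g w.2 w.1) (ball 0 δ ×ˢ Ioo (-e) e))
    (hf0 : f 0 0 = 0) (hf1 : HasFDerivAt (f 0) (ContinuousLinearMap.fst ℂ ℂ ℂ) 0)
    (hg0 : ∀ x, g 0 x = x.2 ^ (k + 1)) :
    ∃ e' r : ℝ, 0 < e' ∧ e' ≤ e ∧ 0 < r ∧ r ≤ δ ∧
    ∃ φ φz φt U : ℝ → ℂ × ℂ → ℂ, ∃ c : ℕ → ℝ → ℂ,
      (∀ x, φ 0 x = 0) ∧ (∀ x, U 0 x = 1) ∧ (∀ j, c j 0 = 0) ∧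
      (∀ j, ContinuousOn (c j) (Ioo (-e') e')) ∧
      ContinuousOn (fun w : (ℂ × ℂ) × ℝ => φ w.2 w.1) (ball 0 r ×ˢ Ioo (-e') e') ∧
      ContinuousOn (fun w : (ℂ × ℂ) × ℝ => U w.2 w.1) (ball 0 r ×ˢ Ioo (-e') e') ∧
      (∀ η > 0, ∀ᶠ ε in nhds 0, ∀ x ∈ ball 0 r, ‖φ ε x‖ ≤ η) ∧
      ∀ ε ∈ Ioo (-e') e', ∀ x ∈ ball 0 r,
        HasFDerivAt (φ ε) (φz ε x • ContinuousLinearMap.fst ℂ ℂ ℂ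
          + φt ε x • ContinuousLinearMap.snd ℂ ℂ ℂ) x ∧
        DifferentiableAt ℂ (U ε) x ∧ ‖φt ε x‖ ≤ 1 / 8 ∧ ‖U ε x - 1‖ ≤ 1 / 8 ∧
        f ε x * φz ε x + g ε x * (1 + φt ε x) = U ε x * ((x.2 + φ ε x) ^ (k + 1)
          - ∑ j ∈ Finset.range (k + 1), c j ε * (x.2 + φ ε x) ^ j) := by
  have h0e : (0 : ℝ) ∈ Ioo (-e) e := ⟨by linarith, he⟩
  obtain ⟨ρ₀, hρ₀, hρ₀δ, hρb⟩ := exists_scaled_expansion he hδ f hfd hfc hf0 hf1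
    (show (0 : ℝ) < 1 / 4 by norm_num)
  obtain ⟨ρ, hρ, hρρ₀, hρk⟩ : ∃ ρ : ℝ, 0 < ρ ∧ ρ ≤ ρ₀ ∧ ρ * (2 * k + 1) ≤ 1 / 4 := by
    refine ⟨min ρ₀ (1 / 4 / (2 * k + 1)), by positivity, min_le_left _ _, ?_⟩
    rw [← le_div_iff₀ (by positivity)]
    exact min_le_right _ _
  have hρC : (ρ : ℂ) ≠ 0 := by exact_mod_cast hρ.ne'
  have hρn : ‖(ρ : ℂ)⁻¹‖ = ρ⁻¹ := by rw [norm_inv, Complex.norm_real, Real.norm_of_nonneg hρ.le]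
  obtain ⟨b, hb, hb0, hbf⟩ := hρb ρ hρ hρρ₀
  obtain ⟨β, hβ, hβg⟩ := exists_taylor hρ (hρρ₀.trans_lt hρ₀δ) g hgd hgc
  set κ : ℂ := (ρ : ℂ) ^ k with hκdef
  have hκ : κ ≠ 0 := pow_ne_zero _ hρC
  have hκn : ‖κ‖ ≤ ρ := by
    rw [hκdef, norm_pow, Complex.norm_real, Real.norm_of_nonneg hρ.le]
    refine pow_le_of_le_one hρ.le ?_ (by omega)
    have : (0 : ℝ) ≤ k := k.cast_nonneg
    nlinarith
  obtain ⟨ψ, hψ0, hψ⟩ := exists_preparation_series k hκ (a := b 0 - mono e0) (by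
    have : ‖κ‖ * (2 * k + 1) ≤ 1 / 4 := (mul_le_mul_of_nonneg_right hκn (by positivity)).trans hρk
    linarith)
  set p : ℝ → BidiscAlg × BidiscAlg := fun ε =>
    (b ε, (ρ : ℂ)⁻¹ • (β ε - β 0) + κ • mono e1 ^ (k + 1)) with hp
  have hpc : ContinuousOn p (Ioo (-e) e) :=
    hb.prodMk (((hβ.sub continuousOn_const).const_smul ((ρ : ℂ)⁻¹)).add continuousOn_const)
  have hp0 : p 0 = (mono e0 + (b 0 - mono e0), κ • mono e1 ^ (k + 1)) := by
    simp [hp]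
  rw [← hp0] at hψ0 hψ
  have hp0c : ContinuousAt p 0 := hpc.continuousAt (Ioo_mem_nhds h0e.1 h0e.2)
  set h : ℝ → BidiscAlg := fun ε => ψ (p ε) with hh
  have hh0 : Tendsto (fun ε => ‖h ε‖) (nhds 0) (nhds 0) := by
    have h1 : ContinuousAt h 0 := ContinuousAt.comp hψ.self_of_nhds.1 hp0c
    simpa [ContinuousAt, hh, hψ0] using h1.norm
  have hμ : 0 < min (1 / 8 / ((k : ℝ) + 1)) (‖κ‖ / 8) := by
    have := norm_pos_iff.2 hκ
    positivity
  obtain ⟨e₂, he₂, hee⟩ := Metric.eventually_nhds_iff.1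
    ((hp0c.eventually hψ).and (hh0.eventually (eventually_le_nhds hμ)))
  have hsub : Ioo (-min e e₂) (min e e₂) ⊆ Ioo (-e) e :=
    Ioo_subset_Ioo (neg_le_neg (min_le_left _ _)) (min_le_left _ _)
  have hnear : ∀ ε ∈ Ioo (-min e e₂) (min e e₂), dist ε 0 < e₂ := by
    intro ε hε
    rw [dist_zero_right, Real.norm_eq_abs, abs_lt]
    exact ⟨by linarith [hε.1, min_le_right e e₂], hε.2.trans_le (min_le_right _ _)⟩
  have hhc : ContinuousOn h (Ioo (-min e e₂) (min e e₂)) := fun ε hε =>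
    (hee (hnear ε hε)).1.1.comp_continuousWithinAt (hpc.mono hsub ε hε)
  have hscale : ∀ x ∈ ball (0 : ℂ × ℂ) (ρ / 2), ‖(ρ : ℂ)⁻¹ • x‖ < 1 / 2 := by
    intro x hx
    rw [norm_smul, hρn, inv_mul_lt_iff₀ hρ]
    rw [mem_ball_zero_iff] at hx; linarith
  refine ⟨min e e₂, ρ / 2, lt_min he he₂, min_le_left _ _, by positivity, by linarith,
    fun ε x => ρ * ev ((ρ : ℂ)⁻¹ • x) (prim k (h ε)),
    fun ε x => ev ((ρ : ℂ)⁻¹ • x) (primZ k (h ε)), fun ε x => ev ((ρ : ℂ)⁻¹ • x) (primT k (h ε)),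
    fun ε x => 1 - κ⁻¹ * ev ((ρ : ℂ)⁻¹ • x) (quotT k (h ε)),
    fun j ε => ρ * (ρ : ℂ)⁻¹ ^ j * coCLM (Finsupp.single 1 j) (h ε), fun x => ?_, fun x => ?_,
    fun j => ?_, fun j => ?_, ?_, ?_, fun η hη => ?_, fun ε hε x hx => ?_⟩
  · simp [hh, hψ0, ev_zero]
  · simp [hh, hψ0, ev_zero]
  · simp [hh, hψ0]
  · exact continuousOn_const.mul ((coCLM _).continuous.comp_continuousOn hhc)
  · refine continuousOn_const.mul (continuousOn_ev_comp (by fun_prop)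
      ((prim k).continuous.comp_continuousOn (hhc.comp continuousOn_snd fun w hw => hw.2))
      fun w hw => ?_)
    linarith [hscale _ hw.1]
  · refine continuousOn_const.sub (continuousOn_const.mul (continuousOn_ev_comp (by fun_prop)
      ((quotT k).continuous.comp_continuousOn (hhc.comp continuousOn_snd fun w hw => hw.2))
      fun w hw => ?_))
    linarith [hscale _ hw.1]
  · filter_upwards [hh0.eventually (eventually_le_nhds (show 0 < η / ρ by positivity))]
      with ε hε x hx
    rw [norm_mul, Complex.norm_real, Real.norm_of_nonneg hρ.le, mul_comm, ← le_div_iff₀ hρ]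
    exact (norm_ev_le (by linarith [hscale x hx]) _).trans ((norm_prim_le _ _).trans hε)
  have hy := hscale x hx
  have hy1 : ‖(ρ : ℂ)⁻¹ • x‖ ≤ 1 := by linarith
  have hhn : ‖h ε‖ ≤ _ := (hee (hnear ε hε)).2
  refine ⟨?_, ?_, ?_, ?_, ?_⟩
  · have h1 := HasFDerivAt.comp (g := fun x => ev x (prim k (h ε)))
      (f := fun x : ℂ × ℂ => (ρ : ℂ)⁻¹ • x) x
      (hasFDerivAt_ev_prim k (h ε) (by linarith))
      ((ρ : ℂ)⁻¹ • ContinuousLinearMap.id ℂ (ℂ × ℂ)).hasFDerivAt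
    refine (h1.const_mul (ρ : ℂ)).congr_fderiv ?_
    ext <;> simp <;> field_simp
  · have h1 : DifferentiableAt ℂ (fun x => ev x (quotT k (h ε))) ((ρ : ℂ)⁻¹ • x) :=
      differentiableAt_ev _ hy
    exact ((h1.comp x (differentiableAt_id.const_smul ((ρ : ℂ)⁻¹))).const_mul _).const_sub 1
  · refine (norm_ev_le hy1 _).trans ((norm_primT_le _ _).trans ?_)
    have h1 := hhn.trans (min_le_left _ _)
    rw [le_div_iff₀ (by positivity)] at h1
    nlinarith [norm_nonneg (h ε)]
  · have h1 : ‖ev ((ρ : ℂ)⁻¹ • x) (quotT k (h ε))‖ ≤ ‖κ‖ / 8 :=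
      (norm_ev_le hy1 _).trans ((norm_quotT_le _ _).trans (hhn.trans (min_le_right _ _)))
    rw [sub_sub_cancel_left, norm_neg, norm_mul, norm_inv, inv_mul_le_iff₀ (norm_pos_iff.2 hκ)]
    linarith
  · have hf : ev ((ρ : ℂ)⁻¹ • x) (b ε) = (ρ : ℂ)⁻¹ * f ε x := by
      rw [hbf ε (hsub hε) _ hy1, smul_inv_smul₀ hρC]
    have hgε : ev ((ρ : ℂ)⁻¹ • x) (p ε).2 = (ρ : ℂ)⁻¹ * g ε x := by
      simp only [hp]
      rw [ev_add hy1, ev_smul, ev_smul, ev_sub hy1, ev_pow hy1, ev_mono, hβg ε (hsub hε) _ hy1,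
        hβg 0 h0e _ hy1, smul_inv_smul₀ hρC, hg0]
      simp [mval, hκdef, mul_pow]
      field_simp
      ring
    have h1 := congrArg (ev ((ρ : ℂ)⁻¹ • x)) (hee (hnear ε hε)).1.2
    simp only [ev_add hy1, ev_mul hy1, ev_sub hy1, ev_smul, ev_pow hy1, ev_one, ev_sum hy1, ev_mono,
      hgε] at h1
    have hρρ : (ρ : ℂ) * (ρ : ℂ)⁻¹ = 1 := mul_inv_cancel₀ hρC
    have hκκ : κ * κ⁻¹ = 1 := mul_inv_cancel₀ hκ
    simp only [hp, hf] at h1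
    change _ = (κ * 1 - ev _ (quotT k (h ε))) * ((_ + ev _ (prim k (h ε))) ^ (k + 1)
      - κ⁻¹ * ∑ j ∈ Finset.range (k + 1),
        co (h ε) (Finsupp.single 1 j) * (_ + ev _ (prim k (h ε))) ^ j) at h1
    set Y : ℂ := mval ((ρ : ℂ)⁻¹ • x) e1 + ev ((ρ : ℂ)⁻¹ • x) (prim k (h ε)) with hYdef
    have hY : x.2 + ρ * ev ((ρ : ℂ)⁻¹ • x) (prim k (h ε)) = ρ * Y := by
      simp [hYdef, mval]
      field_simp
    have hS : ∑ j ∈ Finset.range (k + 1),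
        ρ * (ρ : ℂ)⁻¹ ^ j * coCLM (Finsupp.single 1 j) (h ε) * (ρ * Y) ^ j
        = ρ * ∑ j ∈ Finset.range (k + 1), co (h ε) (Finsupp.single 1 j) * Y ^ j := by
      rw [Finset.mul_sum]
      refine Finset.sum_congr rfl fun j _ => ?_
      rw [coCLM_apply, mul_pow, inv_pow]
      field_simp
    have hP : (ρ * Y) ^ (k + 1) = ρ * κ * Y ^ (k + 1) := by rw [mul_pow, hκdef]; ring
    simp only [hY]
    rw [hS, hP]
    generalize ∑ j ∈ Finset.range (k + 1), co (h ε) (Finsupp.single 1 j) * Y ^ j = S at h1 ⊢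
    change _ * ev _ (primZ k (h ε)) + _ * (1 + ev _ (primT k (h ε))) = _ at h1
    linear_combination ρ * h1 - (f ε x * ev ((ρ : ℂ)⁻¹ • x) (primZ k (h ε))
      + g ε x * (1 + ev ((ρ : ℂ)⁻¹ • x) (primT k (h ε)))) * hρρ
      + (ρ * ev ((ρ : ℂ)⁻¹ • x) (quotT k (h ε)) * Y ^ (k + 1) - ρ * S) * hκκ

theorem mem_ball_zero_prod {a b : ℂ} {r : ℝ} :
    ((a, b) : ℂ × ℂ) ∈ ball (0 : ℂ × ℂ) r ↔ ‖a‖ < r ∧ ‖b‖ < r := by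
  rw [mem_ball_zero_iff, Prod.norm_def, max_lt_iff]

theorem norm_sub_le_of_hasFDerivAt {r : ℝ} {φ φz φt : ℂ × ℂ → ℂ}
    (hφ : ∀ x ∈ ball 0 r, HasFDerivAt φ (φz x • ContinuousLinearMap.fst ℂ ℂ ℂ
      + φt x • ContinuousLinearMap.snd ℂ ℂ ℂ) x)
    (hφt : ∀ x ∈ ball 0 r, ‖φt x‖ ≤ 1 / 8) {z t t' : ℂ} (hz : ‖z‖ < r) (ht : ‖t‖ < r)
    (ht' : ‖t'‖ < r) : ‖φ (z, t) - φ (z, t')‖ ≤ 1 / 8 * ‖t - t'‖ := by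
  refine Convex.norm_image_sub_le_of_norm_hasDerivWithin_le (𝕜 := ℂ) (f := fun t => φ (z, t))
    (f' := fun t => φt (z, t)) (s := ball 0 r) (fun y hy => ?_) (fun y hy => ?_)
    (convex_ball 0 r) (mem_ball_zero_iff.2 ht') (mem_ball_zero_iff.2 ht)
  · have h1 := HasFDerivAt.comp_hasDerivAt (f := fun t : ℂ => ((z, t) : ℂ × ℂ)) (l := φ) y
      (hφ _ (mem_ball_zero_prod.2 ⟨hz, mem_ball_zero_iff.1 hy⟩))
      ((hasDerivAt_const y z).prodMk (hasDerivAt_id y))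
    exact (h1.congr_deriv (by simp)).hasDerivWithinAt
  · exact hφt _ (mem_ball_zero_prod.2 ⟨hz, mem_ball_zero_iff.1 hy⟩)

/-- The linear automorphism of the plane fixing the first coordinate. -/
def shearEquiv (a d : ℂ) (hd : 1 + d ≠ 0) : (ℂ × ℂ) ≃L[ℂ] (ℂ × ℂ) :=
  ContinuousLinearEquiv.equivOfInverse
    ((ContinuousLinearMap.fst ℂ ℂ ℂ).prod (a • ContinuousLinearMap.fst ℂ ℂ ℂ
      + (1 + d) • ContinuousLinearMap.snd ℂ ℂ ℂ))
    ((ContinuousLinearMap.fst ℂ ℂ ℂ).prod ((1 + d)⁻¹ • (ContinuousLinearMap.snd ℂ ℂ ℂ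
      - a • ContinuousLinearMap.fst ℂ ℂ ℂ)))
    (fun x => by ext <;> simp [hd]) (fun x => by ext <;> simp [hd])

/-- Inversion in the second variable of a family of small perturbations of the identity. -/
theorem exists_fibre_inverse {e r : ℝ} (φ φz φt : ℝ → ℂ × ℂ → ℂ)
    (hφ : ∀ ε ∈ Ioo (-e) e, ∀ x ∈ ball 0 r, HasFDerivAt (φ ε)
      (φz ε x • ContinuousLinearMap.fst ℂ ℂ ℂ + φt ε x • ContinuousLinearMap.snd ℂ ℂ ℂ) x)
    (hφt : ∀ ε ∈ Ioo (-e) e, ∀ x ∈ ball 0 r, ‖φt ε x‖ ≤ 1 / 8)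
    (hφs : ∀ ε ∈ Ioo (-e) e, ∀ x ∈ ball 0 r, ‖φ ε x‖ ≤ r / 8)
    (hφc : ContinuousOn (fun w : (ℂ × ℂ) × ℝ => φ w.2 w.1) (ball 0 r ×ˢ Ioo (-e) e)) :
    ∃ τ : ℝ → ℂ × ℂ → ℂ,
      ContinuousOn (fun w : (ℂ × ℂ) × ℝ => τ w.2 w.1) (ball 0 (r / 2) ×ˢ Ioo (-e) e) ∧
      ∀ ε ∈ Ioo (-e) e, ∀ x ∈ ball 0 (r / 2), ‖τ ε x‖ < r ∧ DifferentiableAt ℂ (τ ε) x ∧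
        ∀ t, ‖t‖ < r → t + φ ε (x.1, t) = x.2 → τ ε x = t := by
  have hlip : ∀ ε ∈ Ioo (-e) e, ∀ z t t' : ℂ, ‖z‖ < r → ‖t‖ < r → ‖t'‖ < r →
      ‖φ ε (z, t) - φ ε (z, t')‖ ≤ 1 / 8 * ‖t - t'‖ := fun ε hε z t t' =>
    norm_sub_le_of_hasFDerivAt (hφ ε hε) (hφt ε hε)
  have hex : ∀ ε ∈ Ioo (-e) e, ∀ x ∈ ball (0 : ℂ × ℂ) (r / 2),
      ∃ t, ‖t‖ < r ∧ t + φ ε (x.1, t) = x.2 := by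
    intro ε hε x hx
    have hr : 0 < r := by linarith [pos_of_mem_ball hx]
    obtain ⟨hz, hT⟩ := mem_ball_zero_prod.1 hx
    have hmaps : MapsTo (fun t => x.2 - φ ε (x.1, t)) (closedBall 0 (3 * r / 4))
        (closedBall 0 (3 * r / 4)) := by
      intro t ht
      rw [mem_closedBall_zero_iff] at ht ⊢
      have h1 := hφs ε hε (x.1, t) (mem_ball_zero_prod.2 ⟨by linarith, by linarith⟩)
      exact (norm_sub_le _ _).trans (by linarith)
    have hcon : ContractingWith (1 / 8) (hmaps.restrict _ _ _) := by
      refine ⟨by rw [div_lt_one] <;> norm_num, LipschitzWith.of_dist_le_mul fun t t' => ?_⟩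
      have ht := mem_closedBall_zero_iff.1 t.2
      have ht' := mem_closedBall_zero_iff.1 t'.2
      have h1 := hlip ε hε x.1 t t' (by linarith) (by linarith) (by linarith)
      rw [Subtype.dist_eq, Subtype.dist_eq, dist_eq_norm, dist_eq_norm]
      simp only [MapsTo.val_restrict_apply, sub_sub_sub_cancel_left]
      rw [norm_sub_rev]
      simpa using h1
    obtain ⟨t, ht, hfix, -⟩ := hcon.exists_fixedPoint' isClosed_closedBall.isComplete hmaps
      (mem_closedBall_self (by positivity : 0 ≤ 3 * r / 4)) (edist_ne_top _ _)
    refine ⟨t, ?_, ?_⟩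
    · have := mem_closedBall_zero_iff.1 ht; linarith
    · have h1 : x.2 - φ ε (x.1, t) = t := hfix
      linear_combination -h1
  choose! τ hτ hτφ using hex
  have huniq : ∀ ε ∈ Ioo (-e) e, ∀ x ∈ ball (0 : ℂ × ℂ) (r / 2), ∀ t, ‖t‖ < r →
      t + φ ε (x.1, t) = x.2 → τ ε x = t := by
    intro ε hε x hx t ht h
    obtain ⟨hz, -⟩ := mem_ball_zero_prod.1 hx
    have h1 := hlip ε hε x.1 (τ ε x) t (by linarith [pos_of_mem_ball hx]) (hτ ε hε x hx) ht
    have h2 : φ ε (x.1, τ ε x) - φ ε (x.1, t) = -(τ ε x - t) := by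
      linear_combination hτφ ε hε x hx - h
    rw [h2, norm_neg] at h1
    have h3 : ‖τ ε x - t‖ ≤ 0 := by linarith
    exact sub_eq_zero.1 (norm_le_zero_iff.1 h3)
  have hcont : ContinuousOn (fun w : (ℂ × ℂ) × ℝ => τ w.2 w.1) (ball 0 (r / 2) ×ˢ Ioo (-e) e) := by
    intro w₀ hw₀
    set t₀ := τ w₀.2 w₀.1 with ht₀
    have ht₀r : ‖t₀‖ < r := hτ _ hw₀.2 _ hw₀.1
    have hmem : ∀ w ∈ ball (0 : ℂ × ℂ) (r / 2) ×ˢ Ioo (-e) e,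
        (((w.1.1, t₀), w.2) : (ℂ × ℂ) × ℝ) ∈ ball (0 : ℂ × ℂ) r ×ˢ Ioo (-e) e := fun w hw =>
      ⟨mem_ball_zero_prod.2 ⟨by
        linarith [(mem_ball_zero_prod.1 hw.1).1, pos_of_mem_ball hw.1], ht₀r⟩, hw.2⟩
    have h1 : ContinuousOn (fun w : (ℂ × ℂ) × ℝ => 2 * (‖w.1.2 - w₀.1.2‖
        + ‖φ w.2 (w.1.1, t₀) - φ w₀.2 (w₀.1.1, t₀)‖)) (ball 0 (r / 2) ×ˢ Ioo (-e) e) := by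
      have h2 : ContinuousOn (fun w : (ℂ × ℂ) × ℝ => φ w.2 (w.1.1, t₀))
          (ball 0 (r / 2) ×ˢ Ioo (-e) e) :=
        hφc.comp (f := fun w : (ℂ × ℂ) × ℝ => ((w.1.1, t₀), w.2)) (by fun_prop) hmem
      refine continuousOn_const.mul (ContinuousOn.add ?_ (h2.sub continuousOn_const).norm)
      exact Continuous.continuousOn (by fun_prop)
    have h2 := h1 w₀ hw₀
    simp only [ContinuousWithinAt, sub_self, norm_zero, add_zero, mul_zero] at h2
    refine tendsto_iff_norm_sub_tendsto_zero.2 (squeeze_zero' (Eventually.of_forall fun _ =>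
      norm_nonneg _) ?_ h2)
    filter_upwards [self_mem_nhdsWithin] with w hw
    have h3 := hlip w.2 hw.2 w.1.1 (τ w.2 w.1) t₀ (mem_ball_zero_prod.1 (hmem w hw).1).1
      (hτ _ hw.2 _ hw.1) ht₀r
    have h4 : τ w.2 w.1 - t₀ = (w.1.2 - w₀.1.2) - (φ w.2 (w.1.1, τ w.2 w.1) - φ w.2 (w.1.1, t₀))
        - (φ w.2 (w.1.1, t₀) - φ w₀.2 (w₀.1.1, t₀)) := by
      linear_combination hτφ _ hw.2 _ hw.1 - hτφ _ hw₀.2 _ hw₀.1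
    have h5 : ‖τ w.2 w.1 - t₀‖ ≤ ‖w.1.2 - w₀.1.2‖ + 1 / 8 * ‖τ w.2 w.1 - t₀‖
        + ‖φ w.2 (w.1.1, t₀) - φ w₀.2 (w₀.1.1, t₀)‖ := by
      conv_lhs => rw [h4]
      exact (norm_sub_le _ _).trans (add_le_add_left ((norm_sub_le _ _).trans (by gcongr)) _)
    nlinarith [norm_nonneg (w.1.2 - w₀.1.2), norm_nonneg (φ w.2 (w.1.1, t₀) - φ w₀.2 (w₀.1.1, t₀))]
  refine ⟨τ, hcont, fun ε hε x hx => ⟨hτ ε hε x hx, ?_, huniq ε hε x hx⟩⟩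
  have hxτ : ((x.1, τ ε x) : ℂ × ℂ) ∈ ball (0 : ℂ × ℂ) r := mem_ball_zero_prod.2
    ⟨by linarith [(mem_ball_zero_prod.1 hx).1, pos_of_mem_ball hx], hτ ε hε x hx⟩
  have hne : 1 + φt ε (x.1, τ ε x) ≠ 0 := by
    intro h
    have h1 := hφt ε hε _ hxτ
    rw [eq_neg_of_add_eq_zero_right h, norm_neg, norm_one] at h1
    norm_num at h1
  have hτc : ContinuousAt (τ ε) x := by
    have h1 : ContinuousOn (τ ε) (ball 0 (r / 2)) :=
      hcont.comp (f := fun x : ℂ × ℂ => (x, ε)) (by fun_prop) fun y hy => ⟨hy, hε⟩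
    exact h1.continuousAt (isOpen_ball.mem_nhds hx)
  have h1 : HasFDerivAt (fun y : ℂ × ℂ => (y.1, y.2 + φ ε y))
      (shearEquiv (φz ε (x.1, τ ε x)) (φt ε (x.1, τ ε x)) hne : ℂ × ℂ →L[ℂ] ℂ × ℂ)
      (x.1, τ ε x) := by
    refine (hasFDerivAt_fst.prodMk (hasFDerivAt_snd.add (hφ ε hε _ hxτ))).congr_fderiv ?_
    ext <;> simp [shearEquiv]
  have h2 := HasFDerivAt.of_local_left_inverse (g := fun y : ℂ × ℂ => (y.1, τ ε y)) (a := x)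
    (continuousAt_fst.prodMk hτc) h1 (by
      filter_upwards [isOpen_ball.mem_nhds hx] with y hy
      exact Prod.ext rfl (hτφ ε hε y hy))
  exact h2.differentiableAt.snd

theorem hasFDerivAt_fst_of_partial {f : ℂ × ℂ → ℂ} {A : ℂ → ℂ → ℂ} (hf : DifferentiableAt ℂ f 0)
    (hfA : ∀ z t, f (z, t) = z + A z t) (hz : deriv (fun z => A z 0) 0 = 0)
    (ht : deriv (fun t => A 0 t) 0 = 0) :
    HasFDerivAt f (ContinuousLinearMap.fst ℂ ℂ ℂ) 0 := by
  have h := hf.hasFDerivAt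
  have h1 : HasDerivAt (fun z : ℂ => f (z, 0)) (fderiv ℂ f 0 (1, 0)) 0 :=
    HasFDerivAt.comp_hasDerivAt (f := fun z : ℂ => ((z, 0) : ℂ × ℂ)) (l := f) (0 : ℂ) h
      ((hasDerivAt_id _).prodMk (hasDerivAt_const _ _))
  have h2 : HasDerivAt (fun t : ℂ => f (0, t)) (fderiv ℂ f 0 (0, 1)) 0 :=
    HasFDerivAt.comp_hasDerivAt (f := fun t : ℂ => ((0, t) : ℂ × ℂ)) (l := f) (0 : ℂ) h
      ((hasDerivAt_const _ _).prodMk (hasDerivAt_id _))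
  have h3 : fderiv ℂ f 0 (1, 0) = 1 := by
    have h4 : HasDerivAt (fun z => A z 0) (fderiv ℂ f 0 (1, 0) - 1) 0 :=
      (h1.sub (hasDerivAt_id (0 : ℂ))).congr_of_eventuallyEq
        (Eventually.of_forall fun z => by simp [hfA])
    rw [h4.deriv] at hz
    exact sub_eq_zero.1 hz
  have h5 : fderiv ℂ f 0 (0, 1) = 0 := by
    have h4 : HasDerivAt (fun t => A 0 t) (fderiv ℂ f 0 (0, 1)) 0 :=
      h2.congr_of_eventuallyEq (Eventually.of_forall fun t => by simp [hfA])
    rwa [h4.deriv] at ht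
  refine h.congr_fderiv ?_
  ext <;> simp [h3, h5]

open Polynomial in
theorem exists_continuous_factorization {n : ℕ} {r : ℝ} (hr : 0 ≤ r) {c : ℕ → ℝ → ℂ}
    (hc : ∀ j, ContinuousOn (c j) (Icc (-r) r)) (hc0 : ∀ j, c j 0 = 0) :
    ∃ α : Fin (n + 1) → ℝ → ℂ, (∀ i, Continuous (α i)) ∧ (∀ i, α i 0 = 0) ∧
      ∀ s ∈ Icc (-r) r, ∀ T : ℂ,
        T ^ (n + 1) - ∑ j ∈ Finset.range (n + 1), c j s * T ^ j = ∏ i, (T - α i s) := by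
  set q : ℝ → ℂ[X] := fun s => ∑ j ∈ Finset.range (n + 1), C (c j s) * X ^ j with hq
  have hdeg : ∀ s, (q s).degree < (n + 1 : ℕ) := fun s =>
    (degree_sum_le _ _).trans_lt ((Finset.sup_lt_iff (WithBot.bot_lt_coe _)).2 fun j hj =>
      (degree_C_mul_X_pow_le _ _).trans_lt (by exact_mod_cast Finset.mem_range.1 hj))
  obtain ⟨α, hα, hαp⟩ := Polynomial.exists_continuous_roots (n := n + 1) hr
    (p := fun s => X ^ (n + 1) - q s) (fun s _ => monic_X_pow_sub (hdeg s))
    (fun s _ => natDegree_eq_of_degree_eq_some (by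
      rw [degree_sub_eq_left_of_degree_lt, degree_X_pow]
      rw [degree_X_pow]
      exact hdeg s))
    (fun i => by
      simp only [hq, coeff_sub, finsetSum_coeff, coeff_C_mul]
      exact continuousOn_const.sub (continuousOn_finsetSum _ fun j _ =>
        (hc j).mul continuousOn_const))
  have key : ∀ s ∈ Icc (-r) r, ∀ T : ℂ,
      T ^ (n + 1) - ∑ j ∈ Finset.range (n + 1), c j s * T ^ j = ∏ i, (T - α i s) := by
    intro s hs T
    have := congrArg (Polynomial.eval T) (hαp s hs)
    simpa [hq, eval_finsetSum, eval_prod] using this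
  refine ⟨α, hα, fun i => ?_, key⟩
  have h1 := key 0 ⟨by linarith, hr⟩ (α i 0)
  rw [Finset.prod_eq_zero (Finset.mem_univ i) (sub_self _)] at h1
  simpa [hc0] using h1

theorem stmt8 (k : ℕ) (hk : 1 ≤ k) (ε₀ δ₀ : ℝ) (hε₀ : 0 < ε₀) (hδ₀ : 0 < δ₀)
    (v : ℝ → ℂ × ℂ → ℂ × ℂ)
    (hvhol : ∀ ε ∈ Set.Ioo (-ε₀) ε₀,
      DifferentiableOn ℂ (v ε) (Metric.ball (0 : ℂ) δ₀ ×ˢ Metric.ball (0 : ℂ) δ₀))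
    (hvcont : ContinuousOn (fun w : (ℂ × ℂ) × ℝ => v w.2 w.1)
      ((Metric.ball (0 : ℂ) δ₀ ×ˢ Metric.ball (0 : ℂ) δ₀) ×ˢ Set.Ioo (-ε₀) ε₀))
    (A : ℂ → ℂ → ℂ)
    (hv0 : ∀ z t : ℂ, v 0 (z, t) = (z + A z t, t ^ (k + 1)))
    (hA00 : A 0 0 = 0)
    (hAz : deriv (fun z => A z 0) 0 = 0)
    (hAt : ∀ j : ℕ, 1 ≤ j → j ≤ k → iteratedDeriv j (fun t => A 0 t) 0 = 0) :
    ∃ ε₁ δ' δ'' : ℝ, 0 < ε₁ ∧ ε₁ ≤ ε₀ ∧ 0 < δ' ∧ δ' ≤ δ₀ ∧ 0 < δ'' ∧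
    ∃ Φ : ℝ → ℂ × ℂ → ℂ × ℂ, ∃ u : ℝ → ℂ × ℂ → ℂ,
    ∃ α : Fin (k + 1) → ℝ → ℂ, ∃ Qt : ℂ → ℂ → ℝ → ℂ, ∃ gt : ℂ → ℝ → ℂ,
      (∀ i, ContinuousOn (α i) (Set.Ioo (-ε₁) ε₁)) ∧ (∀ i, α i 0 = 0) ∧
      Qt 0 0 0 = 0 ∧
      (∀ ε : ℝ, |ε| < ε₁ →
        DifferentiableOn ℂ (fun zt : ℂ × ℂ => Qt zt.1 zt.2 ε)
          (Metric.ball (0 : ℂ) δ'' ×ˢ Metric.ball (0 : ℂ) δ'') ∧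
        DifferentiableOn ℂ (fun t => gt t ε) (Metric.ball (0 : ℂ) δ'')) ∧
      ContinuousOn (fun w : (ℂ × ℂ) × ℝ => Qt w.1.1 w.1.2 w.2)
        ((Metric.ball (0 : ℂ) δ'' ×ˢ Metric.ball (0 : ℂ) δ'') ×ˢ Set.Ioo (-ε₁) ε₁) ∧
      ContinuousOn (fun w : ℂ × ℝ => gt w.1 w.2)
        (Metric.ball (0 : ℂ) δ'' ×ˢ Set.Ioo (-ε₁) ε₁) ∧
      ContinuousOn (fun w : (ℂ × ℂ) × ℝ => Φ w.2 w.1)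
        ((Metric.ball (0 : ℂ) δ' ×ˢ Metric.ball (0 : ℂ) δ') ×ˢ Set.Ioo (-ε₁) ε₁) ∧
      ContinuousOn (fun w : (ℂ × ℂ) × ℝ => u w.2 w.1)
        ((Metric.ball (0 : ℂ) δ' ×ˢ Metric.ball (0 : ℂ) δ') ×ˢ Set.Ioo (-ε₁) ε₁) ∧
      ∀ ε : ℝ, |ε| < ε₁ →
        DifferentiableOn ℂ (Φ ε) (Metric.ball (0 : ℂ) δ' ×ˢ Metric.ball (0 : ℂ) δ') ∧
        Set.InjOn (Φ ε) (Metric.ball (0 : ℂ) δ' ×ˢ Metric.ball (0 : ℂ) δ') ∧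
        DifferentiableOn ℂ (u ε) (Metric.ball (0 : ℂ) δ' ×ˢ Metric.ball (0 : ℂ) δ') ∧
        (∀ x ∈ (Metric.ball (0 : ℂ) δ' ×ˢ Metric.ball (0 : ℂ) δ' : Set (ℂ × ℂ)), u ε x ≠ 0) ∧
        ∀ x ∈ (Metric.ball (0 : ℂ) δ' ×ˢ Metric.ball (0 : ℂ) δ' : Set (ℂ × ℂ)),
          Φ ε x ∈ (Metric.ball (0 : ℂ) δ'' ×ˢ Metric.ball (0 : ℂ) δ'' : Set (ℂ × ℂ)) ∧
          fderiv ℂ (Φ ε) x (v ε x) =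
            u ε x • ((Φ ε x).1 * (1 + Qt (Φ ε x).1 (Φ ε x).2 ε)
                  + gt (Φ ε x).2 ε * ∏ i, ((Φ ε x).2 - α i ε),
                ∏ i, ((Φ ε x).2 - α i ε)) := by
  have hprod : ∀ r : ℝ, (ball (0 : ℂ) r ×ˢ ball (0 : ℂ) r : Set (ℂ × ℂ)) = ball 0 r := fun r =>
    ball_prod_same _ _ _
  simp only [hprod] at hvhol hvcont ⊢
  have h0ε₀ : (0 : ℝ) ∈ Ioo (-ε₀) ε₀ := ⟨by linarith, hε₀⟩
  have hf1 : HasFDerivAt (fun x => (v 0 x).1) (ContinuousLinearMap.fst ℂ ℂ ℂ) 0 := by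
    refine hasFDerivAt_fst_of_partial (A := A) ?_ (fun z t => by rw [hv0]) hAz ?_
    · exact ((hvhol 0 h0ε₀).differentiableAt (ball_mem_nhds _ hδ₀)).fst
    · simpa using hAt 1 le_rfl hk
  obtain ⟨e₁, r₁, he₁, he₁ε, hr₁, hr₁δ, φ, φz, φt, U, c, hφ0, hU0, hc0, hcc, hφc, hUc, hφs, hφ⟩ :=
    exists_preparation hk hε₀ hδ₀ (fun ε x => (v ε x).1) (fun ε x => (v ε x).2)
      (fun ε hε => (hvhol ε hε).fst) hvcont.fst (fun ε hε => (hvhol ε hε).snd) hvcont.snd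
      (by simpa [hA00, Prod.mk_zero_zero] using congrArg Prod.fst (hv0 0 0))
      hf1 (fun x => by rw [hv0 x.1 x.2])
  obtain ⟨e₂, he₂, hφe₂⟩ := Metric.eventually_nhds_iff.1 (hφs (r₁ / 8) (by positivity))
  have hdist : ∀ {a b ε : ℝ}, b ≤ a → ε ∈ Ioo (-b) b → dist ε 0 < a := fun hba hε => by
    rw [dist_zero_right, Real.norm_eq_abs]
    exact (abs_lt.2 hε).trans_le hba
  have hIoo : ∀ {a b : ℝ}, a ≤ b → Ioo (-a) a ⊆ Ioo (-b) b := fun h =>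
    Ioo_subset_Ioo (neg_le_neg h) h
  have hbb : ball (0 : ℂ × ℂ) (r₁ / 2) ⊆ ball 0 r₁ := ball_subset_ball (by linarith)
  set e₃ := min e₁ e₂ with he₃def
  have he₃ : 0 < e₃ := lt_min he₁ he₂
  have h31 : Ioo (-e₃) e₃ ⊆ Ioo (-e₁) e₁ := hIoo (min_le_left _ _)
  obtain ⟨τ, hτc, hτ⟩ := exists_fibre_inverse (e := e₃) (r := r₁) φ φz φt
    (fun ε hε x hx => (hφ ε (h31 hε) x hx).1) (fun ε hε x hx => (hφ ε (h31 hε) x hx).2.2.1)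
    (fun ε hε => hφe₂ (hdist (min_le_right _ _) hε)) (hφc.mono (prod_mono_right h31))
  have hU : ∀ ε ∈ Ioo (-e₁) e₁, ∀ x ∈ ball 0 r₁, U ε x ≠ 0 := by
    intro ε hε x hx h
    have := (hφ ε hε x hx).2.2.2.1
    rw [h] at this
    norm_num at this
  have hmem : ∀ ε ∈ Ioo (-e₃) e₃, ∀ x ∈ ball (0 : ℂ × ℂ) (r₁ / 2),
      ((x.1, τ ε x) : ℂ × ℂ) ∈ ball (0 : ℂ × ℂ) r₁ := fun ε hε x hx =>
    mem_ball_zero_prod.2 ⟨(mem_ball_zero_prod.1 (hbb hx)).1, (hτ ε hε x hx).1⟩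
  have hτ0 : ∀ x ∈ ball (0 : ℂ × ℂ) (r₁ / 2), τ 0 x = x.2 := fun x hx =>
    (hτ 0 ⟨by linarith, he₃⟩ x hx).2.2 _ (mem_ball_zero_prod.1 (hbb hx)).2 (by simp [hφ0])
  have h30 : Ioo (-e₃) e₃ ⊆ Ioo (-ε₀) ε₀ := h31.trans (hIoo he₁ε)
  set F : ℝ → ℂ × ℂ → ℂ := fun ε x => (v ε (x.1, τ ε x)).1 / U ε (x.1, τ ε x) with hF
  have hF0 : ∀ x ∈ ball (0 : ℂ × ℂ) (r₁ / 2), F 0 x = (v 0 x).1 := fun x hx => by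
    simp [hF, hU0, hτ0 x hx]
  obtain ⟨e₄, r₂, he₄, he₄₃, hr₂, hr₂₁, s, s', H, hs0, hH0, hsH, hsc, hs'c, hHc⟩ :=
    exists_graph_factor he₃ (half_pos hr₁) F
      (fun ε hε x hx => by
        have h1 : DifferentiableAt ℂ (fun x : ℂ × ℂ => ((x.1, τ ε x) : ℂ × ℂ)) x :=
          differentiableAt_fst.prodMk (hτ ε hε x hx).2.1
        have h2 : DifferentiableAt ℂ (v ε) (x.1, τ ε x) :=
          (hvhol ε (h30 hε)).differentiableAt
            (isOpen_ball.mem_nhds (ball_subset_ball hr₁δ (hmem ε hε x hx)))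
        have h3 := (hφ ε (h31 hε) _ (hmem ε hε x hx)).2.1
        simp only [hF, div_eq_mul_inv]
        have h4 : DifferentiableAt ℂ (fun x => U ε (x.1, τ ε x)) x := h3.comp x h1
        have h5 : DifferentiableAt ℂ (fun x => (v ε (x.1, τ ε x)).1) x := (h2.comp x h1).fst
        exact (h5.mul (h4.fun_inv (hU ε (h31 hε) _ (hmem ε hε x hx)))).differentiableWithinAt)
      (by
        have h1 : ContinuousOn (fun w : (ℂ × ℂ) × ℝ => (((w.1.1, τ w.2 w.1), w.2) : (ℂ × ℂ) × ℝ))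
            (ball 0 (r₁ / 2) ×ˢ Ioo (-e₃) e₃) :=
          ((continuousOn_fst.fst).prodMk hτc).prodMk continuousOn_snd
        exact (hvcont.fst.comp h1 fun w hw =>
          ⟨ball_subset_ball hr₁δ (hmem _ hw.2 _ hw.1), h30 hw.2⟩).div
          (hUc.comp h1 fun w hw => ⟨hmem _ hw.2 _ hw.1, h31 hw.2⟩)
          fun w hw => hU _ (h31 hw.2) _ (hmem _ hw.2 _ hw.1))
      (by
        rw [hF0 0 (mem_ball_self (half_pos hr₁))]
        simpa [hA00, Prod.mk_zero_zero] using congrArg Prod.fst (hv0 0 0))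
      (hf1.congr_of_eventuallyEq (by
        filter_upwards [ball_mem_nhds (0 : ℂ × ℂ) (half_pos hr₁)] with x hx using hF0 x hx))
  obtain ⟨e₅, he₅, hφe₅⟩ := Metric.eventually_nhds_iff.1 (hφs (r₂ / 8) (by positivity))
  set ε₁ := min e₄ e₅ / 2 with hε₁def
  have hm : 0 < min e₄ e₅ := lt_min he₄ he₅
  have hε₁ : 0 < ε₁ := half_pos hm
  have hε₁4 : ε₁ < e₄ := (half_lt_self hm).trans_le (min_le_left _ _)
  have hε₁5 : ε₁ < e₅ := (half_lt_self hm).trans_le (min_le_right _ _)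
  have h14 : Ioo (-ε₁) ε₁ ⊆ Ioo (-e₄) e₄ := hIoo hε₁4.le
  have h13 : Ioo (-ε₁) ε₁ ⊆ Ioo (-e₃) e₃ := h14.trans (hIoo he₄₃)
  have h11 : Ioo (-ε₁) ε₁ ⊆ Ioo (-e₁) e₁ := h13.trans h31
  obtain ⟨α, hα, hα0, hαp⟩ := exists_continuous_factorization (n := k) hε₁.le (c := c)
    (fun j => (hcc j).mono fun ε hε => (h31.trans' (hIoo he₄₃))
      ⟨by linarith [hε.1], by linarith [hε.2]⟩) hc0
  have hb81 : ball (0 : ℂ × ℂ) (r₂ / 8) ⊆ ball 0 r₁ := ball_subset_ball (by linarith)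
  have hT : ∀ ε ∈ Ioo (-ε₁) ε₁, ∀ x ∈ ball (0 : ℂ × ℂ) (r₂ / 8), ‖x.2 + φ ε x‖ < r₂ / 4 := by
    intro ε hε x hx
    have h1 := hφe₅ (hdist hε₁5.le hε) x (hb81 hx)
    have h2 := (mem_ball_zero_prod.1 hx).2
    exact (norm_add_le _ _).trans_lt (by linarith)
  have hTmem : ∀ ε ∈ Ioo (-ε₁) ε₁, ∀ x ∈ ball (0 : ℂ × ℂ) (r₂ / 8),
      ((x.1, x.2 + φ ε x) : ℂ × ℂ) ∈ ball (0 : ℂ × ℂ) r₂ := fun ε hε x hx =>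
    mem_ball_zero_prod.2 ⟨by linarith [(mem_ball_zero_prod.1 hx).1], by linarith [hT ε hε x hx]⟩
  have hT1 : ∀ ε ∈ Ioo (-ε₁) ε₁, ∀ x ∈ ball (0 : ℂ × ℂ) (r₂ / 8),
      x.2 + φ ε x ∈ ball (0 : ℂ) r₂ := fun ε hε x hx =>
    mem_ball_zero_iff.2 (by linarith [hT ε hε x hx])
  have hQ : ∀ ε ∈ Ioo (-ε₁) ε₁, ∀ x ∈ ball (0 : ℂ × ℂ) (r₂ / 2),
      x.2 ∈ ball (0 : ℂ) r₂ ∧ ((x.1 + s ε x.2, x.2) : ℂ × ℂ) ∈ ball (0 : ℂ × ℂ) r₂ := by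
    intro ε hε x hx
    obtain ⟨h1, h2⟩ := mem_ball_zero_prod.1 hx
    have h3 : x.2 ∈ ball (0 : ℂ) r₂ := mem_ball_zero_iff.2 (by linarith)
    have h4 := ((hsH ε (h14 hε)).2.1 x.2 h3).2
    exact ⟨h3, mem_ball_zero_prod.2 ⟨(norm_add_le _ _).trans_lt (by linarith), by linarith⟩⟩
  have hΦd : ∀ ε ∈ Ioo (-ε₁) ε₁, ∀ x ∈ ball (0 : ℂ × ℂ) (r₂ / 8),
      HasFDerivAt (fun x : ℂ × ℂ => ((x.1 - s ε (x.2 + φ ε x), x.2 + φ ε x) : ℂ × ℂ))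
        ((ContinuousLinearMap.fst ℂ ℂ ℂ - s' ε (x.2 + φ ε x) • (ContinuousLinearMap.snd ℂ ℂ ℂ
          + (φz ε x • ContinuousLinearMap.fst ℂ ℂ ℂ + φt ε x • ContinuousLinearMap.snd ℂ ℂ ℂ))).prod
        (ContinuousLinearMap.snd ℂ ℂ ℂ + (φz ε x • ContinuousLinearMap.fst ℂ ℂ ℂ
          + φt ε x • ContinuousLinearMap.snd ℂ ℂ ℂ))) x := by
    intro ε hε x hx
    have h1 := hasFDerivAt_snd.add (hφ ε (h11 hε) x (hb81 hx)).1
    have h2 := ((hsH ε (h14 hε)).2.1 _ (hT1 ε hε x hx)).1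
    exact (hasFDerivAt_fst.sub (h2.comp_hasFDerivAt x h1)).prodMk h1
  have hτT : ∀ ε ∈ Ioo (-ε₁) ε₁, ∀ x ∈ ball (0 : ℂ × ℂ) (r₂ / 8),
      τ ε (x.1, x.2 + φ ε x) = x.2 := fun ε hε x hx =>
    (hτ ε (h13 hε) _ (ball_subset_ball hr₂₁ (hTmem ε hε x hx))).2.2 _
      (mem_ball_zero_prod.1 (hb81 hx)).2 rfl
  have he₃₁ : e₃ ≤ e₁ := min_le_left _ _
  refine ⟨ε₁, r₂ / 8, r₂ / 2, hε₁, by linarith, by positivity, by linarith, by positivity,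
    fun ε x => (x.1 - s ε (x.2 + φ ε x), x.2 + φ ε x), U, α,
    fun Z T ε => H ε (Z + s ε T, T) - 1, fun T ε => -s' ε T, fun i => (hα i).continuousOn, hα0,
    by simp [hs0, hH0, Prod.mk_zero_zero], fun ε hε => ⟨fun x hx => ?_, ?_⟩, ?_, ?_, ?_, ?_,
    fun ε hε => ⟨fun x hx => ?_, fun x hx y hy hxy => ?_, fun x hx => ?_, fun x hx => ?_,
      fun x hx => ⟨?_, ?_⟩⟩⟩
  · have hε' : ε ∈ Ioo (-ε₁) ε₁ := abs_lt.1 hε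
    obtain ⟨h1, h2⟩ := hQ ε hε' x hx
    have h3 := ((hsH ε (h14 hε')).2.1 x.2 h1).1.differentiableAt
    have h4 : DifferentiableAt ℂ (H ε) (x.1 + s ε x.2, x.2) :=
      (hsH ε (h14 hε')).2.2.2.differentiableAt (isOpen_ball.mem_nhds h2)
    have h5 : DifferentiableAt ℂ (fun x : ℂ × ℂ => ((x.1 + s ε x.2, x.2) : ℂ × ℂ)) x :=
      (differentiableAt_fst.add (h3.comp x differentiableAt_snd)).prodMk differentiableAt_snd
    exact ((h4.comp x h5).sub_const 1).differentiableWithinAt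
  · have hε' : ε ∈ Ioo (-ε₁) ε₁ := abs_lt.1 hε
    exact (hsH ε (h14 hε')).2.2.1.neg.mono (ball_subset_ball (by linarith))
  · have h1 : ContinuousOn (fun w : (ℂ × ℂ) × ℝ => s w.2 w.1.2) (ball 0 (r₂ / 2) ×ˢ Ioo (-ε₁) ε₁) :=
      hsc.comp (f := fun w : (ℂ × ℂ) × ℝ => (w.1.2, w.2)) (by fun_prop) fun w hw =>
        ⟨(hQ _ hw.2 _ hw.1).1, h14 hw.2⟩
    have h2 : ContinuousOn (fun w : (ℂ × ℂ) × ℝ =>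
        (((w.1.1 + s w.2 w.1.2, w.1.2), w.2) : (ℂ × ℂ) × ℝ)) (ball 0 (r₂ / 2) ×ˢ Ioo (-ε₁) ε₁) :=
      ((continuousOn_fst.fst.add h1).prodMk continuousOn_fst.snd).prodMk continuousOn_snd
    exact (hHc.comp h2 fun w hw => ⟨(hQ _ hw.2 _ hw.1).2, h14 hw.2⟩).sub continuousOn_const
  · exact hs'c.neg.mono (prod_mono (ball_subset_ball (by linarith)) h14)
  · have h1 : ContinuousOn (fun w : (ℂ × ℂ) × ℝ => w.1.2 + φ w.2 w.1)
        (ball 0 (r₂ / 8) ×ˢ Ioo (-ε₁) ε₁) :=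
      continuousOn_fst.snd.add (hφc.mono (prod_mono hb81 h11))
    have h2 : ContinuousOn (fun w : (ℂ × ℂ) × ℝ => s w.2 (w.1.2 + φ w.2 w.1))
        (ball 0 (r₂ / 8) ×ˢ Ioo (-ε₁) ε₁) :=
      hsc.comp (h1.prodMk continuousOn_snd) fun w hw => ⟨hT1 _ hw.2 _ hw.1, h14 hw.2⟩
    exact (continuousOn_fst.fst.sub h2).prodMk h1
  · exact hUc.mono (prod_mono hb81 h11)
  · exact (hΦd ε (abs_lt.1 hε) x hx).differentiableAt.differentiableWithinAt
  · have hε' : ε ∈ Ioo (-ε₁) ε₁ := abs_lt.1 hε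
    obtain ⟨h1, h2⟩ := Prod.mk.inj hxy
    rw [h2] at h1
    have h3 : x.1 = y.1 := sub_left_injective h1
    have h4 := hτT ε hε' x hx
    rw [h2, h3, hτT ε hε' y hy] at h4
    exact Prod.ext h3 h4.symm
  · exact (hφ ε (h11 (abs_lt.1 hε)) x (hb81 hx)).2.1.differentiableWithinAt
  · exact hU ε (h11 (abs_lt.1 hε)) x (hb81 hx)
  · have hε' : ε ∈ Ioo (-ε₁) ε₁ := abs_lt.1 hε
    have h1 := hT ε hε' x hx
    have h2 := ((hsH ε (h14 hε')).2.1 _ (hT1 ε hε' x hx)).2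
    have h3 := (mem_ball_zero_prod.1 hx).1
    exact mem_ball_zero_prod.2 ⟨(norm_sub_le _ _).trans_lt (by linarith), by linarith⟩
  · have hε' : ε ∈ Ioo (-ε₁) ε₁ := abs_lt.1 hε
    have h1 := (hφ ε (h11 hε') x (hb81 hx)).2.2.2.2
    rw [hαp ε ⟨hε'.1.le, hε'.2.le⟩] at h1
    have h2 := (hsH ε (h14 hε')).1 _ (hTmem ε hε' x hx)
    have h3 := hU ε (h11 hε') x (hb81 hx)
    simp only [hF, hτT ε hε' x hx, Prod.mk.eta] at h2
    rw [div_eq_iff h3] at h2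
    rw [(hΦd ε hε' x hx).fderiv]
    ext
    · simp
      linear_combination h2 - s' ε (x.2 + φ ε x) * h1
    · simp
      linear_combination h1
end
end
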